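/- For each j = 1,…,m and n = 1,…,m, it holds that ∫_{B_R(x_{j,k})} λ_k V(x) e^{v_k(x)} · (w^n_k(x) − w^n_k(x_{j,k}))/μ^n_k dx = −16π c^n_j + o(1) as k → ∞. -/

import Mathlib

open MeasureTheory Real Filter Topology Metric Bornology
open scoped RealInnerProductSpace

noncomputable section

/-- The plane `ℝ²`. -/
abbrev E2 : Type := EuclideanSpace ℝ (Fin 2)

/-- The Laplacian of a function on the plane, as the sum of the second partial
derivatives in the coordinate directions. -/
def lap (f : E2 → ℝ) (x : E2) : ℝ :=
  ∑ i : Fin 2,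
    fderiv ℝ (fun y => fderiv ℝ f y (EuclideanSpace.single i 1)) x (EuclideanSpace.single i 1)

/-- `G` is the Dirichlet Green function of `-Δ` on `Ω`, with regular part `K`
(so that `x ↦ K x x` is the Robin function). -/
structure IsGreen (Ω : Set E2) (G K : E2 → E2 → ℝ) : Prop where
  symm : ∀ x y, G x y = G y x
  decomp : ∀ x ∈ Ω, ∀ y ∈ Ω, x ≠ y →
    G x y = -(1 / (2 * π)) * Real.log (dist x y) + K x y
  harmK : ∀ y ∈ Ω, ∀ x ∈ Ω, lap (fun z => K z y) x = 0
  harmG : ∀ y ∈ Ω, ∀ x ∈ Ω, x ≠ y → lap (fun z => G z y) x = 0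
  bdry : ∀ y ∈ Ω, ∀ x ∈ frontier Ω, G x y = 0
  contK : ContinuousOn (fun p : E2 × E2 => K p.1 p.2) (closure Ω ×ˢ Ω ∪ Ω ×ˢ closure Ω)

/-- The Hamiltonian `H^m_V` of the system of `m`-point vortices:
`H^m_V(x₁,…,x_m) = ½ Σᵢ R(xᵢ) + Σ_{i<j} G(xᵢ,xⱼ) + (1/8π) Σᵢ log V(xᵢ)`. -/
def Ham (m : ℕ) (G K : E2 → E2 → ℝ) (V : E2 → ℝ) (x : Fin m → E2) : ℝ :=
  (1 / 2) * ∑ i, K (x i) (x i)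
    + ∑ i, ∑ j, (if i < j then G (x i) (x j) else 0)
    + (1 / (8 * π)) * ∑ i, Real.log (V (x i))

/-- The standard bubble `U(x) = log (1/(1+|x|²/8)²)`. -/
def U (x : E2) : ℝ := Real.log (1 / (1 + ‖x‖ ^ 2 / 8) ^ 2)

/-- `Λ` lists the eigenvalues (with multiplicity, in nondecreasing order) of the real
symmetric matrix `M`, as witnessed by an orthonormal eigenbasis. -/
def IsEigList {N : ℕ} (M : Matrix (Fin N) (Fin N) ℝ) (Λ : Fin N → ℝ) : Prop :=
  Monotone Λ ∧ ∃ b : Fin N → (Fin N → ℝ),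
    (∀ i i', (∑ t, b i t * b i' t) = if i = i' then 1 else 0) ∧
    ∀ i, M.mulVec (b i) = Λ i • b i

/-- The standing setting: a family `v_k` of solutions of the Liouville–Gel'fand problem
`-Δv = λ_k V e^v` in `Ω`, `v = 0` on `∂Ω`, blowing up at the `m` interior points
`x*₁, …, x*_m`, with local maximum points `x_{j,k} → x*_j`. -/
structure Setting (m : ℕ) where
  /-- the bounded planar domain -/
  Ω : Set E2
  /-- the positive coefficient `V ∈ C¹(Ω̄)` -/
  V : E2 → ℝ
  /-- the parameters `λ_k ↓ 0` -/
  lam : ℕ → ℝ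
  /-- the blow-up solutions -/
  v : ℕ → E2 → ℝ
  /-- the Dirichlet Green function of `-Δ` on `Ω` -/
  G : E2 → E2 → ℝ
  /-- its regular part; `x ↦ K x x` is the Robin function -/
  K : E2 → E2 → ℝ
  /-- the blow-up points -/
  xstar : Fin m → E2
  /-- the local maximum points `x_{j,k}` -/
  xpt : Fin m → ℕ → E2
  /-- the fixed small radius -/
  R : ℝ
  hm : 0 < m
  hopen : IsOpen Ω
  hbd : IsBounded Ω
  hconn : IsConnected Ω
  hVpos : ∀ x ∈ closure Ω, 0 < V x
  hVreg : ContDiffOn ℝ 1 V (closure Ω)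
  hgreen : IsGreen Ω G K
  hlam_pos : ∀ k, 0 < lam k
  hlam_anti : StrictAnti lam
  hlam0 : Tendsto lam atTop (𝓝 0)
  hv_reg : ∀ k, ContDiffOn ℝ 2 (v k) Ω
  hv_cont : ∀ k, ContinuousOn (v k) (closure Ω)
  hPDE : ∀ k, ∀ x ∈ Ω, -lap (v k) x = lam k * V x * Real.exp (v k x)
  hBC : ∀ k, ∀ x ∈ frontier Ω, v k x = 0
  hblow : Tendsto (fun k => ⨆ x ∈ closure Ω, |v k x|) atTop atTop
  hmass : Tendsto (fun k => ∫ x in Ω, lam k * V x * Real.exp (v k x)) atTop (𝓝 (8 * π * m))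
  hx_mem : ∀ j, xstar j ∈ Ω
  hx_inj : Function.Injective xstar
  hS : {x ∈ closure Ω | ∃ z : ℕ → E2, (∀ k, z k ∈ Ω) ∧ Tendsto z atTop (𝓝 x) ∧
      Tendsto (fun k => v k (z k)) atTop atTop} = Set.range xstar
  hR : 0 < R
  hR2 : ∀ j, closedBall (xstar j) (2 * R) ⊆ Ω
  hRdisj : ∀ i j, i ≠ j → Disjoint (ball (xstar i) R) (ball (xstar j) R)
  hxpt_lim : ∀ j, Tendsto (fun k => xpt j k) atTop (𝓝 (xstar j))
  hxpt_mem : ∀ j k, xpt j k ∈ ball (xstar j) R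
  hxpt_max : ∀ j k, ∀ x ∈ ball (xpt j k) R, v k x ≤ v k (xpt j k)
  hxpt_blow : ∀ j, Tendsto (fun k => v k (xpt j k)) atTop atTop

namespace Setting

variable {m : ℕ}

/-- The scaling parameter `δ_{j,k} > 0`, defined by
`λ_k V(x_{j,k}) e^{v_k(x_{j,k})} δ_{j,k}² = 1`. -/
def delta (S : Setting m) (j : Fin m) (k : ℕ) : ℝ :=
  (Real.sqrt (S.lam k * S.V (S.xpt j k) * Real.exp (S.v k (S.xpt j k))))⁻¹

/-- The local mass `σ_{j,k} = ∫_{B_R(x_{j,k})} λ_k V e^{v_k}`. -/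
def sigmaLoc (S : Setting m) (j : Fin m) (k : ℕ) : ℝ :=
  ∫ x in ball (S.xpt j k) S.R, S.lam k * S.V x * Real.exp (S.v k x)

/-- The entries of the matrix `(h_{ij})`:
`h_{ii} = R(x*_i) + 2 Σ_{h ≠ i} G(x*_h, x*_i) + (1/4π) log V(x*_i)`,
`h_{ij} = -G(x*_i, x*_j)` for `i ≠ j`. -/
def hEnt (S : Setting m) (i j : Fin m) : ℝ :=
  if i = j then
    S.K (S.xstar i) (S.xstar i)
      + 2 * ∑ h, (if h = i then 0 else S.G (S.xstar h) (S.xstar i))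
      + 1 / (4 * π) * Real.log (S.V (S.xstar i))
  else -S.G (S.xstar i) (S.xstar j)

/-- The matrix `(h_{ij})`. -/
def hmat (S : Setting m) : Matrix (Fin m) (Fin m) ℝ := Matrix.of S.hEnt

end Setting

/-- The eigenpairs `(μⁿ_k, wⁿ_k)` of the linearized problem
`-Δw = μ λ_k V e^{v_k} w` in `Ω`, `w = 0` on `∂Ω`, indexed by `n = 1, 2, …`,
normalized by `‖wⁿ_k‖_∞ = max wⁿ_k = 1`, ordered, and orthogonal in `H¹₀`. -/
structure EigenData {m : ℕ} (S : Setting m) where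
  /-- the `n`-th eigenvalue `μⁿ_k` (`n ≥ 1`) -/
  mu : ℕ → ℕ → ℝ
  /-- the `n`-th eigenfunction `wⁿ_k` -/
  w : ℕ → ℕ → E2 → ℝ
  hw_reg : ∀ n k, ContDiffOn ℝ 2 (w n k) S.Ω
  hw_cont : ∀ n k, ContinuousOn (w n k) (closure S.Ω)
  hPDE : ∀ n k, ∀ x ∈ S.Ω,
    -lap (w n k) x = mu n k * S.lam k * S.V x * Real.exp (S.v k x) * w n k x
  hBC : ∀ n k, ∀ x ∈ frontier S.Ω, w n k x = 0
  hbound : ∀ n k, ∀ x ∈ closure S.Ω, |w n k x| ≤ 1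
  hmax : ∀ n k, ∃ x ∈ closure S.Ω, w n k x = 1
  hpos : ∀ k, 0 < mu 1 k
  hlt : ∀ k, mu 1 k < mu 2 k
  hmono : ∀ k n, 2 ≤ n → mu n k ≤ mu (n + 1) k
  hdiv : ∀ k, Tendsto (fun n => mu n k) atTop atTop
  horth : ∀ k n n', 1 ≤ n → 1 ≤ n' → n ≠ n' →
    (∫ x in S.Ω, ⟪gradient (w n k) x, gradient (w n' k) x⟫) = 0

/-- `c = (c₁,…,c_m) ≠ 0` is the limit vector of the rescaled `n`-th eigenfunctions
`w̃ⁿ_{j,k}(x) = wⁿ_k(δ_{j,k} x + x_{j,k}) → c_j` locally uniformly in `ℝ²`,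
along the subsequence `φ`. -/
def IsLimitVec {m : ℕ} (S : Setting m) (W : EigenData S) (φ : ℕ → ℕ) (n : ℕ)
    (c : Fin m → ℝ) : Prop :=
  c ≠ 0 ∧ ∀ j : Fin m,
    TendstoLocallyUniformly
      (fun k (x : E2) => W.w n (φ k) (S.delta j (φ k) • x + S.xpt j (φ k)))
      (fun _ => c j) atTop

/-- A sequence of (eigen)functions `w_k` concentrates at `κ`: there are `C > 0`
and `κ_k → κ` in `Ω` with `|w_k(κ_k)| ≥ C` for `k ≫ 1`. -/
def ConcentratesAt {m : ℕ} (S : Setting m) (wk : ℕ → E2 → ℝ) (κ : E2) : Prop :=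
  ∃ C > 0, ∃ z : ℕ → E2, (∀ k, z k ∈ S.Ω) ∧ Tendsto z atTop (𝓝 κ) ∧
    ∀ᶠ k in atTop, C ≤ |wk k (z k)|

/-- The index `j` of the coordinate pair to which the `i`-th coordinate of
`ℝ^{2m} ≃ (ℝ²)^m` belongs. -/
def coordIdx {m : ℕ} (i : Fin (2 * m)) : Fin m := ⟨i.1 / 2, by have h := i.isLt; omega⟩

/-- The `i`-th coordinate direction of `(ℝ²)^m ≃ ℝ^{2m}`. -/
def coordBasis (m : ℕ) (i : Fin (2 * m)) : Fin m → E2 :=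
  Pi.single (coordIdx i) (EuclideanSpace.single ⟨i.1 % 2, by omega⟩ 1)

/-- The Hessian of the Hamiltonian `H^m_V` at `x0`, as a `2m × 2m` array of second
directional derivatives. -/
def hessHam (m : ℕ) (G K : E2 → E2 → ℝ) (V : E2 → ℝ) (x0 : Fin m → E2)
    (i j : Fin (2 * m)) : ℝ :=
  fderiv ℝ (fun x => fderiv ℝ (Ham m G K V) x (coordBasis m j)) x0 (coordBasis m i)

noncomputable section


set_option linter.unusedSectionVars false

section kernel

variable {E : Type*} [NormedAddCommGroup E] [InnerProductSpace ℝ E] [FiniteDimensional ℝ E]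
  [MeasureSpace E] [BorelSpace E] [(volume : Measure E).IsAddHaarMeasure]

/-- the logarithmic kernel, normalized at the origin -/
def kk (x y : E) : ℝ := Real.log ‖x - y‖ - Real.log ‖y‖

/-- the integral of a negative power of the norm over the unit ball -/
def JJ (E : Type*) [NormedAddCommGroup E] [MeasureSpace E] (a : ℝ) : ℝ :=
  ∫ y in ball (0 : E) 1, ‖y‖ ^ (-a)

theorem JJ_nonneg (a : ℝ) : 0 ≤ JJ E a := by
  unfold JJ
  apply setIntegral_nonneg_of_ae
  exact Eventually.of_forall fun y => by positivity

theorem integrableOn_norm_rpow (hd : Module.finrank ℝ E = 2) {a : ℝ} (ha : a < 2) (r : ℝ) :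
    IntegrableOn (fun y : E => ‖y‖ ^ (-a)) (ball 0 r) := by
  have : Nontrivial E := Module.nontrivial_of_finrank_pos (R := ℝ) (by omega)
  rw [integrableOn_fun_norm_addHaar volume (f := fun t : ℝ => t ^ (-a))]
  rcases le_or_gt r 0 with hr | hr
  · rw [Set.Ioo_eq_empty (by linarith)]; simp
  have h1 : IntervalIntegrable (fun t : ℝ => t ^ (1 - a)) volume 0 r :=
    intervalIntegral.intervalIntegrable_rpow' (by linarith)
  rw [intervalIntegrable_iff_integrableOn_Ioo_of_le hr.le] at h1
  refine h1.congr_fun ?_ measurableSet_Ioo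
  intro t ht
  simp only [hd, smul_eq_mul]
  rw [sub_eq_add_neg, Real.rpow_add ht.1]; simp

theorem integrableOn_sub_rpow (hd : Module.finrank ℝ E = 2) {a : ℝ} (ha : a < 2) (r : ℝ) (x : E) :
    IntegrableOn (fun y : E => ‖x - y‖ ^ (-a)) (ball x r) ∧
      (∫ y in ball x r, ‖x - y‖ ^ (-a)) = ∫ y in ball (0 : E) r, ‖y‖ ^ (-a) := by
  have hmp : MeasurePreserving (fun y : E => y - x) volume volume :=
    measurePreserving_sub_right volume x
  have hme : MeasurableEmbedding (fun y : E => y - x) :=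
    (Homeomorph.subRight x).measurableEmbedding
  have hpre : (fun y : E => y - x) ⁻¹' (ball 0 r) = ball x r := by
    ext y; simp [dist_eq_norm]
  have h1 := (hmp.integrableOn_comp_preimage hme (f := fun y : E => ‖y‖ ^ (-a)) (s := ball 0 r)).2
    (integrableOn_norm_rpow hd ha r)
  have h2 := hmp.setIntegral_preimage_emb hme (fun y : E => ‖y‖ ^ (-a)) (ball 0 r)
  rw [hpre] at h1 h2
  constructor
  · refine h1.congr_fun ?_ measurableSet_ball
    intro y _; simp [norm_sub_rev]
  · rw [← h2]
    refine setIntegral_congr_fun measurableSet_ball ?_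
    intro y _; simp [norm_sub_rev]

/-- weak-singularity potential bound -/
theorem pot_bound (hd : Module.finrank ℝ E = 2) {a : ℝ} (ha0 : 0 ≤ a) (ha : a < 2) {P : E → ℝ}
    (hP0 : ∀ y, 0 ≤ P y) (hPi : Integrable P) {C0 : ℝ} (x : E)
    (hC : ∀ y ∈ ball x 1, P y ≤ C0) :
    Integrable (fun y => ‖x - y‖ ^ (-a) * P y) ∧
      (∫ y, ‖x - y‖ ^ (-a) * P y) ≤ C0 * JJ E a + ∫ y, P y := by
  obtain ⟨h1, h2⟩ := integrableOn_sub_rpow hd ha 1 x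
  have hC0 : 0 ≤ C0 := (hP0 x).trans (hC x (mem_ball_self one_pos))
  have hdom : Integrable (fun y => (ball x 1).indicator (fun y => ‖x - y‖ ^ (-a) * C0) y + P y) :=
    (((integrable_indicator_iff measurableSet_ball).2 (h1.mul_const C0))).add hPi
  have hle : ∀ y, ‖x - y‖ ^ (-a) * P y ≤
      (ball x 1).indicator (fun y => ‖x - y‖ ^ (-a) * C0) y + P y := by
    intro y
    by_cases hy : y ∈ ball x 1
    · rw [Set.indicator_of_mem hy]
      have := mul_le_mul_of_nonneg_left (hC y hy) (Real.rpow_nonneg (norm_nonneg (x - y)) (-a))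
      linarith [hP0 y]
    · rw [Set.indicator_of_notMem hy, zero_add]
      have h3 : 1 ≤ ‖x - y‖ := by
        rw [mem_ball, not_lt, dist_eq_norm, norm_sub_rev] at hy; exact hy
      have h4 : ‖x - y‖ ^ (-a) ≤ 1 := Real.rpow_le_one_of_one_le_of_nonpos h3 (by linarith)
      nlinarith [hP0 y]
  have hmeas : AEStronglyMeasurable (fun y => ‖x - y‖ ^ (-a) * P y) volume := by
    refine AEStronglyMeasurable.mul ?_ hPi.1
    exact (Measurable.pow_const (by fun_prop) _).aestronglyMeasurable
  have hintg : Integrable (fun y => ‖x - y‖ ^ (-a) * P y) := by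
    refine hdom.mono' hmeas (Eventually.of_forall fun y => ?_)
    rw [Real.norm_of_nonneg (mul_nonneg (Real.rpow_nonneg (norm_nonneg _) _) (hP0 y))]
    exact hle y
  refine ⟨hintg, (integral_mono hintg hdom hle).trans ?_⟩
  rw [integral_add ((integrable_indicator_iff measurableSet_ball).2 (h1.mul_const C0)) hPi,
    integral_indicator measurableSet_ball, integral_mul_const, h2, mul_comm]
  rfl

theorem log_diff_bound {x x' y : E} (h : y ≠ x) (h' : y ≠ x') :
    |Real.log ‖x - y‖ - Real.log ‖x' - y‖| ≤ ‖x - x'‖ * (‖x - y‖⁻¹ + ‖x' - y‖⁻¹) := by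
  have ha : 0 < ‖x - y‖ := norm_pos_iff.2 (sub_ne_zero.2 h.symm)
  have hb : 0 < ‖x' - y‖ := norm_pos_iff.2 (sub_ne_zero.2 h'.symm)
  have hab : |‖x - y‖ - ‖x' - y‖| ≤ ‖x - x'‖ := by
    have := abs_norm_sub_norm_le (x - y) (x' - y)
    simpa using this
  set a := ‖x - y‖
  set b := ‖x' - y‖
  set d := ‖x - x'‖
  have hab' := abs_le.1 hab
  have key : ∀ s t : ℝ, 0 < s → 0 < t → s - t ≤ d → Real.log s - Real.log t ≤ d * t⁻¹ := by
    intro s t hs ht hst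
    rw [← Real.log_div hs.ne' ht.ne']
    have := Real.log_le_sub_one_of_pos (div_pos hs ht)
    have h2 : s / t - 1 = (s - t) * t⁻¹ := by field_simp
    rw [h2] at this
    exact this.trans (mul_le_mul_of_nonneg_right hst (by positivity))
  have hd0 : 0 ≤ d := norm_nonneg _
  have h1 := key a b ha hb (by linarith)
  have h2 := key b a hb ha (by linarith)
  have h3 : 0 ≤ d * a⁻¹ := by positivity
  have h4 : 0 ≤ d * b⁻¹ := by positivity
  rw [abs_le]; constructor <;> linarith

theorem log_diff_bound_ae (hd : Module.finrank ℝ E = 2) (x x' : E) : ∀ᵐ y : E,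
    |Real.log ‖x - y‖ - Real.log ‖x' - y‖| ≤ ‖x - x'‖ * (‖x - y‖ ^ (-1 : ℝ) + ‖x' - y‖ ^ (-1 : ℝ)) := by
  have : Nontrivial E := Module.nontrivial_of_finrank_pos (R := ℝ) (by omega)
  have h1 : ∀ᵐ y : E, y ≠ x := by simp [ae_iff, measure_singleton]
  have h2 : ∀ᵐ y : E, y ≠ x' := by simp [ae_iff, measure_singleton]
  filter_upwards [h1, h2] with y hy hy'
  simpa [Real.rpow_neg_one] using log_diff_bound hy hy'

/-- difference of logarithmic potentials -/
theorem log_pot_diff (hd : Module.finrank ℝ E = 2) {P Q : E → ℝ}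
    (hP0 : ∀ y, 0 ≤ P y) (hPi : Integrable P) (hQm : AEStronglyMeasurable Q)
    (hQ : ∀ y, |Q y| ≤ P y) {C0 : ℝ} (x x' : E)
    (hC : ∀ y ∈ ball x 1, P y ≤ C0) (hC' : ∀ y ∈ ball x' 1, P y ≤ C0) :
    Integrable (fun y => (Real.log ‖x - y‖ - Real.log ‖x' - y‖) * Q y) ∧
      |∫ y, (Real.log ‖x - y‖ - Real.log ‖x' - y‖) * Q y| ≤
        ‖x - x'‖ * (2 * (C0 * JJ E 1 + ∫ y, P y)) := by
  obtain ⟨i1, b1⟩ := pot_bound hd zero_le_one one_lt_two hP0 hPi x hC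
  obtain ⟨i2, b2⟩ := pot_bound hd zero_le_one one_lt_two hP0 hPi x' hC'
  have hdom : Integrable (fun y => ‖x - x'‖ * (‖x - y‖ ^ (-1 : ℝ) * P y + ‖x' - y‖ ^ (-1 : ℝ) * P y)) :=
    (i1.add i2).const_mul _
  have hmeas : AEStronglyMeasurable (fun y => (Real.log ‖x - y‖ - Real.log ‖x' - y‖) * Q y) volume := by
    refine AEStronglyMeasurable.mul ?_ hQm
    exact (Measurable.sub (Real.measurable_log.comp (by fun_prop))
      (Real.measurable_log.comp (by fun_prop))).aestronglyMeasurable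
  have hle : ∀ᵐ y, ‖(Real.log ‖x - y‖ - Real.log ‖x' - y‖) * Q y‖ ≤
      ‖x - x'‖ * (‖x - y‖ ^ (-1 : ℝ) * P y + ‖x' - y‖ ^ (-1 : ℝ) * P y) := by
    filter_upwards [log_diff_bound_ae hd x x'] with y hy
    rw [Real.norm_eq_abs, abs_mul]
    calc _ ≤ (‖x - x'‖ * (‖x - y‖ ^ (-1 : ℝ) + ‖x' - y‖ ^ (-1 : ℝ))) * P y :=
          mul_le_mul hy (hQ y) (abs_nonneg _) (by positivity)
      _ = _ := by ring
  have hintg := hdom.mono' hmeas hle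
  refine ⟨hintg, ?_⟩
  rw [← Real.norm_eq_abs]
  refine (norm_integral_le_of_norm_le hdom hle).trans ?_
  rw [integral_const_mul, integral_add i1 i2]
  exact mul_le_mul_of_nonneg_left (by linarith) (norm_nonneg _)

theorem kk_pot (hd : Module.finrank ℝ E = 2) {P Q : E → ℝ}
    (hP0 : ∀ y, 0 ≤ P y) (hPi : Integrable P) (hQm : AEStronglyMeasurable Q)
    (hQ : ∀ y, |Q y| ≤ P y) {C0 : ℝ} (x : E)
    (hC : ∀ y ∈ ball x 1, P y ≤ C0) (hC' : ∀ y ∈ ball (0 : E) 1, P y ≤ C0) :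
    Integrable (fun y => kk x y * Q y) ∧
      |∫ y, kk x y * Q y| ≤ ‖x‖ * (2 * (C0 * JJ E 1 + ∫ y, P y)) := by
  have := log_pot_diff hd hP0 hPi hQm hQ x 0 hC hC'
  simpa [kk] using this

/-- tail bound for the kernel -/
theorem kk_tail (hd : Module.finrank ℝ E = 2) {x : E} {T : ℝ} (hT : 0 < T) (hxT : 2 * ‖x‖ ≤ T) :
    ∀ᵐ y : E, T ≤ ‖y‖ → |kk x y| ≤ 3 * ‖x‖ / T := by
  filter_upwards [log_diff_bound_ae hd x 0] with y hy hTy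
  have h1 : ‖y‖ / 2 ≤ ‖x - y‖ := by
    have := norm_sub_norm_le y x
    rw [norm_sub_rev] at this; linarith
  have hy0 : 0 < ‖y‖ := hT.trans_le hTy
  have h2 : ‖x - y‖⁻¹ ≤ 2 * T⁻¹ := by
    calc ‖x - y‖⁻¹ ≤ (T / 2)⁻¹ := inv_anti₀ (by linarith) (by linarith)
      _ = 2 * T⁻¹ := by field_simp
  have h3 : ‖y‖⁻¹ ≤ T⁻¹ := inv_anti₀ hT hTy
  simp only [zero_sub, norm_neg, sub_zero, Real.rpow_neg_one] at hy
  refine hy.trans ?_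
  calc ‖x‖ * (‖x - y‖⁻¹ + ‖y‖⁻¹) ≤ ‖x‖ * (3 * T⁻¹) :=
        mul_le_mul_of_nonneg_left (by linarith) (norm_nonneg _)
    _ = _ := by ring

end kernel

end

noncomputable section


set_option linter.unusedSectionVars false

section kernel2

variable {E : Type*} [NormedAddCommGroup E] [InnerProductSpace ℝ E] [FiniteDimensional ℝ E]
  [MeasureSpace E] [BorelSpace E] [(volume : Measure E).IsAddHaarMeasure]

theorem measurable_kk (x : E) : Measurable (fun y : E => kk x y) := by
  unfold kk
  exact Measurable.sub (Real.measurable_log.comp (by fun_prop))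
      (Real.measurable_log.comp (by fun_prop))

theorem kk_integrableOn (hd : Module.finrank ℝ E = 2) (x : E) (T : ℝ) :
    IntegrableOn (fun y : E => kk x y) (ball 0 T) := by
  have h := (kk_pot hd (P := (ball (0 : E) T).indicator (fun _ => (1 : ℝ)))
    (Q := (ball (0 : E) T).indicator (fun _ => (1 : ℝ))) (C0 := 1)
    (fun y => Set.indicator_nonneg (fun _ _ => zero_le_one) y)
    ((integrable_indicator_iff measurableSet_ball).2
      (integrableOn_const (measure_ball_lt_top).ne))
    (aestronglyMeasurable_const.indicator measurableSet_ball)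
    (fun y => by rw [abs_of_nonneg]; exact Set.indicator_nonneg (fun _ _ => zero_le_one) y) x
    (fun y _ => Set.indicator_le' (fun _ _ => le_rfl) (fun _ _ => zero_le_one) y)
    (fun y _ => Set.indicator_le' (fun _ _ => le_rfl) (fun _ _ => zero_le_one) y)).1
  rw [← integrable_indicator_iff measurableSet_ball]
  refine h.congr (Eventually.of_forall fun y => ?_)
  by_cases hy : y ∈ ball (0 : E) T <;> simp [Set.indicator, hy]

theorem kk_tail_int (hd : Module.finrank ℝ E = 2) {x : E} {T M : ℝ} (hT : 0 < T)
    (hxT : 2 * ‖x‖ ≤ T) {P Q : E → ℝ} (hPi : Integrable P) (hP0 : ∀ y, 0 ≤ P y)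
    (hQ : ∀ y, |Q y| ≤ P y) (hM : ∫ y, P y ≤ M) :
    |∫ y in (ball (0 : E) T)ᶜ, kk x y * Q y| ≤ 3 * ‖x‖ / T * M := by
  rw [← Real.norm_eq_abs]
  have h1 : ‖∫ y in (ball (0 : E) T)ᶜ, kk x y * Q y‖ ≤
      ∫ y in (ball (0 : E) T)ᶜ, 3 * ‖x‖ / T * P y := by
    refine norm_integral_le_of_norm_le (hPi.integrableOn.const_mul _) ?_
    rw [ae_restrict_iff' measurableSet_ball.compl]
    filter_upwards [kk_tail hd hT hxT] with y hy hyT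
    have hyT' : T ≤ ‖y‖ := by simpa using hyT
    rw [norm_mul, Real.norm_eq_abs, Real.norm_eq_abs]
    exact mul_le_mul (hy hyT') (hQ y) (abs_nonneg _) (by positivity)
  refine h1.trans ?_
  rw [integral_const_mul]
  refine mul_le_mul_of_nonneg_left ?_ (by positivity)
  exact (setIntegral_le_integral hPi (Eventually.of_forall hP0)).trans hM

/-- passing to the limit in logarithmic potentials -/
theorem kk_lim (hd : Module.finrank ℝ E = 2) {P Q : ℕ → E → ℝ} {q : E → ℝ} {C0 M : ℝ}
    {r : ℕ → ℝ} (hr : Tendsto r atTop atTop)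
    (hP0 : ∀ k y, 0 ≤ P k y) (hPi : ∀ k, Integrable (P k)) (hM : ∀ k, ∫ y, P k y ≤ M)
    (hC : ∀ k, ∀ y ∈ ball (0 : E) (r k), P k y ≤ C0)
    (hQm : ∀ k, AEStronglyMeasurable (Q k)) (hQ : ∀ k y, |Q k y| ≤ P k y)
    (hqi : Integrable q) (hlim : ∀ y, Tendsto (fun k => Q k y) atTop (𝓝 (q y))) (x : E) :
    Tendsto (fun k => ∫ y, kk x y * Q k y) atTop (𝓝 (∫ y, kk x y * q y)) := by
  have hqC : ∀ y, |q y| ≤ C0 := by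
    intro y
    refine le_of_tendsto (hlim y).abs ?_
    filter_upwards [hr.eventually_gt_atTop ‖y‖] with k hk
    exact (hQ k y).trans (hC k y (by simpa using hk))
  have hC0 : 0 ≤ C0 := (abs_nonneg _).trans (hqC 0)
  have hqpot := kk_pot hd (P := fun y => |q y|) (Q := q) (fun y => abs_nonneg _) hqi.abs hqi.1
    (fun y => le_rfl) x (fun y _ => hqC y) (fun y _ => hqC y)
  set M' := max M (∫ y, |q y|) with hM'
  have hM'0 : 0 ≤ M' := (integral_nonneg fun y => abs_nonneg (q y)).trans (le_max_right _ _)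
  rw [Metric.tendsto_atTop]
  intro ε hε
  obtain ⟨T, hT1, hT2⟩ : ∃ T : ℝ, 2 * ‖x‖ + 1 ≤ T ∧ 3 * ‖x‖ / T * M' < ε / 3 := by
    have : Tendsto (fun T : ℝ => 3 * ‖x‖ / T * M') atTop (𝓝 0) := by
      have := (tendsto_const_nhds (x := 3 * ‖x‖)).div_atTop tendsto_id
      simpa using this.mul_const M'
    obtain ⟨T, h1, h2⟩ := ((eventually_ge_atTop (2 * ‖x‖ + 1)).and
      (this.eventually (gt_mem_nhds (by positivity : (0 : ℝ) < ε / 3)))).exists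
    exact ⟨T, h1, h2⟩
  have hT : 0 < T := by linarith [norm_nonneg x]
  have hloc : Tendsto (fun k => ∫ y in ball (0 : E) T, kk x y * Q k y) atTop
      (𝓝 (∫ y in ball (0 : E) T, kk x y * q y)) := by
    refine tendsto_integral_filter_of_dominated_convergence (fun y => |kk x y| * C0) ?_ ?_ ?_ ?_
    · exact Eventually.of_forall fun k =>
        ((measurable_kk x).aestronglyMeasurable.mul (hQm k)).restrict
    · filter_upwards [hr.eventually_ge_atTop T] with k hk
      rw [ae_restrict_iff' measurableSet_ball]
      refine Eventually.of_forall fun y hy => ?_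
      rw [norm_mul, Real.norm_eq_abs, Real.norm_eq_abs]
      exact mul_le_mul_of_nonneg_left
        ((hQ k y).trans (hC k y (ball_subset_ball hk hy))) (abs_nonneg _)
    · exact (kk_integrableOn hd x T).abs.mul_const _
    · exact Eventually.of_forall fun y => (hlim y).const_mul _
  obtain ⟨N, hN⟩ := (Metric.tendsto_atTop.1 hloc) (ε / 3) (by positivity)
  obtain ⟨N2, hN2⟩ := eventually_atTop.1 (hr.eventually_ge_atTop (‖x‖ + 1))
  refine ⟨max N N2, fun k hk => ?_⟩
  have hk1 := hN k (le_of_max_le_left hk)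
  have hk2 := hN2 k (le_of_max_le_right hk)
  have hintg := (kk_pot hd (hP0 k) (hPi k) (hQm k) (hQ k) x
    (fun y hy => hC k y (by
      rw [mem_ball, dist_zero_right]; rw [mem_ball, dist_eq_norm] at hy
      have := norm_sub_norm_le y x
      linarith))
    (fun y hy => hC k y (ball_subset_ball (by linarith [norm_nonneg x]) hy))).1
  have t1 := kk_tail_int hd hT (by linarith : 2 * ‖x‖ ≤ T) (hPi k) (hP0 k) (hQ k)
    ((hM k).trans (le_max_left M (∫ y, |q y|)))
  have t2 := kk_tail_int hd hT (by linarith : 2 * ‖x‖ ≤ T) hqi.abs (fun y => abs_nonneg (q y))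
    (fun y => le_rfl) (le_max_right M (∫ y, |q y|))
  rw [← integral_add_compl measurableSet_ball hintg,
    ← integral_add_compl measurableSet_ball hqpot.1]
  rw [Real.dist_eq] at hk1 ⊢
  rw [abs_lt] at hk1 ⊢
  have t1' := abs_le.1 t1
  have t2' := abs_le.1 t2
  constructor <;> linarith

/-- logarithmic decay of potentials -/
theorem kk_decay (hd : Module.finrank ℝ E = 2) {P : E → ℝ} (hP0 : ∀ y, 0 ≤ P y)
    (hPi : Integrable P) {C0 M L m0 e : ℝ} (hL : 1 ≤ L) (x : E)
    (hC : ∀ y ∈ ball x 1, P y ≤ C0) (hC' : ∀ y ∈ ball (0 : E) 1, P y ≤ C0)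
    (hM : ∫ y, P y ≤ M) (hm0 : m0 ≤ ∫ y in ball (0 : E) L, P y)
    (he : ∫ y in (ball (0 : E) L)ᶜ, P y ≤ e) (hx : 2 * L ≤ ‖x‖) :
    -(∫ y, kk x y * P y) ≤ -(m0 - e) * Real.log ‖x‖ +
      ((Real.log L + Real.log 2 + Real.log 3) * M + C0 * JJ E 1) := by
  have : Nontrivial E := Module.nontrivial_of_finrank_pos (R := ℝ) (by omega)
  have hx0 : 0 < ‖x‖ := by linarith
  have hlx : 0 ≤ Real.log ‖x‖ := Real.log_nonneg (by linarith)
  have hlL : 0 ≤ Real.log L := Real.log_nonneg hL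
  have hl2 : 0 ≤ Real.log 2 := Real.log_nonneg (by norm_num)
  have hl3 : 0 ≤ Real.log 3 := Real.log_nonneg (by norm_num)
  have hC0 : 0 ≤ C0 := (hP0 x).trans (hC x (mem_ball_self one_pos))
  have hintg := (kk_pot hd hP0 hPi hPi.1 (fun y => (abs_of_nonneg (hP0 y)).le) x hC hC').1
  obtain ⟨h1, h2⟩ := integrableOn_sub_rpow hd (one_lt_two) 1 x
  set K := Real.log L + Real.log 2 + Real.log 3 with hK
  have i1 : Integrable (fun y => K * P y) := hPi.const_mul K
  have i2 : Integrable ((ball (0 : E) L).indicator fun y => Real.log ‖x‖ * P y) :=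
    (hPi.const_mul _).indicator measurableSet_ball
  have i3 : Integrable ((ball (0 : E) L)ᶜ.indicator fun y => Real.log ‖x‖ * P y) :=
    (hPi.const_mul _).indicator measurableSet_ball.compl
  have i4 : Integrable ((ball x 1).indicator fun y => ‖x - y‖ ^ (-1 : ℝ) * C0) :=
    (integrable_indicator_iff measurableSet_ball).2 (h1.mul_const C0)
  have hle : ∀ᵐ y : E, -(kk x y * P y) ≤ (K * P y -
      (ball (0 : E) L).indicator (fun y => Real.log ‖x‖ * P y) y) +
      ((ball (0 : E) L)ᶜ.indicator (fun y => Real.log ‖x‖ * P y) y +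
      (ball x 1).indicator (fun y => ‖x - y‖ ^ (-1 : ℝ) * C0) y) := by
    have e1 : ∀ᵐ y : E, y ≠ x := by simp [ae_iff, measure_singleton]
    have e2 : ∀ᵐ y : E, y ≠ 0 := by simp [ae_iff, measure_singleton]
    filter_upwards [e1, e2] with y hyx hy0
    have ny : 0 < ‖y‖ := norm_pos_iff.2 hy0
    have nxy : 0 < ‖x - y‖ := norm_pos_iff.2 (sub_ne_zero.2 hyx.symm)
    have hind : 0 ≤ (ball x 1).indicator (fun y => ‖x - y‖ ^ (-1 : ℝ) * C0) y :=
      Set.indicator_nonneg (fun y _ => by positivity) y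
    have hPy := hP0 y
    by_cases hy : y ∈ ball (0 : E) L
    · rw [Set.indicator_of_mem hy, Set.indicator_of_notMem (by simpa using hy)]
      have hyL : ‖y‖ < L := by simpa using hy
      have hhalf : ‖x‖ / 2 ≤ ‖x - y‖ := by
        have := norm_sub_norm_le x y; linarith
      have l1 : Real.log ‖x‖ - Real.log 2 ≤ Real.log ‖x - y‖ := by
        rw [← Real.log_div hx0.ne' two_ne_zero]
        exact Real.log_le_log (by positivity) hhalf
      have l2 : Real.log ‖y‖ ≤ Real.log L := Real.log_le_log ny hyL.le
      have : -kk x y ≤ K - Real.log ‖x‖ := by unfold kk; linarith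
      nlinarith [mul_le_mul_of_nonneg_right this hPy]
    · rw [Set.indicator_of_notMem hy, Set.indicator_of_mem (by simpa using hy)]
      have hle' : -kk x y * P y ≤ (K + Real.log ‖x‖) * P y +
          (ball x 1).indicator (fun y => ‖x - y‖ ^ (-1 : ℝ) * C0) y := by
        rcases le_or_gt (‖x‖ / 2) ‖x - y‖ with hc | hc
        · have hy3 : ‖y‖ ≤ 3 * ‖x - y‖ := by
            have := norm_sub_norm_le y x
            rw [norm_sub_rev] at this; linarith
          have l1 : Real.log ‖y‖ ≤ Real.log 3 + Real.log ‖x - y‖ := by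
            rw [← Real.log_mul (by norm_num) nxy.ne']
            exact Real.log_le_log ny hy3
          have : -kk x y ≤ K + Real.log ‖x‖ := by unfold kk; linarith
          nlinarith [mul_le_mul_of_nonneg_right this hPy]
        · have hy3 : ‖y‖ ≤ 2 * ‖x‖ := by
            have := norm_sub_norm_le y x
            rw [norm_sub_rev] at this; linarith
          have l1 : Real.log ‖y‖ ≤ Real.log 2 + Real.log ‖x‖ := by
            rw [← Real.log_mul (by norm_num) hx0.ne']
            exact Real.log_le_log ny hy3
          by_cases hb : y ∈ ball x 1
          · rw [Set.indicator_of_mem hb, Real.rpow_neg_one]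
            have l2 : -Real.log ‖x - y‖ ≤ ‖x - y‖⁻¹ := by
              rw [← Real.log_inv]
              have := Real.log_le_sub_one_of_pos (inv_pos.2 nxy)
              linarith
            have : -kk x y ≤ K + Real.log ‖x‖ + ‖x - y‖⁻¹ := by unfold kk; linarith
            have t1 := mul_le_mul_of_nonneg_right this hPy
            have t2 := mul_le_mul_of_nonneg_left (hC y hb) (inv_nonneg.2 nxy.le)
            nlinarith
          · rw [Set.indicator_of_notMem hb]
            have h3 : 1 ≤ ‖x - y‖ := by
              rw [mem_ball, not_lt, dist_eq_norm, norm_sub_rev] at hb; exact hb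
            have l2 := Real.log_nonneg h3
            have : -kk x y ≤ K + Real.log ‖x‖ := by unfold kk; linarith
            nlinarith [mul_le_mul_of_nonneg_right this hPy]
      nlinarith
  rw [← integral_neg]
  refine (integral_mono_ae hintg.neg ((i1.sub i2).add (i3.add i4)) hle).trans ?_
  rw [integral_add' (i1.sub i2) (i3.add i4), integral_sub' i1 i2, integral_add' i3 i4,
    integral_indicator measurableSet_ball, integral_indicator measurableSet_ball.compl,
    integral_indicator measurableSet_ball, integral_const_mul, integral_const_mul,
    integral_const_mul, integral_mul_const, h2]
  change _ - _ + (_ + JJ E 1 * C0) ≤ _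
  have hK0 : 0 ≤ K := by linarith
  have u1 := mul_le_mul_of_nonneg_left hM hK0
  have u2 := mul_le_mul_of_nonneg_left hm0 hlx
  have u3 := mul_le_mul_of_nonneg_left he hlx
  nlinarith

end kernel2

end

noncomputable section


theorem radial_C (F : ℝ → ℝ) : ∫ z : ℂ, F ‖z‖ = 2 * π * ∫ r in Set.Ioi (0 : ℝ), r * F r := by
  rw [integral_fun_norm_addHaar volume F]
  simp [Complex.finrank_real_complex, Measure.real, Complex.volume_ball, mul_assoc]

theorem radial_E2 (F : ℝ → ℝ) : ∫ z : E2, F ‖z‖ = 2 * π * ∫ r in Set.Ioi (0 : ℝ), r * F r := by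
  rw [integral_fun_norm_addHaar volume F]
  simp [Measure.real, EuclideanSpace.volume_ball_fin_two, mul_assoc, Real.pi_nonneg]

theorem tendsto_one_add_sq {b : ℝ} (hb : 0 < b) :
    Tendsto (fun r : ℝ => 1 + b * r ^ 2) atTop atTop :=
  tendsto_atTop_add_const_left _ _ (Tendsto.const_mul_atTop hb (tendsto_pow_atTop two_ne_zero))

theorem int_cube {b : ℝ} (hb : 0 < b) :
    ∫ r in Set.Ioi (0 : ℝ), r * ((1 + b * r ^ 2) ^ 3)⁻¹ = 1 / (4 * b) := by
  have hd : ∀ r ∈ Set.Ici (0 : ℝ), HasDerivAt (fun r : ℝ => -(1 / (4 * b)) * ((1 + b * r ^ 2) ^ 2)⁻¹)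
      (r * ((1 + b * r ^ 2) ^ 3)⁻¹) r := by
    intro r _
    have hp : 0 < 1 + b * r ^ 2 := by positivity
    have h1 : HasDerivAt (fun r : ℝ => 1 + b * r ^ 2) (b * (2 * r)) r := by
      simpa using ((hasDerivAt_pow 2 r).const_mul b).const_add 1
    have h2 := ((h1.fun_pow 2).fun_inv (pow_ne_zero 2 hp.ne')).const_mul (-(1 / (4 * b)))
    refine h2.congr_deriv ?_
    have := hp.ne'
    simp
    field_simp
    ring
  have hl : Tendsto (fun r : ℝ => -(1 / (4 * b)) * ((1 + b * r ^ 2) ^ 2)⁻¹) atTop (𝓝 0) := by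
    have := (((tendsto_pow_atTop two_ne_zero).comp (tendsto_one_add_sq hb)).inv_tendsto_atTop).const_mul
      (-(1 / (4 * b)))
    simpa using this
  rw [integral_Ioi_of_hasDerivAt_of_nonneg' hd (fun r hr => by
    have : 0 < r := hr
    positivity) hl]
  simp

theorem int_sq {b : ℝ} (hb : 0 < b) :
    ∫ r in Set.Ioi (0 : ℝ), r * ((1 + b * r ^ 2) ^ 2)⁻¹ = 1 / (2 * b) := by
  have hd : ∀ r ∈ Set.Ici (0 : ℝ), HasDerivAt (fun r : ℝ => -(1 / (2 * b)) * (1 + b * r ^ 2)⁻¹)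
      (r * ((1 + b * r ^ 2) ^ 2)⁻¹) r := by
    intro r _
    have hp : 0 < 1 + b * r ^ 2 := by positivity
    have h1 : HasDerivAt (fun r : ℝ => 1 + b * r ^ 2) (b * (2 * r)) r := by
      simpa using ((hasDerivAt_pow 2 r).const_mul b).const_add 1
    have h2 := (h1.fun_inv hp.ne').const_mul (-(1 / (2 * b)))
    refine h2.congr_deriv ?_
    have := hp.ne'
    field_simp
  have hl : Tendsto (fun r : ℝ => -(1 / (2 * b)) * (1 + b * r ^ 2)⁻¹) atTop (𝓝 0) := by
    have := ((tendsto_one_add_sq hb).inv_tendsto_atTop).const_mul (-(1 / (2 * b)))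
    simpa using this
  rw [integral_Ioi_of_hasDerivAt_of_nonneg' hd (fun r hr => by
    have : 0 < r := hr
    positivity) hl]
  simp

/-- the logarithmic moment of the bubble -/
theorem int_sq_log {b : ℝ} (hb : 0 < b) :
    ∫ r in Set.Ioi (0 : ℝ), r * (((1 + b * r ^ 2) ^ 2)⁻¹ * Real.log (1 + b * r ^ 2)) = 1 / (2 * b) := by
  have hd : ∀ r ∈ Set.Ici (0 : ℝ), HasDerivAt
      (fun r : ℝ => -(1 / (2 * b)) * ((Real.log (1 + b * r ^ 2) + 1) * (1 + b * r ^ 2)⁻¹))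
      (r * (((1 + b * r ^ 2) ^ 2)⁻¹ * Real.log (1 + b * r ^ 2))) r := by
    intro r _
    have hp : 0 < 1 + b * r ^ 2 := by positivity
    have h1 : HasDerivAt (fun r : ℝ => 1 + b * r ^ 2) (b * (2 * r)) r := by
      simpa using ((hasDerivAt_pow 2 r).const_mul b).const_add 1
    have h2 := (((h1.log hp.ne').add_const 1).fun_mul (h1.fun_inv hp.ne')).const_mul (-(1 / (2 * b)))
    refine h2.congr_deriv ?_
    have := hp.ne'
    field_simp
    ring
  have hl : Tendsto (fun r : ℝ => -(1 / (2 * b)) * ((Real.log (1 + b * r ^ 2) + 1) * (1 + b * r ^ 2)⁻¹))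
      atTop (𝓝 0) := by
    have h0 : Tendsto (fun t : ℝ => (Real.log t + 1) * t⁻¹) atTop (𝓝 0) := by
      have e1 : Tendsto (fun t : ℝ => Real.log t / t) atTop (𝓝 0) := by
        simpa using Real.tendsto_pow_log_div_mul_add_atTop 1 0 1 one_ne_zero
      have e2 := e1.add tendsto_inv_atTop_zero
      simp only [add_zero] at e2
      refine e2.congr fun t => ?_
      rw [add_mul, one_mul, div_eq_mul_inv]
    simpa using (h0.comp (tendsto_one_add_sq hb)).const_mul (-(1 / (2 * b)))
  rw [integral_Ioi_of_hasDerivAt_of_nonneg' hd (fun r hr => by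
    have : 0 < r := hr
    have : 0 ≤ Real.log (1 + b * r ^ 2) := Real.log_nonneg (by nlinarith [sq_nonneg r])
    positivity) hl]
  simp

theorem not_integrable_two : ¬ Integrable (fun z : ℂ => (1 + ‖z‖) ^ (-2 : ℝ)) := by
  rw [integrable_fun_norm_addHaar volume (f := fun t : ℝ => (1 + t) ^ (-2 : ℝ))]
  intro h
  apply not_integrableOn_Ioi_inv (a := 1)
  have h2 : IntegrableOn (fun y : ℝ => 4 * (y ^ (Module.finrank ℝ ℂ - 1) • (1 + y) ^ (-2 : ℝ)))
      (Set.Ioi 1) := (h.mono_set (Set.Ioi_subset_Ioi zero_le_one)).const_mul 4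
  refine h2.mono' (by fun_prop) ?_
  rw [ae_restrict_iff' measurableSet_Ioi]
  refine Eventually.of_forall fun y hy => ?_
  have hy1 : (1 : ℝ) < y := hy
  simp only [Complex.finrank_real_complex, smul_eq_mul]
  rw [Real.norm_of_nonneg (by positivity), Real.rpow_neg (by positivity)]
  norm_num
  rw [inv_eq_one_div, ← div_eq_mul_inv, ← mul_div_assoc, div_le_div_iff₀ (by positivity) (by positivity)]
  nlinarith

theorem not_integrable_one : ¬ Integrable (fun _ : ℂ => (1 : ℝ)) := by
  intro h
  apply not_integrable_two
  refine h.mono' ?_ (Eventually.of_forall fun z => ?_)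
  · exact (Measurable.pow_const (by fun_prop) _).aestronglyMeasurable
  · rw [Real.norm_of_nonneg (by positivity)]
    exact Real.rpow_le_one_of_one_le_of_nonpos (by linarith [norm_nonneg z]) (by norm_num)

end

noncomputable section


/-- normalized entire solutions of the Liouville equation in integral form -/
structure Ent (u : ℂ → ℝ) : Prop where
  cont : Continuous u
  zero : u 0 = 0
  nonpos : ∀ x, u x ≤ 0
  int : Integrable (fun x => Real.exp (u x))
  eq : ∀ x, u x = -(1 / (2 * π)) * ∫ y, kk x y * Real.exp (u y)

theorem hdC : Module.finrank ℝ ℂ = 2 := Complex.finrank_real_complex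

namespace Ent

variable {u : ℂ → ℝ}

theorem exp_le_one (h : Ent u) (x : ℂ) : Real.exp (u x) ≤ 1 :=
  Real.exp_le_one_iff.2 (h.nonpos x)

theorem expm (h : Ent u) : AEStronglyMeasurable (fun x => Real.exp (u x)) volume :=
  (Real.continuous_exp.comp h.cont).aestronglyMeasurable

theorem kk_int (h : Ent u) (x : ℂ) : Integrable (fun y => kk x y * Real.exp (u y)) :=
  (kk_pot hdC (fun y => (Real.exp_pos (u y)).le) h.int h.expm
    (fun y => (abs_of_pos (Real.exp_pos (u y))).le) x (fun y _ => h.exp_le_one y)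
    (fun y _ => h.exp_le_one y)).1

theorem kk_upper (x y : ℂ) (hy : y ≠ 0) (hxy : y ≠ x) :
    kk x y ≤ Real.log (1 + ‖x‖) + ‖y‖ ^ (-1 : ℝ) := by
  have hy0 : 0 < ‖y‖ := norm_pos_iff.2 hy
  have hxy0 : 0 < ‖x - y‖ := norm_pos_iff.2 (sub_ne_zero.2 hxy.symm)
  have h1 : ‖x - y‖ ≤ (1 + ‖x‖) * ((1 + ‖y‖⁻¹) * ‖y‖) := by
    have := norm_sub_le x y
    have h2 : (1 + ‖y‖⁻¹) * ‖y‖ = ‖y‖ + 1 := by field_simp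
    rw [h2]
    nlinarith [norm_nonneg x]
  have h3 := Real.log_le_log hxy0 h1
  have hx1 : 0 < 1 + ‖x‖ := by positivity
  rw [Real.log_mul (by positivity) (by positivity), Real.log_mul (by positivity) (by positivity)] at h3
  have h4 := Real.log_le_sub_one_of_pos (show 0 < 1 + ‖y‖⁻¹ by positivity)
  rw [Real.rpow_neg_one]
  unfold kk
  linarith

theorem lower (h : Ent u) : ∃ B, ∀ x, -((∫ y, Real.exp (u y)) / (2 * π)) * Real.log (1 + ‖x‖) - B ≤ u x := by
  refine ⟨1 / (2 * π) * ∫ y : ℂ, ‖(0 : ℂ) - y‖ ^ (-1 : ℝ) * Real.exp (u y), fun x => ?_⟩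
  have hp := pot_bound hdC zero_le_one one_lt_two (fun y => (Real.exp_pos (u y)).le) h.int 0
    (fun y _ => h.exp_le_one y)
  have h1 : ∫ y, kk x y * Real.exp (u y) ≤
      ∫ y, (Real.log (1 + ‖x‖) * Real.exp (u y) + ‖(0 : ℂ) - y‖ ^ (-1 : ℝ) * Real.exp (u y)) := by
    refine integral_mono_ae (h.kk_int x) ((h.int.const_mul _).add hp.1) ?_
    have a1 : ∀ᵐ y : ℂ, y ≠ 0 := by simp [ae_iff, measure_singleton]
    have a2 : ∀ᵐ y : ℂ, y ≠ x := by simp [ae_iff, measure_singleton]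
    filter_upwards [a1, a2] with y hy hyx
    have := kk_upper x y hy hyx
    simp only [zero_sub, norm_neg]
    nlinarith [Real.exp_pos (u y)]
  rw [integral_add (h.int.const_mul _) hp.1, integral_const_mul] at h1
  rw [h.eq x]
  have hpi := Real.pi_pos
  have h2 := mul_le_mul_of_nonneg_left h1 (show 0 ≤ 1 / (2 * π) by positivity)
  calc _ = -(1 / (2 * π) * (Real.log (1 + ‖x‖) * (∫ y, Real.exp (u y)) + ∫ y : ℂ, ‖(0 : ℂ) - y‖ ^ (-1 : ℝ) * Real.exp (u y))) := by ring
    _ ≤ _ := by linarith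

theorem mass (h : Ent u) : 4 * π < ∫ y, Real.exp (u y) := by
  by_contra! hc
  obtain ⟨B, hB⟩ := h.lower
  apply not_integrable_two
  refine (h.int.const_mul (Real.exp B)).mono' ?_ (Eventually.of_forall fun z => ?_)
  · exact (Measurable.pow_const (by fun_prop) _).aestronglyMeasurable
  · have h1 : 0 < 1 + ‖z‖ := by positivity
    rw [Real.norm_of_nonneg (by positivity), ← Real.exp_add, Real.rpow_def_of_pos h1]
    apply Real.exp_le_exp.2
    have h2 : (∫ y, Real.exp (u y)) / (2 * π) ≤ 2 := by
      rw [div_le_iff₀ (by positivity)]; linarith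
    have h3 : 0 ≤ Real.log (1 + ‖z‖) := Real.log_nonneg (by linarith [norm_nonneg z])
    have := hB z
    nlinarith

theorem decay (h : Ent u) : ∃ s > (0 : ℝ), ∃ C > (0 : ℝ), ∀ x, Real.exp (u x) ≤ C * (1 + ‖x‖) ^ (-(2 + s)) := by
  set σ := ∫ y, Real.exp (u y) with hσ
  have hm := h.mass
  rw [← hσ] at hm
  set d := σ - 4 * π with hd
  have hd0 : 0 < d := by linarith
  have hpi := Real.pi_pos
  have hlim : Tendsto (fun n : ℕ => ∫ y in ball (0 : ℂ) n, Real.exp (u y)) atTop (𝓝 σ) := by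
    have := tendsto_setIntegral_of_monotone (μ := volume) (f := fun y => Real.exp (u y))
      (s := fun n : ℕ => ball (0 : ℂ) n) (fun n => measurableSet_ball)
      (fun a b hab => ball_subset_ball (by exact_mod_cast hab))
      (by rw [iUnion_ball_nat]; exact h.int.integrableOn)
    simpa [iUnion_ball_nat, hσ] using this
  obtain ⟨n, hn1, hn2⟩ := ((hlim.eventually (lt_mem_nhds (show σ - d / 4 < σ by linarith))).and
    (eventually_ge_atTop 1)).exists
  set L : ℝ := (n : ℝ) with hLdef
  have hL : 1 ≤ L := by simp only [L]; exact_mod_cast hn2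
  have htail : ∫ y in (ball (0 : ℂ) L)ᶜ, Real.exp (u y) ≤ d / 4 := by
    have := integral_add_compl (measurableSet_ball (x := (0 : ℂ)) (ε := L)) h.int
    linarith
  set K := (Real.log L + Real.log 2 + Real.log 3) * σ + 1 * JJ ℂ 1
  set s := d / (4 * π) with hs
  have hs0 : 0 < s := by positivity
  refine ⟨s, hs0, Real.exp (1 / (2 * π) * K) * 2 ^ (2 + s) + (1 + 2 * L) ^ (2 + s), by positivity, fun x => ?_⟩
  have hx1 : 0 < 1 + ‖x‖ := by positivity
  rcases le_or_gt (2 * L) ‖x‖ with hx | hx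
  · have hk := kk_decay hdC (fun y => (Real.exp_pos (u y)).le) h.int hL x
      (fun y _ => h.exp_le_one y) (fun y _ => h.exp_le_one y) hσ.symm.le hn1.le htail hx
    have hx0 : 0 < ‖x‖ := by linarith
    have h1 : u x ≤ -(2 + s) * Real.log ‖x‖ + 1 / (2 * π) * K := by
      rw [h.eq x]
      have h2 := mul_le_mul_of_nonneg_left hk (show 0 ≤ 1 / (2 * π) by positivity)
      have h3 : 1 / (2 * π) * (-(σ - d / 4 - d / 4) * Real.log ‖x‖ + K) =
        -(2 + s) * Real.log ‖x‖ + 1 / (2 * π) * K := by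
        have : σ = d + 4 * π := by rw [hd]; ring
        rw [this, hs]; field_simp; ring
      calc _ = 1 / (2 * π) * -∫ y, kk x y * Real.exp (u y) := by ring
        _ ≤ _ := h2
        _ = _ := h3
    calc Real.exp (u x) ≤ Real.exp (-(2 + s) * Real.log ‖x‖ + 1 / (2 * π) * K) := Real.exp_le_exp.2 h1
      _ = Real.exp (1 / (2 * π) * K) * ‖x‖ ^ (-(2 + s)) := by
        rw [Real.exp_add, Real.rpow_def_of_pos hx0]; ring_nf
      _ ≤ Real.exp (1 / (2 * π) * K) * (2 ^ (2 + s) * (1 + ‖x‖) ^ (-(2 + s))) := by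
        gcongr
        rw [Real.rpow_neg hx0.le, Real.rpow_neg hx1.le, ← div_eq_mul_inv, ← Real.div_rpow (by norm_num) hx1.le,
          ← Real.inv_rpow hx0.le]
        apply Real.rpow_le_rpow (by positivity) _ (by linarith)
        rw [inv_eq_one_div, div_le_div_iff₀ hx0 hx1]
        linarith
      _ ≤ _ := by
        have : 0 ≤ (1 + 2 * L) ^ (2 + s) * (1 + ‖x‖) ^ (-(2 + s)) := by positivity
        nlinarith
  · refine (h.exp_le_one x).trans ?_
    have h1 : 1 ≤ (1 + 2 * L) ^ (2 + s) * (1 + ‖x‖) ^ (-(2 + s)) := by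
      rw [Real.rpow_neg hx1.le, ← div_eq_mul_inv, ← Real.div_rpow (by linarith) hx1.le]
      apply Real.one_le_rpow _ (by linarith)
      rw [one_le_div hx1]; linarith
    have : 0 ≤ Real.exp (1 / (2 * π) * K) * 2 ^ (2 + s) * (1 + ‖x‖) ^ (-(2 + s)) := by positivity
    nlinarith

end Ent

theorem le_two_rpow {s : ℝ} (hs : 1 / 4 ≤ s) : s ≤ 2 * s ^ (3 / 2 : ℝ) := by
  have h0 : 0 < s := by linarith
  have h1 : s ^ (3 / 2 : ℝ) = s * √s := by
    rw [Real.sqrt_eq_rpow, show (3 / 2 : ℝ) = 1 + 1 / 2 by norm_num, Real.rpow_add h0, Real.rpow_one]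
  have h2 : 1 / 2 ≤ √s := Real.le_sqrt_of_sq_le (by linarith)
  rw [h1]; nlinarith

theorem log_taylor {a e : ℂ} (ha : a ≠ 0) (hae : a + e ≠ 0) :
    |Real.log ‖a + e‖ - Real.log ‖a‖ - (e / a).re| ≤
      6 * ‖e‖ ^ (3 / 2 : ℝ) * (‖a‖ ^ (-(3 / 2) : ℝ) + ‖a + e‖ ^ (-(3 / 2) : ℝ)) := by
  have ha0 : 0 < ‖a‖ := norm_pos_iff.2 ha
  have hae0 : 0 < ‖a + e‖ := norm_pos_iff.2 hae
  have e1 : ‖e‖ ^ (3 / 2 : ℝ) * ‖a‖ ^ (-(3 / 2) : ℝ) = (‖e‖ / ‖a‖) ^ (3 / 2 : ℝ) := by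
    rw [Real.div_rpow (norm_nonneg _) ha0.le, Real.rpow_neg ha0.le, ← div_eq_mul_inv]
  have e2 : ‖e‖ ^ (3 / 2 : ℝ) * ‖a + e‖ ^ (-(3 / 2) : ℝ) = (‖e‖ / ‖a + e‖) ^ (3 / 2 : ℝ) := by
    rw [Real.div_rpow (norm_nonneg _) hae0.le, Real.rpow_neg hae0.le, ← div_eq_mul_inv]
  have e3 : 6 * ‖e‖ ^ (3 / 2 : ℝ) * (‖a‖ ^ (-(3 / 2) : ℝ) + ‖a + e‖ ^ (-(3 / 2) : ℝ)) =
      6 * ((‖e‖ / ‖a‖) ^ (3 / 2 : ℝ) + (‖e‖ / ‖a + e‖) ^ (3 / 2 : ℝ)) := by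
    rw [← e1, ← e2]; ring
  rw [e3]
  have n1 : 0 ≤ (‖e‖ / ‖a‖) ^ (3 / 2 : ℝ) := by positivity
  have n2 : 0 ≤ (‖e‖ / ‖a + e‖) ^ (3 / 2 : ℝ) := by positivity
  have hre : |(e / a).re| ≤ ‖e‖ / ‖a‖ := by
    rw [← norm_div]; exact Complex.abs_re_le_norm _
  rcases le_or_gt ‖e‖ (‖a‖ / 2) with h | h
  · set t := e / a with ht
    have hnt : ‖t‖ = ‖e‖ / ‖a‖ := by rw [ht, norm_div]
    have ht1 : ‖t‖ ≤ 1 / 2 := by rw [hnt, div_le_iff₀ ha0]; linarith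
    have h1 : a + e = a * (1 + t) := by rw [ht]; field_simp
    have h1t : 1 + t ≠ 0 := by rintro h0; rw [h1, h0, mul_zero] at hae; exact hae rfl
    have h2 : Real.log ‖a + e‖ - Real.log ‖a‖ - t.re = (Complex.log (1 + t) - t).re := by
      rw [h1, norm_mul, Real.log_mul ha0.ne' (norm_ne_zero_iff.2 h1t), Complex.sub_re, Complex.log_re]
      ring
    rw [h2, ← hnt]
    have h3 := Complex.norm_log_one_add_sub_self_le (z := t) (by linarith)
    have h4 : (1 - ‖t‖)⁻¹ ≤ 2 := by
      rw [inv_le_comm₀ (by linarith) (by norm_num)]; linarith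
    have h5 : ‖t‖ ^ 2 * (1 - ‖t‖)⁻¹ / 2 ≤ ‖t‖ ^ 2 := by nlinarith [sq_nonneg ‖t‖]
    have h6 : ‖t‖ ^ 2 ≤ ‖t‖ ^ (3 / 2 : ℝ) := by
      rw [← Real.rpow_natCast]
      rcases (norm_nonneg t).eq_or_lt with h0 | h0
      · rw [← h0]; norm_num
      · exact Real.rpow_le_rpow_of_exponent_ge h0 (by linarith) (by norm_num)
    rw [← hnt] at n1
    have := Complex.abs_re_le_norm (Complex.log (1 + t) - t)
    linarith
  · have he0 : 0 < ‖e‖ := by linarith [half_pos ha0]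
    have hl := log_diff_bound (x := a + e) (x' := a) (y := 0) (Ne.symm hae) (Ne.symm ha)
    simp only [sub_zero, add_sub_cancel_left, mul_add] at hl
    rw [← div_eq_mul_inv, ← div_eq_mul_inv] at hl
    have b1 : ‖e‖ / ‖a‖ ≤ 2 * (‖e‖ / ‖a‖) ^ (3 / 2 : ℝ) :=
      le_two_rpow (by rw [le_div_iff₀ ha0]; linarith)
    have b2 : ‖e‖ / ‖a + e‖ ≤ 2 * (‖e‖ / ‖a + e‖) ^ (3 / 2 : ℝ) :=
      le_two_rpow (by rw [le_div_iff₀ hae0]; linarith [norm_add_le a e])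
    have := abs_sub (Real.log ‖a + e‖ - Real.log ‖a‖) (e / a).re
    linarith

end

noncomputable section


/-- the real functional twice the real part of a product -/
def rl : ℂ →L[ℝ] (ℂ →L[ℝ] ℝ) :=
  ((ContinuousLinearMap.compL ℝ ℂ ℂ ℝ) ((2 : ℝ) • Complex.reCLM)).comp (ContinuousLinearMap.mul ℝ ℂ)

theorem rl_apply (w e : ℂ) : rl w e = 2 * (w * e).re := by
  simp [rl]

theorem rl_norm (w : ℂ) : ‖rl w‖ ≤ 2 * ‖w‖ := by
  refine ContinuousLinearMap.opNorm_le_bound _ (by positivity) fun e => ?_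
  rw [rl_apply, norm_mul, Real.norm_eq_abs, Real.norm_eq_abs, abs_two, mul_assoc, ← norm_mul]
  have := Complex.abs_re_le_norm (w * e)
  linarith

/-- the complex gradient of the potential -/
def gg (u : ℂ → ℝ) (z : ℂ) : ℂ := -(1 / (4 * π) : ℝ) * ∫ y, (Real.exp (u y) : ℂ) * (z - y)⁻¹

namespace Ent

variable {u : ℂ → ℝ}

theorem cauchy (h : Ent u) {Q : ℂ → ℂ} (hQm : AEStronglyMeasurable Q) {D : ℝ} (hD : 0 ≤ D)
    (hQ : ∀ y, ‖Q y‖ ≤ D * Real.exp (u y)) (z : ℂ) :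
    Integrable (fun y => Q y * (z - y)⁻¹) ∧ Integrable (fun y => ‖z - y‖⁻¹ * ‖Q y‖) ∧
      ‖∫ y, Q y * (z - y)⁻¹‖ ≤ D * JJ ℂ 1 + D * ∫ y, Real.exp (u y) ∧
      (∫ y, ‖Q y * (z - y)⁻¹‖) ≤ D * JJ ℂ 1 + D * ∫ y, Real.exp (u y) := by
  have hp := pot_bound hdC zero_le_one one_lt_two (P := fun y => D * Real.exp (u y)) (fun y => by positivity) (h.int.const_mul D) (C0 := D) z
    (fun y _ => by nlinarith [h.exp_le_one y])
  rw [integral_const_mul] at hp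
  have hm : AEStronglyMeasurable (fun y => Q y * (z - y)⁻¹) := by
    refine hQm.mul ?_
    exact (Measurable.inv (by fun_prop)).aestronglyMeasurable
  have hle : ∀ y, ‖Q y * (z - y)⁻¹‖ ≤ ‖z - y‖ ^ (-1 : ℝ) * (D * Real.exp (u y)) := by
    intro y
    rw [norm_mul, norm_inv, Real.rpow_neg_one, mul_comm]
    exact mul_le_mul_of_nonneg_left (hQ y) (by positivity)
  have hi := hp.1.mono' hm (Eventually.of_forall hle)
  refine ⟨hi, ?_, ?_, ?_⟩
  · refine hi.norm.congr (Eventually.of_forall fun y => ?_)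
    simp [mul_comm]
  · exact (norm_integral_le_of_norm_le hp.1 (Eventually.of_forall hle)).trans hp.2
  · exact (integral_mono hi.norm hp.1 hle).trans hp.2

theorem expC (h : Ent u) : AEStronglyMeasurable (fun y => (Real.exp (u y) : ℂ)) volume :=
  (Complex.continuous_ofReal.comp (Real.continuous_exp.comp h.cont)).aestronglyMeasurable

theorem expC_norm (y : ℂ) : ‖(Real.exp (u y) : ℂ)‖ ≤ 1 * Real.exp (u y) := by
  rw [Complex.norm_real, Real.norm_of_nonneg (Real.exp_pos _).le, one_mul]

theorem cauchy1 (h : Ent u) (z : ℂ) :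
    Integrable (fun y => (Real.exp (u y) : ℂ) * (z - y)⁻¹) ∧
      Integrable (fun y => ‖z - y‖⁻¹ * ‖(Real.exp (u y) : ℂ)‖) ∧
      ‖∫ y, (Real.exp (u y) : ℂ) * (z - y)⁻¹‖ ≤ 1 * JJ ℂ 1 + 1 * ∫ y, Real.exp (u y) ∧
      (∫ y, ‖(Real.exp (u y) : ℂ) * (z - y)⁻¹‖) ≤ 1 * JJ ℂ 1 + 1 * ∫ y, Real.exp (u y) :=
  h.cauchy h.expC zero_le_one expC_norm z

theorem gg_bound (h : Ent u) : ∃ G : ℝ, 0 ≤ G ∧ ∀ z, ‖gg u z‖ ≤ G := by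
  refine ⟨1 / (4 * π) * (1 * JJ ℂ 1 + 1 * ∫ y, Real.exp (u y)), ?_, fun z => ?_⟩
  · have := JJ_nonneg (E := ℂ) 1
    have : 0 ≤ ∫ y, Real.exp (u y) := integral_nonneg fun y => (Real.exp_pos _).le
    have := Real.pi_pos
    positivity
  · unfold gg
    rw [norm_mul, norm_neg, Complex.norm_real, Real.norm_of_nonneg (by have := Real.pi_pos; positivity)]
    exact mul_le_mul_of_nonneg_left (h.cauchy1 z).2.2.1 (by have := Real.pi_pos; positivity)

theorem hasFDeriv (h : Ent u) (z : ℂ) : HasFDerivAt u (rl (gg u z)) z := by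
  have hpi := Real.pi_pos
  set M := 1 * JJ ℂ (3 / 2) + ∫ y, Real.exp (u y) with hM
  have hM0 : 0 ≤ M := by
    have := JJ_nonneg (E := ℂ) (3 / 2)
    have : 0 ≤ ∫ y, Real.exp (u y) := integral_nonneg fun y => (Real.exp_pos _).le
    positivity
  have key : ∀ e : ℂ, ‖u (z + e) - u z - rl (gg u z) e‖ ≤ 1 / (2 * π) * (6 * ‖e‖ ^ (3 / 2 : ℝ) * (2 * M)) := by
    intro e
    have hp : ∀ x : ℂ, _ := fun x => pot_bound hdC (a := 3 / 2) (by norm_num) (by norm_num)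
      (fun y => (Real.exp_pos (u y)).le) h.int x (fun y _ => h.exp_le_one y)
    have i1 := h.kk_int (z + e)
    have i2 := h.kk_int z
    have i3 : Integrable (fun y => (e * ((Real.exp (u y) : ℂ) * (z - y)⁻¹)).re) :=
      ((h.cauchy1 z).1.const_mul e).re
    have e1 : u (z + e) - u z - rl (gg u z) e = -(1 / (2 * π)) *
        ∫ y, (kk (z + e) y * Real.exp (u y) - kk z y * Real.exp (u y) - (e * ((Real.exp (u y) : ℂ) * (z - y)⁻¹)).re) := by
      rw [integral_sub (f := fun y => kk (z + e) y * Real.exp (u y) - kk z y * Real.exp (u y)) (i1.sub i2) i3, integral_sub i1 i2, h.eq (z + e), h.eq z, rl_apply]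
      have e2 : ∫ y, (e * ((Real.exp (u y) : ℂ) * (z - y)⁻¹)).re = (e * ∫ y, ((Real.exp (u y) : ℂ) * (z - y)⁻¹)).re := by
        rw [← integral_const_mul]
        exact integral_re ((h.cauchy1 z).1.const_mul e)
      rw [e2]
      unfold gg
      set I := ∫ y, ((Real.exp (u y) : ℂ) * (z - y)⁻¹)
      have e3 : (-((1 / (4 * π) : ℝ) : ℂ) * I * e).re = -(1 / (4 * π)) * (e * I).re := by
        rw [show -((1 / (4 * π) : ℝ) : ℂ) * I * e = ((-(1 / (4 * π)) : ℝ) : ℂ) * (e * I) by push_cast; ring,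
          Complex.re_ofReal_mul]
      rw [e3]
      field_simp
      ring
    rw [e1, norm_mul, norm_neg, Real.norm_of_nonneg (show 0 ≤ 1 / (2 * π) by positivity)]
    refine mul_le_mul_of_nonneg_left ?_ (by positivity)
    have hdom : Integrable (fun y => 6 * ‖e‖ ^ (3 / 2 : ℝ) *
      (‖z - y‖ ^ (-(3 / 2) : ℝ) * Real.exp (u y) + ‖z + e - y‖ ^ (-(3 / 2) : ℝ) * Real.exp (u y))) :=
      ((hp z).1.add (hp (z + e)).1).const_mul _
    refine (norm_integral_le_of_norm_le hdom ?_).trans ?_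
    · have a1 : ∀ᵐ y : ℂ, y ≠ z := by simp [ae_iff, measure_singleton]
      have a2 : ∀ᵐ y : ℂ, y ≠ z + e := by simp [ae_iff, measure_singleton]
      filter_upwards [a1, a2] with y hy hy'
      have ht := log_taylor (a := z - y) (e := e) (sub_ne_zero.2 hy.symm)
        (by rw [show z - y + e = z + e - y by ring]; exact sub_ne_zero.2 hy'.symm)
      rw [show z - y + e = z + e - y by ring] at ht
      have e4 : kk (z + e) y * Real.exp (u y) - kk z y * Real.exp (u y) - (e * ((Real.exp (u y) : ℂ) * (z - y)⁻¹)).re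
          = (Real.log ‖z + e - y‖ - Real.log ‖z - y‖ - (e / (z - y)).re) * Real.exp (u y) := by
        rw [show e * ((Real.exp (u y) : ℂ) * (z - y)⁻¹) = (Real.exp (u y) : ℂ) * (e / (z - y)) by
          rw [div_eq_mul_inv]; ring, Complex.re_ofReal_mul]
        unfold kk; ring
      rw [e4, norm_mul, Real.norm_eq_abs, Real.norm_of_nonneg (Real.exp_pos _).le, ← add_mul, ← mul_assoc]
      exact mul_le_mul_of_nonneg_right ht (Real.exp_pos _).le
    · rw [integral_const_mul, integral_add (hp z).1 (hp (z + e)).1]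
      refine mul_le_mul_of_nonneg_left ?_ (by positivity)
      have := (hp z).2
      have := (hp (z + e)).2
      rw [hM]; linarith
  rw [hasFDerivAt_iff_isLittleO_nhds_zero, Asymptotics.isLittleO_iff]
  intro c hc
  have ht : Tendsto (fun e : ℂ => 1 / (2 * π) * (6 * √‖e‖ * (2 * M))) (𝓝 0) (𝓝 0) := by
    have : Continuous (fun e : ℂ => 1 / (2 * π) * (6 * √‖e‖ * (2 * M))) := by fun_prop
    have h1 := this.tendsto 0
    simpa using h1
  filter_upwards [ht.eventually (gt_mem_nhds hc)] with e he
  refine (key e).trans ?_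
  have h1 : ‖e‖ ^ (3 / 2 : ℝ) = ‖e‖ * √‖e‖ := by
    rcases (norm_nonneg e).eq_or_lt with h0 | h0
    · rw [← h0]; norm_num
    · rw [Real.sqrt_eq_rpow, show (3 / 2 : ℝ) = 1 + 1 / 2 by norm_num, Real.rpow_add h0, Real.rpow_one]
  rw [h1]
  calc _ = (1 / (2 * π) * (6 * √‖e‖ * (2 * M))) * ‖e‖ := by ring
    _ ≤ c * ‖e‖ := mul_le_mul_of_nonneg_right he.le (norm_nonneg e)

theorem gg_meas (h : Ent u) : Measurable (gg u) := by
  have h1 : Measurable (fun z => fderiv ℝ u z 1) := measurable_fderiv_apply_const ℝ u 1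
  have h2 : Measurable (fun z => fderiv ℝ u z Complex.I) := measurable_fderiv_apply_const ℝ u Complex.I
  have h3 : gg u = fun z => ((1 / 2 : ℝ) : ℂ) * (((fderiv ℝ u z 1 : ℝ) : ℂ) - Complex.I * ((fderiv ℝ u z Complex.I : ℝ) : ℂ)) := by
    funext z
    rw [(h.hasFDeriv z).fderiv, rl_apply, rl_apply]
    apply Complex.ext <;> simp
  rw [h3]
  have h4 : Measurable (fun z => ((fderiv ℝ u z 1 : ℝ) : ℂ)) := Complex.measurable_ofReal.comp h1
  have h5 : Measurable (fun z => ((fderiv ℝ u z Complex.I : ℝ) : ℂ)) := Complex.measurable_ofReal.comp h2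
  exact (h4.sub (h5.const_mul _)).const_mul _

end Ent

end

noncomputable section

open scoped RealInnerProductSpace ComplexConjugate

/-- the Wirtinger form of a real-linear map of the complex plane -/
def LL (a b : ℂ) : ℂ →L[ℝ] ℂ :=
  a • (ContinuousLinearMap.id ℝ ℂ) + b • (Complex.conjCLE : ℂ →L[ℝ] ℂ)

theorem LL_apply (a b e : ℂ) : LL a b e = a * e + b * conj e := by
  simp [LL]

/-- the holomorphic second derivative of the potential -/
def AA (u : ℂ → ℝ) (z : ℂ) : ℂ := -(1 / (4 * π) : ℝ) * ∫ y, ((Real.exp (u y) : ℂ) * gg u y) * (z - y)⁻¹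

/-- the mixed second derivative of the potential -/
def BB (u : ℂ → ℝ) (z : ℂ) : ℂ :=
  -(1 / (4 * π) : ℝ) * ∫ y, ((Real.exp (u y) : ℂ) * conj (gg u y)) * (z - y)⁻¹

namespace Ent

variable {u : ℂ → ℝ}

theorem shift (f : ℂ → ℂ) (z : ℂ) : ∫ y, f y * (z - y)⁻¹ = ∫ y, f (z - y) * y⁻¹ := by
  have := integral_sub_left_eq_self (fun y => f y * (z - y)⁻¹) volume z
  rw [← this]; simp

theorem shift_int {f : ℂ → ℂ} {z : ℂ} (h : Integrable (fun y => f y * (z - y)⁻¹)) :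
    Integrable (fun y => f (z - y) * y⁻¹) := by
  have := h.comp_sub_left z
  simpa using this

theorem ggA_int (h : Ent u) (z : ℂ) : Integrable (fun y => ((Real.exp (u y) : ℂ) * gg u y) * (z - y)⁻¹) := by
  obtain ⟨G, hG0, hG⟩ := h.gg_bound
  refine (h.cauchy (h.expC.mul h.gg_meas.aestronglyMeasurable) hG0 (fun y => ?_) z).1
  show ‖(Real.exp (u y) : ℂ) * gg u y‖ ≤ _
  rw [norm_mul, mul_comm]
  exact mul_le_mul (hG y) (by simpa using expC_norm y) (norm_nonneg _) hG0

theorem ggB_int (h : Ent u) (z : ℂ) :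
    Integrable (fun y => ((Real.exp (u y) : ℂ) * conj (gg u y)) * (z - y)⁻¹) := by
  obtain ⟨G, hG0, hG⟩ := h.gg_bound
  refine (h.cauchy (h.expC.mul (Complex.continuous_conj.measurable.comp h.gg_meas).aestronglyMeasurable) hG0 (fun y => ?_) z).1
  show ‖(Real.exp (u y) : ℂ) * conj (gg u y)‖ ≤ _
  rw [norm_mul, mul_comm]
  refine mul_le_mul (by simpa using hG y) (by simpa using expC_norm y) (norm_nonneg _) hG0

theorem gg_hasFDeriv (h : Ent u) (z : ℂ) : HasFDerivAt (gg u) (LL (AA u z) (BB u z)) z := by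
  obtain ⟨G, hG0, hG⟩ := h.gg_bound
  obtain ⟨s, hs, C, hC, hdec⟩ := h.decay
  set F : ℂ → ℂ → ℂ := fun x y => Real.exp (u (x - y)) • y⁻¹ with hF
  set F' : ℂ → ℂ → (ℂ →L[ℝ] ℂ) := fun x y => (Real.exp (u (x - y)) • rl (gg u (x - y))).smulRight y⁻¹ with hF'
  have hFm : ∀ x, AEStronglyMeasurable (F x) := by
    intro x
    have m1 : AEStronglyMeasurable (fun y => Real.exp (u (x - y))) volume :=
      (Real.continuous_exp.comp (h.cont.comp (by fun_prop))).aestronglyMeasurable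
    have m2 : AEStronglyMeasurable (fun y : ℂ => y⁻¹) volume := measurable_inv.aestronglyMeasurable
    exact m1.smul m2
  have hFi : Integrable (F z) := by
    refine (shift_int (h.cauchy1 z).1).congr (Eventually.of_forall fun y => ?_)
    simp [hF]
  have hF'm : AEStronglyMeasurable (F' z) := by
    have m1 : AEStronglyMeasurable (fun y => Real.exp (u (z - y)) • rl (gg u (z - y))) := by
      have m1 : AEStronglyMeasurable (fun y => Real.exp (u (z - y))) volume :=
        (Real.continuous_exp.comp (h.cont.comp (by fun_prop))).aestronglyMeasurable
      have m2 : AEStronglyMeasurable (fun y => rl (gg u (z - y))) volume :=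
        rl.continuous.comp_aestronglyMeasurable
          (h.gg_meas.comp (by fun_prop : Measurable fun y : ℂ => z - y)).aestronglyMeasurable
      exact m1.smul m2
    exact ContinuousLinearMap.aestronglyMeasurable_comp₂ (ContinuousLinearMap.smulRightL ℝ ℂ ℂ) m1
      measurable_inv.aestronglyMeasurable
  set bd : ℂ → ℝ := fun y => ‖(0 : ℂ) - y‖ ^ (-1 : ℝ) * (C * 2 ^ (2 + s) * (2 * G) * (1 + ‖z - y‖) ^ (-(2 + s))) with hbd
  have hbdi : Integrable bd := by
    have i1 : Integrable (fun y : ℂ => (1 + ‖y‖) ^ (-(2 + s))) :=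
      integrable_one_add_norm (by rw [hdC]; push_cast; linarith)
    refine (pot_bound hdC zero_le_one one_lt_two (fun y => by positivity) ((i1.comp_sub_left z).const_mul _)
      (C0 := C * 2 ^ (2 + s) * (2 * G)) 0 (fun y _ => ?_)).1
    refine mul_le_of_le_one_right (by positivity) ?_
    exact Real.rpow_le_one_of_one_le_of_nonpos (by linarith [norm_nonneg (z - y)]) (by linarith)
  have hbound : ∀ᵐ y : ℂ, ∀ x ∈ ball z 1, ‖F' x y‖ ≤ bd y := by
    refine Eventually.of_forall fun y x hx => ?_
    simp only [hF', hbd]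
    rw [ContinuousLinearMap.norm_smulRight_apply, norm_smul, Real.norm_of_nonneg (Real.exp_pos _).le,
      norm_inv, Real.rpow_neg_one, zero_sub, norm_neg, mul_comm]
    refine mul_le_mul_of_nonneg_left ?_ (by positivity)
    have n1 : ‖rl (gg u (x - y))‖ ≤ 2 * G := (rl_norm _).trans (by linarith [hG (x - y)])
    have n2 : Real.exp (u (x - y)) ≤ C * 2 ^ (2 + s) * (1 + ‖z - y‖) ^ (-(2 + s)) := by
      refine (hdec (x - y)).trans ?_
      rw [mul_assoc]
      refine mul_le_mul_of_nonneg_left ?_ hC.le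
      have p1 : 0 < 1 + ‖x - y‖ := by positivity
      have p2 : 0 < 1 + ‖z - y‖ := by positivity
      rw [Real.rpow_neg p1.le, Real.rpow_neg p2.le, ← div_eq_mul_inv, ← Real.div_rpow (by norm_num) p2.le,
        ← Real.inv_rpow p1.le]
      apply Real.rpow_le_rpow (by positivity) _ (by linarith)
      rw [inv_eq_one_div, div_le_div_iff₀ p1 p2]
      have hx' : ‖z - x‖ < 1 := by rw [mem_ball, dist_comm, dist_eq_norm] at hx; exact hx
      have : ‖z - y‖ ≤ ‖z - x‖ + ‖x - y‖ := norm_sub_le_norm_sub_add_norm_sub _ _ _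
      linarith [norm_nonneg (x - y)]
    calc _ ≤ (C * 2 ^ (2 + s) * (1 + ‖z - y‖) ^ (-(2 + s))) * (2 * G) :=
          mul_le_mul n2 n1 (norm_nonneg _) (by positivity)
      _ = _ := by ring
  have hdiff : ∀ᵐ y : ℂ, ∀ x ∈ ball z 1, HasFDerivAt (F · y) (F' x y) x := by
    refine Eventually.of_forall fun y x _ => ?_
    have h1 : HasFDerivAt (fun x => u (x - y)) (rl (gg u (x - y))) x := by
      have := (h.hasFDeriv (x - y)).comp x ((hasFDerivAt_id x).sub_const y)
      rw [ContinuousLinearMap.comp_id] at this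
      exact this
    exact (h1.exp).smul_const y⁻¹
  have hmain := hasFDerivAt_integral_of_dominated_of_fderiv_le (ball_mem_nhds z one_pos)
    (Eventually.of_forall hFm) hFi hF'm hbound hbdi hdiff
  have hF'i : Integrable (F' z) := hbdi.mono' hF'm (hbound.mono fun y hy => hy z (mem_ball_self one_pos))
  have hgg : gg u = fun x => (-(1 / (4 * π) : ℝ)) • ∫ y, F x y := by
    funext x
    unfold gg
    rw [shift]
    simp [hF]
  have h2 := hmain.const_smul (-(1 / (4 * π) : ℝ))
  rw [hgg]
  refine h2.congr_fderiv ?_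
  ext1 e
  rw [LL_apply, ContinuousLinearMap.smul_apply, ContinuousLinearMap.integral_apply hF'i]
  have e1 : ∀ y, F' z y e = e * (((Real.exp (u (z - y)) : ℂ) * gg u (z - y)) * y⁻¹) +
      conj e * (((Real.exp (u (z - y)) : ℂ) * conj (gg u (z - y))) * y⁻¹) := by
    intro y
    simp only [hF', ContinuousLinearMap.smulRight_apply, ContinuousLinearMap.smul_apply, rl_apply, smul_eq_mul,
      Complex.real_smul]
    have : ((2 * (gg u (z - y) * e).re : ℝ) : ℂ) = gg u (z - y) * e + conj (gg u (z - y)) * conj e := by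
      rw [← map_mul, Complex.add_conj]
    rw [Complex.ofReal_mul, this]; ring
  simp_rw [e1]
  rw [integral_add, integral_const_mul, integral_const_mul]
  · unfold AA BB
    rw [shift, shift]
    simp only [Complex.real_smul]
    push_cast
    ring
  · exact (shift_int (f := fun y => (Real.exp (u y) : ℂ) * gg u y) (h.ggA_int z)).const_mul e
  · exact (shift_int (f := fun y => (Real.exp (u y) : ℂ) * conj (gg u y)) (h.ggB_int z)).const_mul (conj e)

/-- the loop equation -/
theorem loop (h : Ent u) (z : ℂ) : gg u z ^ 2 = 2 * AA u z := by
  set κ : ℂ := -((1 / (4 * π) : ℝ) : ℂ) with hκ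
  set p : ℂ → ℂ := fun y => (Real.exp (u y) : ℂ) with hp
  set K : ℂ → ℂ → ℂ := fun y y' => p y * (z - y)⁻¹ * (p y' * (y - y')⁻¹) with hK
  have hpm : Measurable p := (Complex.continuous_ofReal.comp (Real.continuous_exp.comp h.cont)).measurable
  have hKi : Integrable (Function.uncurry K) (volume.prod volume) := by
    have hm : Measurable (Function.uncurry K) := by
      have : Function.uncurry K = fun q : ℂ × ℂ => p q.1 * (z - q.1)⁻¹ * (p q.2 * (q.1 - q.2)⁻¹) := rfl
      rw [this]
      fun_prop
    rw [integrable_prod_iff hm.aestronglyMeasurable]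
    constructor
    · refine Eventually.of_forall fun y => ?_
      show Integrable (fun y' => p y * (z - y)⁻¹ * (p y' * (y - y')⁻¹))
      exact (h.cauchy1 y).1.const_mul _
    · have hle : ∀ y, ‖∫ y', ‖K y y'‖‖ ≤ (1 * JJ ℂ 1 + 1 * ∫ y, Real.exp (u y)) * ‖p y * (z - y)⁻¹‖ := by
        intro y
        rw [Real.norm_of_nonneg (integral_nonneg fun _ => norm_nonneg _)]
        simp only [hK, norm_mul (p y * (z - y)⁻¹)]
        rw [integral_const_mul, mul_comm]
        exact mul_le_mul_of_nonneg_right (h.cauchy1 y).2.2.2 (norm_nonneg _)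
      refine ((h.cauchy1 z).1.norm.const_mul _).mono' ?_ (Eventually.of_forall hle)
      exact hm.norm.aestronglyMeasurable.integral_prod_right'
  have hgy : ∀ y, gg u y = κ * ∫ y', p y' * (y - y')⁻¹ := fun y => rfl
  have hA : AA u z = κ * (κ * ∫ y, ∫ y', K y y') := by
    unfold AA
    congr 1
    rw [← integral_const_mul]
    congr 1
    funext y
    simp only [hK]
    rw [integral_const_mul, hgy]
    ring
  have hs : ∫ y, ∫ y', K y' y = ∫ y, ∫ y', K y y' := integral_integral_swap (f := fun y y' => K y' y) hKi.swap
  have hsq : (∫ y, p y * (z - y)⁻¹) ^ 2 = (∫ y, ∫ y', K y y') + ∫ y, ∫ y', K y' y := by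
    have j1 : Integrable (fun y => ∫ y', K y y') := hKi.integral_prod_left
    have j2 : Integrable (fun y => ∫ y', K y' y) := hKi.swap.integral_prod_left
    rw [← integral_add j1 j2]
    have a1 : ∀ᵐ y : ℂ, y ≠ z := by simp [ae_iff, measure_singleton]
    rw [sq, ← integral_mul_const]
    refine integral_congr_ae ?_
    filter_upwards [a1, hKi.prod_right_ae, hKi.swap.prod_right_ae] with y hy hi1 hi2
    have hi1' : Integrable (fun y' => K y y') := hi1
    have hi2' : Integrable (fun y' => K y' y) := hi2
    show _ = (∫ y', K y y') + ∫ y', K y' y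
    rw [← integral_add hi1' hi2', ← integral_const_mul]
    refine integral_congr_ae ?_
    have a2 : ∀ᵐ y' : ℂ, y' ≠ y := by simp [ae_iff, measure_singleton]
    filter_upwards [a1, a2] with y' hy' hyy'
    simp only [hK]
    have n1 : z - y ≠ 0 := sub_ne_zero.2 hy.symm
    have n2 : z - y' ≠ 0 := sub_ne_zero.2 hy'.symm
    have n3 : y' - y ≠ 0 := sub_ne_zero.2 hyy'
    have n4 : y - y' ≠ 0 := sub_ne_zero.2 hyy'.symm
    rw [show y - y' = -(y' - y) by ring]
    rw [inv_neg]
    field_simp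
    ring
  rw [hA, hgy, mul_pow, hsq, hs]
  ring

end Ent

end

noncomputable section

open scoped RealInnerProductSpace ComplexConjugate

namespace Ent

variable {u : ℂ → ℝ}

theorem BB_im (h : Ent u) (z : ℂ) : (BB u z).im = 0 := by
  have h1 : HasFDerivAt (fun x => rl (gg u x)) (rl.comp (LL (AA u z) (BB u z))) z :=
    rl.hasFDerivAt.comp z (h.gg_hasFDeriv z)
  have h2 := second_derivative_symmetric (fun y => h.hasFDeriv y) h1 1 Complex.I
  simp only [ContinuousLinearMap.comp_apply, rl_apply, LL_apply] at h2
  simp at h2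
  linarith

/-- the holomorphic function attached to the solution -/
def HH (u : ℂ → ℝ) (z : ℂ) : ℂ := (Real.exp (-(u z) / 2) : ℂ) * conj (gg u z)

theorem ff_deriv (h : Ent u) (z : ℂ) : HasFDerivAt (fun x => Real.exp (-(u x) / 2))
    ((-(Real.exp (-(u z) / 2)) / 2) • rl (gg u z)) z := by
  have h1 : HasFDerivAt (fun x => -(1 / 2 : ℝ) * u x) (-(1 / 2 : ℝ) • rl (gg u z)) z :=
    (h.hasFDeriv z).const_mul _
  have h2 := h1.exp
  have e : (fun x => Real.exp (-(u x) / 2)) = fun x => Real.exp (-(1 / 2 : ℝ) * u x) := by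
    funext x; congr 1; ring
  rw [e]
  refine h2.congr_fderiv ?_
  rw [smul_smul]
  congr 1
  rw [show -(u z) / 2 = -(1 / 2 : ℝ) * u z by ring]
  ring

theorem HH_deriv (h : Ent u) (z : ℂ) : HasDerivAt (HH u)
    ((Real.exp (-(u z) / 2) * ((BB u z).re - ‖gg u z‖ ^ 2 / 2) : ℝ) : ℂ) z := by
  have h1 := h.ff_deriv z
  have h1' : HasFDerivAt (fun x => (Real.exp (-(u x) / 2) : ℂ))
      (Complex.ofRealCLM.comp ((-(Real.exp (-(u z) / 2)) / 2) • rl (gg u z))) z :=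
    Complex.ofRealCLM.hasFDerivAt.comp z h1
  have h2 : HasFDerivAt (fun x => conj (gg u x))
      ((Complex.conjCLE : ℂ →L[ℝ] ℂ).comp (LL (AA u z) (BB u z))) z :=
    (Complex.conjCLE : ℂ →L[ℝ] ℂ).hasFDerivAt.comp z (h.gg_hasFDeriv z)
  have h3 := h1'.mul h2
  rw [hasDerivAt_iff_hasFDerivAt]
  refine hasFDerivAt_of_restrictScalars ℝ h3 ?_
  ext1 e
  have hl := h.loop z
  have hB : conj (BB u z) = ((BB u z).re : ℂ) := by
    apply Complex.ext
    · simp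
    · simp [h.BB_im z]
  have hn : ((‖gg u z‖ ^ 2 : ℝ) : ℂ) = gg u z * conj (gg u z) := by
    rw [Complex.mul_conj, Complex.normSq_eq_norm_sq]
  have h2r : (2 : ℂ) * ((gg u z * e).re : ℂ) = gg u z * e + conj (gg u z) * conj e := by
    rw [← map_mul, Complex.add_conj]; push_cast; rfl
  have hA : conj (AA u z) = conj (gg u z) ^ 2 / 2 := by
    have : AA u z = gg u z ^ 2 / 2 := by rw [hl]; ring
    rw [this, map_div₀, map_pow, map_ofNat]
  simp only [ContinuousLinearMap.coe_restrictScalars', ContinuousLinearMap.add_apply, ContinuousLinearMap.smul_apply,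
    ContinuousLinearMap.comp_apply, ContinuousLinearMap.toSpanSingleton_apply, rl_apply, smul_eq_mul,
    ContinuousLinearEquiv.coe_coe, Complex.conjCLE_apply, LL_apply, map_add, map_mul, Complex.ofRealCLM_apply,
    Complex.conj_conj, hB, hA]
  push_cast
  rw [h2r]
  have hn' : (‖gg u z‖ : ℂ) ^ 2 = gg u z * conj (gg u z) := by rw [← hn]; push_cast; rfl
  rw [hn']
  ring

theorem real_holo {H : ℂ → ℂ} {r : ℂ → ℝ} (h : ∀ z, HasDerivAt H (r z : ℂ) z) (z : ℂ) : r z = r 0 := by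
  have hH : Differentiable ℂ H := fun z => (h z).differentiableAt
  have hd : deriv H = fun z => (r z : ℂ) := funext fun z => (h z).deriv
  have hD : Differentiable ℂ (fun z => (r z : ℂ)) := by
    rw [← hd]; exact hH.deriv
  have h0 : ∀ z, deriv (fun z => (r z : ℂ)) z = 0 := by
    intro z
    set a := deriv (fun z => (r z : ℂ)) z with ha
    have h1 : HasDerivAt (fun z => (r z : ℂ)) a z := (hD z).hasDerivAt
    have h2 : HasFDerivAt (fun z => (r z : ℂ)) ((ContinuousLinearMap.toSpanSingleton ℂ a).restrictScalars ℝ) z :=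
      h1.hasFDerivAt.restrictScalars ℝ
    have h3 : HasFDerivAt (fun z => ((r z : ℂ)).im)
      (Complex.imCLM.comp ((ContinuousLinearMap.toSpanSingleton ℂ a).restrictScalars ℝ)) z :=
      Complex.imCLM.hasFDerivAt.comp z h2
    simp only [Complex.ofReal_im] at h3
    have h4 := h3.unique (hasFDerivAt_const 0 z)
    have h5 := DFunLike.congr_fun h4 1
    have h6 := DFunLike.congr_fun h4 Complex.I
    simp at h5 h6
    exact Complex.ext h6 h5
  have := is_const_of_deriv_eq_zero hD h0 z 0
  exact_mod_cast this

theorem classify (h : Ent u) (x : ℂ) : u x = -2 * Real.log (1 + ‖x‖ ^ 2 / 8) := by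
  have hpi := Real.pi_pos
  set r : ℂ → ℝ := fun z => Real.exp (-(u z) / 2) * ((BB u z).re - ‖gg u z‖ ^ 2 / 2) with hr
  set f : ℂ → ℝ := fun z => Real.exp (-(u z) / 2) with hf
  have hg0 : gg u 0 = 0 := by
    have hm : IsLocalMax u 0 := Eventually.of_forall fun y => by rw [h.zero]; exact h.nonpos y
    have h1 := hm.hasFDerivAt_eq_zero (h.hasFDeriv 0)
    have h5 := DFunLike.congr_fun h1 1
    have h6 := DFunLike.congr_fun h1 Complex.I
    simp [rl_apply] at h5 h6
    exact Complex.ext h5 h6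
  set a := r 0 with ha
  have hra : ∀ z, r z = a := fun z => real_holo (fun z => h.HH_deriv z) z
  have hH : ∀ z, HH u z = a * z := by
    intro z
    have hd : ∀ z, HasDerivAt (fun z => HH u z - a * z) 0 z := by
      intro z
      have h1 := (h.HH_deriv z).sub ((hasDerivAt_id z).const_mul (a : ℂ))
      have h2 : ((r z : ℝ) : ℂ) - (a : ℂ) * 1 = 0 := by rw [hra]; ring
      exact h1.congr_deriv h2
    have := is_const_of_deriv_eq_zero (fun z => (hd z).differentiableAt) (fun z => (hd z).deriv) z 0
    have h0 : HH u 0 = 0 := by simp [HH, hg0]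
    simp only [h0, mul_zero, sub_zero] at this
    exact sub_eq_zero.1 this
  have hfpos : ∀ z, 0 < f z := fun z => Real.exp_pos _
  have hf0 : f 0 = 1 := by simp [hf, h.zero]
  have hfg : ∀ z, (f z : ℂ) * gg u z = a * conj z := by
    intro z
    have := congrArg conj (hH z)
    simp only [HH, map_mul, Complex.conj_ofReal, Complex.conj_conj] at this
    exact this
  have hff : ∀ z, f z = 1 + (-a / 2) * ‖z‖ ^ 2 := by
    intro z
    have hd : ∀ z, HasFDerivAt (fun z : ℂ => f z + (a / 2) * ‖z‖ ^ 2) (0 : ℂ →L[ℝ] ℝ) z := by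
      intro z
      have h1 := (h.ff_deriv z).add (((hasStrictFDerivAt_norm_sq z).hasFDerivAt).const_mul (a / 2))
      refine h1.congr_fderiv ?_
      ext1 e
      simp [rl_apply, Complex.inner]
      have h2 := congrArg (fun w => (w * e).re) (hfg z)
      simp only [mul_assoc, Complex.re_ofReal_mul] at h2
      simp only [Complex.mul_re, Complex.conj_re, Complex.conj_im, hf] at h2
      linear_combination -h2
    have := is_const_of_fderiv_eq_zero (fun z => (hd z).differentiableAt) (fun z => (hd z).fderiv) z 0
    simp [hf0] at this
    linarith
  set b := -a / 2 with hb
  have hp : ∀ z, Real.exp (u z) = ((f z) ^ 2)⁻¹ := by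
    intro z
    simp only [hf]
    rw [← Real.exp_nat_mul, ← Real.exp_neg]
    congr 1
    push_cast; ring
  have hb0 : b ≠ 0 := by
    intro hb0
    apply not_integrable_one
    refine h.int.congr (Eventually.of_forall fun z => ?_)
    simp only
    rw [hp, hff, hb0]; simp
  have hbpos : 0 < b := by
    by_contra! hneg
    have hlt : b < 0 := lt_of_le_of_ne hneg hb0
    have h1 := hfpos ((√(-1 / b) : ℝ) : ℂ)
    have hnn : 0 ≤ -1 / b := div_nonneg_of_nonpos (by norm_num) hlt.le
    rw [hff, Complex.norm_real, Real.norm_of_nonneg (Real.sqrt_nonneg _), Real.sq_sqrt hnn] at h1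
    rw [mul_div_cancel₀ _ hb0] at h1
    linarith
  have haB : (BB u 0) = a := by
    apply Complex.ext
    · rw [ha, hr]; simp [h.zero, hg0]
    · simp [h.BB_im 0]
  have hBi : BB u 0 = ((a / (8 * b) : ℝ) : ℂ) := by
    unfold BB
    have e1 : ∫ y, ((Real.exp (u y) : ℂ) * conj (gg u y)) * (0 - y)⁻¹ =
        ∫ y : ℂ, ((-a * ((1 + b * ‖y‖ ^ 2) ^ 3)⁻¹ : ℝ) : ℂ) := by
      refine integral_congr_ae ?_
      have a1 : ∀ᵐ y : ℂ, y ≠ 0 := by simp [ae_iff, measure_singleton]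
      filter_upwards [a1] with y hy
      have h1 := hH y
      have hfy : (f y : ℂ) ≠ 0 := by exact_mod_cast (hfpos y).ne'
      have h2 : conj (gg u y) = a * y / f y := by
        rw [eq_div_iff hfy, mul_comm]; exact h1
      rw [h2, hp, ← hff]
      push_cast
      field_simp
      ring
    rw [e1, integral_complex_ofReal, integral_const_mul, radial_C (fun t => ((1 + b * t ^ 2) ^ 3)⁻¹), int_cube hbpos,
      ← Complex.ofReal_neg, ← Complex.ofReal_mul]
    congr 1
    field_simp
    ring
  have hb8 : b = 1 / 8 := by
    rw [haB] at hBi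
    have h1 : a = a / (8 * b) := by exact_mod_cast hBi
    have ha0 : a ≠ 0 := by intro h0; apply hb0; rw [hb, h0]; simp
    field_simp at h1
    linarith
  have h1 := hff x
  rw [hb8] at h1
  have h2 : Real.log (f x) = -(u x) / 2 := by simp [hf]
  rw [h1] at h2
  rw [show 1 + ‖x‖ ^ 2 / 8 = 1 + 1 / 8 * ‖x‖ ^ 2 by ring, h2]
  ring

end Ent

end

noncomputable section


theorem hdE : Module.finrank ℝ E2 = 2 := by simp

theorem classE2 {u : E2 → ℝ} (cont : Continuous u) (zero : u 0 = 0) (nonpos : ∀ x, u x ≤ 0)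
    (int : Integrable (fun x => Real.exp (u x)))
    (eq : ∀ x, u x = -(1 / (2 * π)) * ∫ y, kk x y * Real.exp (u y)) (x : E2) : u x = U x := by
  set L : ℂ ≃ₗᵢ[ℝ] E2 := Complex.orthonormalBasisOneI.repr
  have hmp : MeasurePreserving L volume volume := L.measurePreserving
  have hme : MeasurableEmbedding L := L.toHomeomorph.measurableEmbedding
  have hE : Ent (fun z => u (L z)) := by
    refine ⟨cont.comp L.continuous, by simp [zero], fun z => nonpos _, ?_, fun z => ?_⟩
    · exact (hmp.integrable_comp_emb hme).2 int
    · rw [eq (L z), ← hmp.integral_comp hme]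
      congr 2
      funext y
      congr 1
      unfold kk
      rw [← map_sub, L.norm_map, L.norm_map]
  have h := hE.classify (L.symm x)
  simp only [LinearIsometryEquiv.apply_symm_apply, LinearIsometryEquiv.norm_map] at h
  rw [h]
  unfold U
  rw [one_div, Real.log_inv, Real.log_pow]
  push_cast; ring

theorem expU (x : E2) : Real.exp (U x) = ((1 + 1 / 8 * ‖x‖ ^ 2) ^ 2)⁻¹ := by
  unfold U
  rw [Real.exp_log (by positivity), one_div]
  congr 3; ring

theorem U_nonpos (x : E2) : U x ≤ 0 := by
  unfold U
  apply Real.log_nonpos (by positivity)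
  rw [one_div]
  apply inv_le_one_of_one_le₀
  have : 1 ≤ 1 + ‖x‖ ^ 2 / 8 := by linarith [sq_nonneg ‖x‖]
  nlinarith

theorem extract_pt {G : ℕ → E2 → ℝ} {Λ : ℝ} {r : ℕ → ℝ} (hΛ : 0 ≤ Λ) (hr : Tendsto r atTop atTop)
    (hb : ∀ k x, |G k x| ≤ Λ * ‖x‖)
    (hl : ∀ k, ∀ x ∈ ball (0 : E2) (r k), ∀ x' ∈ ball (0 : E2) (r k), |G k x - G k x'| ≤ Λ * ‖x - x'‖) :
    ∃ ms : ℕ → ℕ, StrictMono ms ∧ ∃ u : E2 → ℝ, (∀ x, Tendsto (fun k => G (ms k) x) atTop (𝓝 (u x))) ∧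
      (∀ x x', |u x - u x'| ≤ Λ * ‖x - x'‖) := by
  set D := TopologicalSpace.denseSeq E2
  set K : Set (ℕ → ℝ) := Set.pi Set.univ fun i => Set.Icc (-(Λ * ‖D i‖)) (Λ * ‖D i‖)
  have hK : IsCompact K := isCompact_univ_pi fun i => isCompact_Icc
  obtain ⟨a, -, ms, hms, hlim⟩ := hK.tendsto_subseq (x := fun k i => G k (D i))
    (fun k i _ => abs_le.1 (hb k (D i)))
  rw [tendsto_pi_nhds] at hlim
  have hrm : Tendsto (fun k => r (ms k)) atTop atTop := hr.comp hms.tendsto_atTop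
  have hc : ∀ x, CauchySeq (fun k => G (ms k) x) := by
    intro x
    rw [Metric.cauchySeq_iff]
    intro ε hε
    obtain ⟨i, hi⟩ := (TopologicalSpace.denseRange_denseSeq E2).exists_dist_lt x
      (show 0 < ε / (3 * (Λ + 1)) by positivity)
    have hi' : Λ * ‖x - D i‖ < ε / 3 := by
      rw [dist_eq_norm] at hi
      have h1 : (Λ + 1) * ‖x - D i‖ < ε / 3 := by
        calc _ < (Λ + 1) * (ε / (3 * (Λ + 1))) := by gcongr
          _ = ε / 3 := by field_simp
      nlinarith [norm_nonneg (x - D i)]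
    obtain ⟨N1, hN1⟩ := Metric.cauchySeq_iff.1 (hlim i).cauchySeq (ε / 3) (by positivity)
    obtain ⟨N2, hN2⟩ := eventually_atTop.1 ((hrm.eventually_gt_atTop ‖x‖).and (hrm.eventually_gt_atTop ‖D i‖))
    refine ⟨max N1 N2, fun m hm n hn => ?_⟩
    have b1 := hN1 m (le_of_max_le_left hm) n (le_of_max_le_left hn)
    have q1 := hN2 m (le_of_max_le_right hm)
    have q2 := hN2 n (le_of_max_le_right hn)
    have l1 := hl (ms m) x (by simpa using q1.1) (D i) (by simpa using q1.2)
    have l2 := hl (ms n) x (by simpa using q2.1) (D i) (by simpa using q2.2)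
    simp only [Function.comp, Real.dist_eq] at b1 ⊢
    rw [abs_lt] at b1 ⊢
    rw [abs_le] at l1 l2
    constructor <;> linarith [b1.1, b1.2, l1.1, l1.2, l2.1, l2.2]
  choose u hu using fun x => cauchySeq_tendsto_of_complete (hc x)
  refine ⟨ms, hms, u, hu, fun x x' => ?_⟩
  refine le_of_tendsto ((hu x).sub (hu x')).abs ?_
  filter_upwards [hrm.eventually_gt_atTop ‖x‖, hrm.eventually_gt_atTop ‖x'‖] with k h1 h2
  exact hl (ms k) x (by simpa using h1) x' (by simpa using h2)

theorem fatou_int {P : ℕ → E2 → ℝ} {q : E2 → ℝ} {M : ℝ} (hP0 : ∀ k y, 0 ≤ P k y) (hPi : ∀ k, Integrable (P k))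
    (hM : ∀ k, ∫ y, P k y ≤ M) (hq : AEStronglyMeasurable q)
    (hlim : ∀ y, Tendsto (fun k => P k y) atTop (𝓝 (q y))) : Integrable q := by
  refine ⟨hq, ?_⟩
  have h1 : ∀ y, ENNReal.ofReal (q y) = liminf (fun k => ENNReal.ofReal (P k y)) atTop := fun y =>
    ((ENNReal.continuous_ofReal.tendsto _).comp (hlim y)).liminf_eq.symm
  have hq0 : ∀ y, 0 ≤ q y := fun y => ge_of_tendsto' (hlim y) (fun k => hP0 k y)
  rw [hasFiniteIntegral_iff_ofReal (Eventually.of_forall hq0)]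
  simp_rw [h1]
  have h2 : ∫⁻ y, liminf (fun k => ENNReal.ofReal (P k y)) atTop ≤
      liminf (fun k => ∫⁻ y, ENNReal.ofReal (P k y)) atTop :=
    lintegral_liminf_le' (fun k => (hPi k).aestronglyMeasurable.aemeasurable.ennreal_ofReal)
  refine h2.trans_lt (lt_of_le_of_lt ?_ (ENNReal.ofReal_lt_top (r := M)))
  refine Filter.liminf_le_of_frequently_le' (Frequently.of_forall fun k => ?_)
  rw [← ofReal_integral_eq_lintegral_ofReal (hPi k) (Eventually.of_forall (hP0 k))]
  exact ENNReal.ofReal_le_ofReal (hM k)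

/-- convergence of the rescaled solutions to the standard bubble -/
theorem bubble {P vt A : ℕ → E2 → ℝ} {r ε : ℕ → ℝ} {C0 M : ℝ} (hr : Tendsto r atTop atTop)
    (hε : Tendsto ε atTop (𝓝 0)) (hC0 : 0 ≤ C0)
    (hP0 : ∀ k y, 0 ≤ P k y) (hPi : ∀ k, Integrable (P k)) (hM : ∀ k, ∫ y, P k y ≤ M)
    (hC : ∀ k, ∀ y ∈ ball (0 : E2) (r k), P k y ≤ C0)
    (hvt : ∀ k, ∀ y ∈ ball (0 : E2) (r k), vt k y ≤ 0)
    (hPA : ∀ k, ∀ y ∈ ball (0 : E2) (r k), P k y = A k y * Real.exp (vt k y))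
    (hA : ∀ y, Tendsto (fun k => A k y) atTop (𝓝 1))
    (hrep : ∀ k, ∀ x ∈ ball (0 : E2) (r k), |vt k x + 1 / (2 * π) * ∫ y, kk x y * P k y| ≤ ε k * ‖x‖) (x : E2) :
    Tendsto (fun k => vt k x) atTop (𝓝 (U x)) := by
  have hpi := Real.pi_pos
  have hM0 : 0 ≤ M := (integral_nonneg (hP0 0)).trans (hM 0)
  have hJ := JJ_nonneg (E := E2) 1
  set Λ := 1 / (2 * π) * (2 * (C0 * JJ E2 1 + M)) with hΛ
  have hΛ0 : 0 ≤ Λ := by positivity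
  set F : ℕ → E2 → ℝ := fun k x => -(1 / (2 * π)) * ∫ y, kk x y * P k y with hF
  have hsub : ∀ k, ∀ x ∈ ball (0 : E2) (r k - 1), ∀ y ∈ ball x 1, P k y ≤ C0 := by
    intro k x hx y hy
    apply hC
    rw [mem_ball, dist_zero_right] at hx ⊢
    rw [mem_ball, dist_eq_norm] at hy
    have := norm_le_norm_add_norm_sub' y x
    linarith
  have hkk : ∀ k x, ∀ x' : E2, (∀ y ∈ ball x 1, P k y ≤ C0) → (∀ y ∈ ball x' 1, P k y ≤ C0) →
      (∀ y ∈ ball (0 : E2) 1, P k y ≤ C0) → |F k x - F k x'| ≤ Λ * ‖x - x'‖ := by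
    intro k x x' h1 h2 h3
    have hab : ∀ y, |P k y| ≤ P k y := fun y => (abs_of_nonneg (hP0 k y)).le
    have i1 := (kk_pot hdE (hP0 k) (hPi k) (hPi k).1 hab x h1 h3).1
    have i2 := (kk_pot hdE (hP0 k) (hPi k) (hPi k).1 hab x' h2 h3).1
    have hl := (log_pot_diff hdE (hP0 k) (hPi k) (hPi k).1 hab x x' h1 h2).2
    have e1 : F k x - F k x' = -(1 / (2 * π)) * ∫ y, (Real.log ‖x - y‖ - Real.log ‖x' - y‖) * P k y := by
      simp only [hF]
      rw [← mul_sub, ← integral_sub i1 i2]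
      congr 2
      funext y
      unfold kk; ring
    rw [e1, abs_mul, abs_neg, abs_of_nonneg (show 0 ≤ 1 / (2 * π) by positivity)]
    calc _ ≤ 1 / (2 * π) * (‖x - x'‖ * (2 * (C0 * JJ E2 1 + ∫ y, P k y))) := by gcongr
      _ ≤ 1 / (2 * π) * (‖x - x'‖ * (2 * (C0 * JJ E2 1 + M))) := by gcongr; exact hM k
      _ = _ := by rw [hΛ]; ring
  have hF0 : ∀ k, F k 0 = 0 := by intro k; simp [hF, kk]
  set s : ℕ → ℝ := fun k => if 1 ≤ r k - 1 then r k - 1 else 0 with hs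
  have hst : Tendsto s atTop atTop := by
    refine (tendsto_atTop_add_const_right _ (-1 : ℝ) hr).congr' ?_
    filter_upwards [hr.eventually_ge_atTop 2] with k hk
    simp only [hs]
    rw [if_pos (by linarith)]
    ring
  have hs1 : ∀ k x, x ∈ ball (0 : E2) (s k) → 1 ≤ r k - 1 ∧ x ∈ ball (0 : E2) (r k - 1) := by
    intro k x hx
    simp only [hs] at hx
    split_ifs at hx with h
    · exact ⟨h, hx⟩
    · simp at hx
  classical
  set G : ℕ → E2 → ℝ := fun k x => if x ∈ ball (0 : E2) (s k) then F k x else 0 with hG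
  have hlip : ∀ k, ∀ x ∈ ball (0 : E2) (s k), ∀ x' ∈ ball (0 : E2) (s k), |G k x - G k x'| ≤ Λ * ‖x - x'‖ := by
    intro k x hx x' hx'
    simp only [hG, if_pos hx, if_pos hx']
    obtain ⟨h1, h2⟩ := hs1 k x hx
    obtain ⟨-, h3⟩ := hs1 k x' hx'
    exact hkk k x x' (hsub k x h2) (hsub k x' h3) (hsub k 0 (mem_ball_self (by linarith)))
  have hGb : ∀ k x, |G k x| ≤ Λ * ‖x‖ := by
    intro k x
    by_cases hx : x ∈ ball (0 : E2) (s k)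
    · have h0 : (0 : E2) ∈ ball (0 : E2) (s k) := mem_ball_self ((dist_nonneg).trans_lt (mem_ball.1 hx))
      have := hlip k x hx 0 h0
      simpa [hG, hF0, h0] using this
    · simp only [hG, if_neg hx, abs_zero]; positivity
  refine tendsto_of_subseq_tendsto fun ns hns => ?_
  obtain ⟨ms, hms, u, hu, hul⟩ := extract_pt (G := fun k => G (ns k)) hΛ0 (hst.comp hns)
    (fun k x => hGb (ns k) x) (fun k => hlip (ns k))
  refine ⟨ms, ?_⟩
  have hn : Tendsto (fun k => ns (ms k)) atTop atTop := hns.comp hms.tendsto_atTop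
  have hrn := hr.comp hn
  have hsn := hst.comp hn
  have hvu : ∀ x, Tendsto (fun k => vt (ns (ms k)) x) atTop (𝓝 (u x)) := by
    intro x
    have h1 : Tendsto (fun k => vt (ns (ms k)) x - G (ns (ms k)) x) atTop (𝓝 0) := by
      have h2 : Tendsto (fun k => ε (ns (ms k)) * ‖x‖) atTop (𝓝 0) := by
        simpa using (hε.comp hn).mul_const ‖x‖
      refine squeeze_zero_norm' ?_ h2
      filter_upwards [hrn.eventually_gt_atTop ‖x‖, hsn.eventually_gt_atTop ‖x‖] with k h3 h4
      have h5 := hrep (ns (ms k)) x (by simpa using h3)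
      have h4' : x ∈ ball (0 : E2) (s (ns (ms k))) := by simpa using h4
      simp only [hG, if_pos h4', hF, Real.norm_eq_abs]
      rw [show vt (ns (ms k)) x - -(1 / (2 * π)) * ∫ y, kk x y * P (ns (ms k)) y =
        vt (ns (ms k)) x + 1 / (2 * π) * ∫ y, kk x y * P (ns (ms k)) y by ring]
      exact h5
    have h6 := h1.add (hu x)
    simpa using h6
  have hPu : ∀ x, Tendsto (fun k => P (ns (ms k)) x) atTop (𝓝 (Real.exp (u x))) := by
    intro x
    have h1 := ((hA x).comp hn).mul ((Real.continuous_exp.tendsto _).comp (hvu x))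
    rw [one_mul] at h1
    refine h1.congr' ?_
    filter_upwards [hrn.eventually_gt_atTop ‖x‖] with k h3
    exact (hPA _ x (by simpa using h3)).symm
  have hucont : Continuous u := by
    have : LipschitzWith Λ.toNNReal u := LipschitzWith.of_dist_le' fun x y => by
      rw [Real.dist_eq, dist_eq_norm]; exact hul x y
    exact this.continuous
  have hu0 : u 0 = 0 := by
    have h1 : |u 0| ≤ 0 := by
      refine le_of_tendsto (hu 0).abs (Eventually.of_forall fun k => ?_)
      simpa using hGb (ns (ms k)) 0
    exact abs_eq_zero.1 (le_antisymm h1 (abs_nonneg _))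
  have hun : ∀ x, u x ≤ 0 := by
    intro x
    refine le_of_tendsto (hvu x) ?_
    filter_upwards [hrn.eventually_gt_atTop ‖x‖] with k h3
    exact hvt _ x (by simpa using h3)
  have hei : Integrable (fun x => Real.exp (u x)) :=
    fatou_int (fun k => hP0 (ns (ms k))) (fun k => hPi _) (fun k => hM _)
      (Real.continuous_exp.comp hucont).aestronglyMeasurable hPu
  have heq : ∀ x, u x = -(1 / (2 * π)) * ∫ y, kk x y * Real.exp (u y) := by
    intro x
    have h1 := (kk_lim hdE hrn (fun k => hP0 (ns (ms k))) (fun k => hPi _) (fun k => hM _) (fun k => hC _)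
      (fun k => (hPi (ns (ms k))).1) (fun k y => (abs_of_nonneg (hP0 _ y)).le) hei hPu x).const_mul (-(1 / (2 * π)))
    refine tendsto_nhds_unique (hu x) (h1.congr' ?_)
    filter_upwards [hsn.eventually_gt_atTop ‖x‖] with k h4
    have h4' : x ∈ ball (0 : E2) (s (ns (ms k))) := by simpa using h4
    simp only [hG, if_pos h4', hF]
  rw [← classE2 hucont hu0 hun hei heq x]
  exact hvu x

end

noncomputable section


/-- partial derivative -/
def pd (i : Fin 2) (f : E2 → ℝ) (x : E2) : ℝ := fderiv ℝ f x (EuclideanSpace.single i 1)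

theorem lap_eq (f : E2 → ℝ) (x : E2) : lap f x = ∑ i, pd i (pd i f) x := rfl

theorem pd_congr {f g : E2 → ℝ} {x : E2} (i : Fin 2) (h : f =ᶠ[𝓝 x] g) : pd i f x = pd i g x := by
  unfold pd; rw [h.fderiv_eq]

theorem pd_congr' {f g : E2 → ℝ} {x : E2} (i : Fin 2) (h : f =ᶠ[𝓝 x] g) : pd i f =ᶠ[𝓝 x] pd i g := by
  filter_upwards [h.eventuallyEq_nhds] with y hy
  exact pd_congr i hy

theorem lap_congr {f g : E2 → ℝ} {x : E2} (h : f =ᶠ[𝓝 x] g) : lap f x = lap g x := by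
  simp only [lap_eq]
  exact Finset.sum_congr rfl fun i _ => pd_congr i (pd_congr' i h)

theorem pd_contDiffAt {f : E2 → ℝ} {x : E2} {n : ℕ} (i : Fin 2) (h : ContDiffAt ℝ (n + 1 : ℕ) f x) :
    ContDiffAt ℝ n (pd i f) x := by
  unfold pd
  have := h.fderiv_right (m := n) (by norm_cast)
  exact this.clm_apply contDiffAt_const

theorem ev_diff {f : E2 → ℝ} {x : E2} (h : ContDiffAt ℝ 2 f x) : ∀ᶠ y in 𝓝 x, DifferentiableAt ℝ f y := by
  filter_upwards [h.eventually (by simp)] with y hy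
  exact hy.differentiableAt (by simp)

theorem pd_diff {f : E2 → ℝ} {x : E2} (i : Fin 2) (h : ContDiffAt ℝ 2 f x) : DifferentiableAt ℝ (pd i f) x :=
  (pd_contDiffAt (n := 1) i h).differentiableAt (by simp)

theorem pd_add {f g : E2 → ℝ} {x : E2} (i : Fin 2) (hf : DifferentiableAt ℝ f x) (hg : DifferentiableAt ℝ g x) :
    pd i (fun y => f y + g y) x = pd i f x + pd i g x := by
  unfold pd; rw [fderiv_fun_add hf hg]; rfl

theorem pd_mul {f g : E2 → ℝ} {x : E2} (i : Fin 2) (hf : DifferentiableAt ℝ f x) (hg : DifferentiableAt ℝ g x) :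
    pd i (fun y => f y * g y) x = f x * pd i g x + g x * pd i f x := by
  unfold pd; rw [fderiv_fun_mul hf hg]; rfl

theorem pd_comp {f : E2 → ℝ} {η : ℝ → ℝ} {x : E2} (i : Fin 2) (hf : DifferentiableAt ℝ f x)
    (hη : DifferentiableAt ℝ η (f x)) :
    pd i (fun y => η (f y)) x = deriv η (f x) * pd i f x := by
  unfold pd
  have := (hη.hasDerivAt.comp_hasFDerivAt x hf.hasFDerivAt).fderiv
  rw [show (fun y => η (f y)) = η ∘ f from rfl, this]; rfl

theorem lap_add {f g : E2 → ℝ} {x : E2} (hf : ContDiffAt ℝ 2 f x) (hg : ContDiffAt ℝ 2 g x) :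
    lap (fun y => f y + g y) x = lap f x + lap g x := by
  simp only [lap_eq, ← Finset.sum_add_distrib]
  refine Finset.sum_congr rfl fun i _ => ?_
  rw [← pd_add i (pd_diff i hf) (pd_diff i hg)]
  apply pd_congr
  filter_upwards [ev_diff hf, ev_diff hg] with y h1 h2
  exact pd_add i h1 h2

theorem lap_mul {f g : E2 → ℝ} {x : E2} (hf : ContDiffAt ℝ 2 f x) (hg : ContDiffAt ℝ 2 g x) :
    lap (fun y => f y * g y) x = f x * lap g x + g x * lap f x + 2 * ∑ i, pd i f x * pd i g x := by
  simp only [lap_eq, Finset.mul_sum, ← Finset.sum_add_distrib]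
  refine Finset.sum_congr rfl fun i _ => ?_
  have h0 : pd i (fun y => f y * g y) =ᶠ[𝓝 x] fun y => f y * pd i g y + g y * pd i f y := by
    filter_upwards [ev_diff hf, ev_diff hg] with y h1 h2
    exact pd_mul i h1 h2
  have df := hf.differentiableAt (by simp)
  have dg := hg.differentiableAt (by simp)
  rw [pd_congr i h0, pd_add i (df.fun_mul (pd_diff i hg)) (dg.fun_mul (pd_diff i hf)),
    pd_mul i df (pd_diff i hg), pd_mul i dg (pd_diff i hf)]
  ring

theorem lap_const (c : ℝ) (x : E2) : lap (fun _ => c) x = 0 := by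
  simp [lap]

theorem lap_const_mul {f : E2 → ℝ} {x : E2} (c : ℝ) (hf : ContDiffAt ℝ 2 f x) :
    lap (fun y => c * f y) x = c * lap f x := by
  rw [lap_mul contDiffAt_const hf, lap_const]
  simp [pd]

theorem lap_comp {f : E2 → ℝ} {η : ℝ → ℝ} {x : E2} (hf : ContDiffAt ℝ 2 f x) (hη : ContDiffAt ℝ 2 η (f x)) :
    lap (fun y => η (f y)) x = deriv (deriv η) (f x) * ∑ i, pd i f x ^ 2 + deriv η (f x) * lap f x := by
  simp only [lap_eq, Finset.mul_sum, ← Finset.sum_add_distrib]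
  refine Finset.sum_congr rfl fun i _ => ?_
  have hη1 : ∀ᶠ t in 𝓝 (f x), DifferentiableAt ℝ η t := by
    filter_upwards [hη.eventually (by simp)] with t ht
    exact ht.differentiableAt (by simp)
  have hη2 : DifferentiableAt ℝ (deriv η) (f x) := by
    have : ContDiffAt ℝ 1 (deriv η) (f x) := by
      have := hη.fderiv_right (m := 1) (by norm_num)
      have := this.clm_apply (contDiffAt_const (c := (1 : ℝ)))
      exact this
    exact this.differentiableAt (by simp)
  have df := hf.differentiableAt (by simp)
  have h0 : pd i (fun y => η (f y)) =ᶠ[𝓝 x] fun y => deriv η (f y) * pd i f y := by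
    filter_upwards [ev_diff hf, hf.continuousAt.eventually hη1] with y h1 h2
    exact pd_comp i h1 h2
  have dη : DifferentiableAt ℝ (fun y => deriv η (f y)) x := hη2.comp x df
  rw [pd_congr i h0, pd_mul i dη (pd_diff i hf), pd_comp i df hη2]
  ring

theorem pd_sq (a : E2) (i : Fin 2) (x : E2) : pd i (fun y => ‖y - a‖ ^ 2) x = 2 * (x - a) i := by
  unfold pd
  have h : HasFDerivAt (fun y : E2 => ‖y - a‖ ^ 2) (2 • (innerSL ℝ (x - a)).comp (ContinuousLinearMap.id ℝ E2)) x :=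
    ((hasFDerivAt_id x).sub_const a).norm_sq
  rw [h.fderiv]
  simp [EuclideanSpace.inner_single_right]

theorem contDiff_sq (a : E2) {n} : ContDiff ℝ n (fun y : E2 => ‖y - a‖ ^ 2) :=
  (contDiff_id.sub contDiff_const).norm_sq ℝ

theorem lap_sq (a x : E2) : lap (fun y => ‖y - a‖ ^ 2) x = 4 := by
  rw [lap_eq]
  have : ∀ i : Fin 2, pd i (pd i (fun y => ‖y - a‖ ^ 2)) x = 2 := by
    intro i
    rw [show pd i (fun y => ‖y - a‖ ^ 2) = fun y => 2 * (y - a) i from funext fun y => pd_sq a i y]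
    unfold pd
    have h1 : HasFDerivAt (fun y : E2 => (2 : ℝ) * (y - a) i) ((2 : ℝ) • (EuclideanSpace.proj i : E2 →L[ℝ] ℝ)) x := by
      have := ((EuclideanSpace.proj i : E2 →L[ℝ] ℝ).hasFDerivAt (x := x)).sub_const (a i)
      exact this.const_mul 2
    rw [h1.fderiv]; simp
  simp [this]; norm_num

theorem sum_pd_sq (a x : E2) : ∑ i, pd i (fun y => ‖y - a‖ ^ 2) x ^ 2 = 4 * ‖x - a‖ ^ 2 := by
  simp only [pd_sq]
  simp only [EuclideanSpace.norm_sq_eq, Real.norm_eq_abs, sq_abs, Finset.mul_sum]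
  exact Finset.sum_congr rfl fun i _ => by ring

/-- second derivative test -/
theorem lap_nonneg_of_min {f : E2 → ℝ} {x : E2} (hf : ContDiffAt ℝ 2 f x) (hm : IsLocalMin f x) : 0 ≤ lap f x := by
  rw [lap_eq]
  refine Finset.sum_nonneg fun i _ => ?_
  set e : E2 := EuclideanSpace.single i 1 with he
  set l : ℝ → E2 := fun t => x + t • e with hl
  have hl0 : l 0 = x := by simp [hl]
  have hld : ∀ t, HasDerivAt l e t := by
    intro t
    have := ((hasDerivAt_id t).smul_const e).const_add x
    rw [one_smul] at this
    exact this
  have hlc : Tendsto l (𝓝 0) (𝓝 x) := by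
    have := (hld 0).continuousAt.tendsto
    rwa [hl0] at this
  have hg1 : ∀ᶠ t in 𝓝 (0 : ℝ), HasDerivAt (f ∘ l) (pd i f (l t)) t := by
    filter_upwards [hlc.eventually (ev_diff hf)] with t ht
    exact ht.hasFDerivAt.comp_hasDerivAt t (hld t)
  have hg2 : deriv (f ∘ l) =ᶠ[𝓝 0] fun t => pd i f (l t) := by
    filter_upwards [hg1] with t ht using ht.deriv
  have hg3 : HasDerivAt (deriv (f ∘ l)) (pd i (pd i f) x) 0 := by
    have h1 : DifferentiableAt ℝ (pd i f) (l 0) := by rw [hl0]; exact pd_diff i hf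
    have h2 := h1.hasFDerivAt.comp_hasDerivAt 0 (hld 0)
    have h3 := h2.congr_of_eventuallyEq (f₁ := deriv (f ∘ l)) hg2
    refine h3.congr_deriv ?_
    rw [hl0]; rfl
  have hmin : IsLocalMin (f ∘ l) 0 := by
    have : IsMinFilter f (𝓝 (l 0)) (l 0) := by rw [hl0]; exact hm
    have h2 := hlc.eventually hm
    filter_upwards [h2] with t ht
    simpa [hl0] using ht
  by_contra hneg
  push Not at hneg
  have hmax := isLocalMax_of_deriv_deriv_neg (f := f ∘ l) (x₀ := 0) (by rw [hg3.deriv]; exact hneg)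
    hmin.deriv_eq_zero hg1.self_of_nhds.continuousAt
  have hconst : (f ∘ l) =ᶠ[𝓝 0] fun _ => (f ∘ l) 0 := by
    filter_upwards [hmin, hmax] with t h1 h2 using le_antisymm h2 h1
  have h4 : deriv (f ∘ l) =ᶠ[𝓝 0] fun _ => 0 := by
    filter_upwards [hconst.eventuallyEq_nhds] with t ht
    rw [ht.deriv_eq]; simp
  have h5 : deriv (deriv (f ∘ l)) 0 = 0 := by rw [h4.deriv_eq]; simp
  rw [hg3.deriv] at h5
  exact hneg.ne h5

theorem max_principle {Ω : Set E2} (ho : IsOpen Ω) (hb : IsBounded Ω) {f : E2 → ℝ}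
    (hf : ContDiffOn ℝ 2 f Ω) (hc : ContinuousOn f (closure Ω)) (hl : ∀ x ∈ Ω, lap f x ≤ 0)
    (hbd : ∀ x ∈ frontier Ω, 0 ≤ f x) : ∀ x ∈ closure Ω, 0 ≤ f x := by
  intro x0 hx0
  by_contra hneg
  push Not at hneg
  have hK : IsCompact (closure Ω) := hb.isCompact_closure
  obtain ⟨D, hD⟩ := hK.isBounded.exists_norm_le
  set ε := -f x0 / (2 * (D ^ 2 + 1)) with hε
  have hε0 : 0 < ε := by apply div_pos <;> [linarith; positivity]
  have hεD : ε * D ^ 2 < -f x0 := by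
    have : ε * (2 * (D ^ 2 + 1)) = -f x0 := by rw [hε]; field_simp
    nlinarith [sq_nonneg D]
  set h : E2 → ℝ := fun x => f x + (-ε) * ‖x - 0‖ ^ 2 with hh
  have hcont : ContinuousOn h (closure Ω) := hc.add (by fun_prop)
  obtain ⟨p, hp, hmin⟩ := hK.exists_isMinOn ⟨x0, hx0⟩ hcont
  have hpx : h p ≤ h x0 := hmin hx0
  have hx0' : h x0 ≤ f x0 := by
    simp only [hh]; nlinarith [sq_nonneg ‖x0 - 0‖]
  by_cases hpΩ : p ∈ Ω
  · have hfp : ContDiffAt ℝ 2 f p := hf.contDiffAt (ho.mem_nhds hpΩ)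
    have hs : ContDiffAt ℝ 2 (fun x : E2 => (-ε) * ‖x - 0‖ ^ 2) p := (contDiff_const.mul (contDiff_sq 0)).contDiffAt
    have hlm : IsLocalMin h p := by
      filter_upwards [ho.mem_nhds hpΩ] with y hy using hmin (subset_closure hy)
    have h1 := lap_nonneg_of_min (hfp.add hs) hlm
    have h2 : lap h p = lap f p + (-ε) * 4 := by
      rw [hh, lap_add hfp hs, lap_const_mul _ (contDiff_sq 0).contDiffAt, lap_sq]
    have h3 := hl p hpΩ
    have h1' : 0 ≤ lap h p := h1
    linarith
  · have hfr : p ∈ frontier Ω := by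
      rw [ho.frontier_eq]; exact ⟨hp, hpΩ⟩
    have h1 := hbd p hfr
    have h2 : ‖p‖ ^ 2 ≤ D ^ 2 := by
      have := hD p hp
      have := norm_nonneg p
      nlinarith
    have h3 : h p = f p - ε * ‖p‖ ^ 2 := by simp [hh]; ring
    nlinarith

theorem ibp_lap {f g : E2 → ℝ} (hf : ContDiff ℝ 2 f) (hg : ContDiff ℝ 2 g) (hs : HasCompactSupport g) :
    ∫ x, f x * lap g x = ∫ x, lap f x * g x := by
  have pdc : ∀ {n : ℕ} {u : E2 → ℝ} (i), ContDiff ℝ (n + 1 : ℕ) u → ContDiff ℝ n (pd i u) := by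
    intro n u i hu
    exact contDiff_iff_contDiffAt.2 fun x => pd_contDiffAt i hu.contDiffAt
  have pds : ∀ {u : E2 → ℝ} (i), HasCompactSupport u → HasCompactSupport (pd i u) := by
    intro u i hu
    exact hu.fderiv_apply (𝕜 := ℝ) (EuclideanSpace.single i 1)
  have f1 := fun i => pdc (n := 1) i hf
  have f2 := fun i => pdc (n := 0) i (f1 i)
  have g1 := fun i => pdc (n := 1) i hg
  have g2 := fun i => pdc (n := 0) i (g1 i)
  have s1 := fun i => pds i hs
  have s2 := fun i => pds i (s1 i)
  have I1 : ∀ i, Integrable fun x => f x * pd i (pd i g) x := fun i =>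
    (hf.continuous.mul (g2 i).continuous).integrable_of_hasCompactSupport (s2 i).mul_left
  have I2 : ∀ i, Integrable fun x => pd i f x * pd i g x := fun i =>
    ((f1 i).continuous.mul (g1 i).continuous).integrable_of_hasCompactSupport (s1 i).mul_left
  have I3 : ∀ i, Integrable fun x => pd i (pd i f) x * g x := fun i =>
    ((f2 i).continuous.mul hg.continuous).integrable_of_hasCompactSupport hs.mul_left
  have I4 : ∀ i, Integrable fun x => f x * pd i g x := fun i =>
    (hf.continuous.mul (g1 i).continuous).integrable_of_hasCompactSupport (s1 i).mul_left
  have I5 : ∀ i, Integrable fun x => pd i f x * g x := fun i =>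
    ((f1 i).continuous.mul hg.continuous).integrable_of_hasCompactSupport hs.mul_left
  simp only [lap_eq, Finset.mul_sum, Finset.sum_mul]
  rw [integral_finsetSum _ (fun i _ => I1 i), integral_finsetSum _ (fun i _ => I3 i)]
  refine Finset.sum_congr rfl fun i _ => ?_
  have e1 := integral_mul_fderiv_eq_neg_fderiv_mul_of_integrable (μ := (volume : Measure E2)) (f := f) (g := pd i g) (v := EuclideanSpace.single i 1)
    (I2 i) (I1 i) (I4 i) (fun x _ => hf.differentiable (by simp) x) (fun x _ => (g1 i).differentiable (by simp) x)
  have e2 := integral_mul_fderiv_eq_neg_fderiv_mul_of_integrable (μ := (volume : Measure E2)) (f := pd i f) (g := g) (v := EuclideanSpace.single i 1)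
    (I3 i) (I2 i) (I5 i) (fun x _ => (f1 i).differentiable (by simp) x) (fun x _ => hg.differentiable (by simp) x)
  have e1' : ∫ x, f x * pd i (pd i g) x = -∫ x, pd i f x * pd i g x := e1
  have e2' : ∫ x, pd i f x * pd i g x = -∫ x, pd i (pd i f) x * g x := e2
  rw [e1', e2', neg_neg]

end

noncomputable section


theorem pd_contDiff {n : ℕ} {u : E2 → ℝ} (i : Fin 2) (hu : ContDiff ℝ (n + 1 : ℕ) u) : ContDiff ℝ n (pd i u) :=
  contDiff_iff_contDiffAt.2 fun _ => pd_contDiffAt i hu.contDiffAt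

theorem lap_continuous {u : E2 → ℝ} (hu : ContDiff ℝ 2 u) : Continuous (lap u) := by
  have : lap u = fun x => ∑ i, pd i (pd i u) x := rfl
  rw [this]
  exact continuous_finsetSum _ fun i _ => (pd_contDiff (n := 0) i (pd_contDiff (n := 1) i hu)).continuous

theorem lap_compact {u : E2 → ℝ} (hu : HasCompactSupport u) : HasCompactSupport (lap u) := by
  have : ∀ x, x ∉ tsupport u → lap u x = 0 := by
    intro x hx
    have h1 : u =ᶠ[𝓝 x] fun _ => 0 := notMem_tsupport_iff_eventuallyEq.1 hx
    rw [lap_congr h1, lap_const]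
  exact HasCompactSupport.intro hu this

/-- smooth convex truncation -/
def eta (t : ℝ) : ℝ := ∫ s in (0 : ℝ)..t, Real.smoothTransition s

theorem eta_deriv (t : ℝ) : HasDerivAt eta (Real.smoothTransition t) t :=
  Real.smoothTransition.continuous.integral_hasStrictDerivAt 0 t |>.hasDerivAt

theorem eta_deriv' : deriv eta = Real.smoothTransition := funext fun t => (eta_deriv t).deriv

theorem eta_contDiff : ContDiff ℝ 2 eta := by
  rw [show (2 : WithTop ℕ∞) = 1 + 1 by norm_num, contDiff_succ_iff_deriv]
  refine ⟨fun t => (eta_deriv t).differentiableAt, by simp, ?_⟩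
  rw [eta_deriv']
  exact Real.smoothTransition.contDiff (n := 1)

theorem eta_zero {t : ℝ} (ht : t ≤ 0) : eta t = 0 := by
  unfold eta
  rw [intervalIntegral.integral_congr (g := fun _ => 0)]
  · simp
  · intro s hs
    rw [Set.uIcc_of_ge ht] at hs
    exact Real.smoothTransition.zero_of_nonpos hs.2

theorem eta_mono : Monotone eta := by
  refine monotone_of_deriv_nonneg (fun t => (eta_deriv t).differentiableAt) fun t => ?_
  rw [eta_deriv']
  exact Real.smoothTransition.nonneg t

theorem eta_nonneg (t : ℝ) : 0 ≤ eta t := by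
  rcases le_total t 0 with h | h
  · exact (eta_zero h).ge
  · rw [← eta_zero le_rfl]; exact eta_mono h

theorem eta_ge (t : ℝ) : t - 1 ≤ eta t := by
  rcases le_total t 1 with h | h
  · linarith [eta_nonneg t]
  · have hm : MonotoneOn (fun s => eta s - s) (Set.Ici 1) := by
      refine monotoneOn_of_deriv_nonneg (convex_Ici 1) ?_ ?_ ?_
      · exact (eta_contDiff.continuous.sub continuous_id).continuousOn
      · intro s _
        exact ((eta_deriv s).sub (hasDerivAt_id s)).differentiableAt.differentiableWithinAt
      · intro s hs
        rw [interior_Ici] at hs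
        have h1 : HasDerivAt (fun s => eta s - s) (Real.smoothTransition s - 1) s :=
          (eta_deriv s).sub (hasDerivAt_id s)
        rw [h1.deriv, Real.smoothTransition.one_of_one_le (le_of_lt hs)]
        simp
    have := hm (Set.self_mem_Ici) h h
    simp only at this
    linarith [eta_nonneg 1]

theorem l1_bound {Ω : Set E2} (ho : IsOpen Ω) {D : ℝ} (hD : ∀ x ∈ Ω, ‖x‖ ≤ D) (hb : IsBounded Ω)
    {v ρ : E2 → ℝ} (hv : ContDiffOn ℝ 2 v Ω) (hc : ContinuousOn v (closure Ω))
    (hbc : ∀ x ∈ frontier Ω, v x = 0) (hρ : ∀ x ∈ Ω, -lap v x = ρ x) (hρ0 : ∀ x ∈ Ω, 0 ≤ ρ x)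
    (hρi : IntegrableOn ρ Ω) :
    ∫ x in Ω, v x ≤ D ^ 2 / 4 * (∫ x in Ω, ρ x) + 2 * (volume Ω).toReal := by
  classical
  set f : E2 → ℝ := fun x => if x ∈ Ω then eta (v x - 1) else 0 with hf
  set K : Set E2 := closure Ω ∩ v ⁻¹' (Set.Ici 1) with hK
  have hKc : IsClosed K := hc.preimage_isClosed_of_isClosed isClosed_closure isClosed_Ici
  have hKk : IsCompact K := hb.isCompact_closure.of_isClosed_subset hKc Set.inter_subset_left
  have hKΩ : K ⊆ Ω := by
    rintro x ⟨hx, hx1⟩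
    by_contra hn
    have hfr : x ∈ frontier Ω := by rw [ho.frontier_eq]; exact ⟨hx, hn⟩
    have := hbc x hfr
    simp only [Set.mem_preimage, Set.mem_Ici] at hx1
    linarith
  have hf0 : ∀ x ∉ K, f x = 0 := by
    intro x hx
    simp only [hf]
    split_ifs with h
    · apply eta_zero
      by_contra hn
      push Not at hn
      exact hx ⟨subset_closure h, by simp; linarith⟩
    · rfl
  have hfs : HasCompactSupport f := HasCompactSupport.intro hKk hf0
  have hev : ∀ x ∈ Ω, f =ᶠ[𝓝 x] fun y => eta (v y + (-1)) := by
    intro x hx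
    filter_upwards [ho.mem_nhds hx] with y hy
    simp only [hf, if_pos hy]; ring_nf
  have hev0 : ∀ x ∉ Ω, f =ᶠ[𝓝 x] fun _ => 0 := by
    intro x hx
    filter_upwards [hKc.isOpen_compl.mem_nhds (fun h => hx (hKΩ h))] with y hy
    exact hf0 y hy
  have hva : ∀ x ∈ Ω, ContDiffAt ℝ 2 v x := fun x hx => hv.contDiffAt (ho.mem_nhds hx)
  have hfd : ContDiff ℝ 2 f := by
    rw [contDiff_iff_contDiffAt]
    intro x
    by_cases hx : x ∈ Ω
    · refine ContDiffAt.congr_of_eventuallyEq ?_ (hev x hx)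
      exact eta_contDiff.contDiffAt.comp x ((hva x hx).add contDiffAt_const)
    · exact contDiffAt_const.congr_of_eventuallyEq (hev0 x hx)
  set τ : E2 → ℝ := fun x => D ^ 2 / 4 + (-(1 / 4)) * ‖x - 0‖ ^ 2 with hτ
  have hτd : ContDiff ℝ 2 τ := contDiff_const.add (contDiff_const.mul (contDiff_sq 0))
  have hlτ : ∀ x, lap τ x = -1 := by
    intro x
    rw [hτ, lap_add contDiffAt_const (contDiff_const.mul (contDiff_sq 0)).contDiffAt, lap_const,
      lap_const_mul _ (contDiff_sq 0).contDiffAt, lap_sq]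
    norm_num
  have hibp := ibp_lap hτd hfd hfs
  simp only [hlτ] at hibp
  have hfi : Integrable f := hfd.continuous.integrable_of_hasCompactSupport hfs
  have hli : Integrable (fun x => τ x * lap f x) :=
    (hτd.continuous.mul (lap_continuous hfd)).integrable_of_hasCompactSupport (lap_compact hfs).mul_left
  have h1 : ∫ x, f x = ∫ x, -(τ x * lap f x) := by
    rw [integral_neg, hibp, ← integral_neg]
    congr 1; funext x; ring
  have h2 : ∫ x, -(τ x * lap f x) ≤ ∫ x, Ω.indicator (fun x => D ^ 2 / 4 * ρ x) x := by
    refine integral_mono hli.neg ((integrable_indicator_iff ho.measurableSet).2 (hρi.const_mul _)) fun x => ?_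
    by_cases hx : x ∈ Ω
    · rw [Set.indicator_of_mem hx]
      have e1 : lap f x = _ := (lap_congr (hev x hx)).trans
        (lap_comp (f := fun y => v y + (-1)) ((hva x hx).add contDiffAt_const) eta_contDiff.contDiffAt)
      rw [lap_add (hva x hx) contDiffAt_const, lap_const, eta_deriv', add_zero] at e1
      have s0 := Real.smoothTransition.nonneg (v x + -1)
      have s1 := Real.smoothTransition.le_one (v x + -1)
      have s2 : 0 ≤ deriv Real.smoothTransition (v x + -1) := Real.smoothTransition.monotone.deriv_nonneg
      have s3 : 0 ≤ ∑ i, pd i (fun y => v y + (-1)) x ^ 2 := Finset.sum_nonneg fun i _ => sq_nonneg _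
      have hr := hρ x hx
      have hr0 := hρ0 x hx
      have e2 : -lap f x ≤ ρ x := by
        rw [e1]
        have : lap v x = -ρ x := by linarith
        rw [this]
        nlinarith [mul_nonneg s2 s3]
      have hτ0 : 0 ≤ τ x := by
        simp only [hτ, sub_zero]
        have := hD x hx
        nlinarith [norm_nonneg x]
      have hτ1 : τ x ≤ D ^ 2 / 4 := by
        simp only [hτ]; nlinarith [sq_nonneg ‖x - 0‖]
      calc -(τ x * lap f x) = τ x * (-lap f x) := by ring
        _ ≤ τ x * ρ x := by gcongr
        _ ≤ _ := by gcongr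
    · rw [Set.indicator_of_notMem hx, lap_congr (hev0 x hx), lap_const]; simp
  rw [integral_indicator ho.measurableSet, integral_const_mul] at h2
  have hvol : volume Ω < ⊤ := hb.measure_lt_top
  have hvi : IntegrableOn v Ω := (hc.integrableOn_compact hb.isCompact_closure).mono_set subset_closure
  have h3 : ∫ x in Ω, v x ≤ ∫ x in Ω, (f x + 2) := by
    refine setIntegral_mono_on hvi (hfi.integrableOn.add (integrableOn_const hvol.ne)) ho.measurableSet fun x hx => ?_
    simp only [hf, if_pos hx]
    linarith [eta_ge (v x - 1)]
  rw [integral_add hfi.integrableOn (integrableOn_const hvol.ne)] at h3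
  have h4 : ∫ x in Ω, f x = ∫ x, f x := by
    refine setIntegral_eq_integral_of_forall_compl_eq_zero fun x hx => ?_
    simp only [hf, if_neg hx]
  simp only [integral_const, Measure.restrict_apply_univ, smul_eq_mul, Measure.real] at h3
  linarith

end

noncomputable section


/-- the cut-off function -/
def chi (p : E2) (R : ℝ) (hR : 0 < R) : ContDiffBump p := ⟨5 * R / 4, 7 * R / 4, by positivity, by linarith⟩

/-- the cut-off error kernel -/
def Hk (χ : E2 → ℝ) (ε : ℝ) (x y : E2) : ℝ :=
  lap χ y * Real.log (‖y - x‖ ^ 2 + ε) + 2 * ∑ i, pd i χ y * (2 * (y - x) i / (‖y - x‖ ^ 2 + ε))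

theorem lap_logeps {ε : ℝ} (hε : 0 < ε) (x y : E2) :
    lap (fun z => Real.log (‖z - x‖ ^ 2 + ε)) y = 4 * ε / (‖y - x‖ ^ 2 + ε) ^ 2 := by
  set s := ‖y - x‖ ^ 2 with hs
  have hs0 : 0 < s + ε := by positivity
  have hd : ∀ t : ℝ, t + ε ≠ 0 → HasDerivAt (fun t => Real.log (t + ε)) ((t + ε)⁻¹) t := by
    intro t ht
    simpa using ((hasDerivAt_id t).add_const ε).log ht
  have hη : ContDiffAt ℝ 2 (fun t => Real.log (t + ε)) s :=
    (contDiffAt_id.add contDiffAt_const).log hs0.ne'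
  rw [lap_comp (f := fun z => ‖z - x‖ ^ 2) (η := fun t => Real.log (t + ε)) (contDiff_sq x).contDiffAt hη,
    sum_pd_sq, lap_sq]
  simp only [← hs]
  have hev : deriv (fun t => Real.log (t + ε)) =ᶠ[𝓝 s] fun t => (t + ε)⁻¹ := by
    have : ∀ᶠ t in 𝓝 s, 0 < t + ε :=
      (continuous_id.add continuous_const).continuousAt.eventually (lt_mem_nhds hs0)
    filter_upwards [this] with t ht using (hd t ht.ne').deriv
  have h2 : HasDerivAt (fun t => (t + ε)⁻¹) (-1 / (s + ε) ^ 2) s :=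
    ((hasDerivAt_id s).add_const ε).fun_inv hs0.ne'
  rw [hev.deriv_eq, h2.deriv, (hd s hs0.ne').deriv]
  field_simp
  ring

theorem pd_logeps {ε : ℝ} (hε : 0 < ε) (i : Fin 2) (x y : E2) :
    pd i (fun z => Real.log (‖z - x‖ ^ 2 + ε)) y = 2 * (y - x) i / (‖y - x‖ ^ 2 + ε) := by
  have hs0 : 0 < ‖y - x‖ ^ 2 + ε := by positivity
  have hd : HasDerivAt (fun t => Real.log (t + ε)) ((‖y - x‖ ^ 2 + ε)⁻¹) (‖y - x‖ ^ 2) := by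
    simpa using ((hasDerivAt_id (‖y - x‖ ^ 2)).add_const ε).log hs0.ne'
  rw [pd_comp (f := fun z => ‖z - x‖ ^ 2) (η := fun t => Real.log (t + ε)) i
    ((contDiff_sq x (n := 1)).differentiable (by simp) y) hd.differentiableAt, pd_sq, hd.deriv]
  field_simp

theorem contDiff_logeps {ε : ℝ} (hε : 0 < ε) (x : E2) {n} : ContDiff ℝ n (fun z => Real.log (‖z - x‖ ^ 2 + ε)) := by
  refine ContDiff.log ((contDiff_sq x).add contDiff_const) fun y => ?_
  positivity

theorem repr_eps {p : E2} {R : ℝ} (hR : 0 < R) {Ω : Set E2} (ho : IsOpen Ω) (hΩ : closedBall p (2 * R) ⊆ Ω)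
    {f g : E2 → ℝ} (hf : ContDiffOn ℝ 2 f Ω) (hg : ∀ x ∈ Ω, -lap f x = g x) {ε : ℝ} (hε : 0 < ε) (x : E2) :
    (∫ y, (chi p R hR y * f y) * (4 * ε / (‖y - x‖ ^ 2 + ε) ^ 2)) + (∫ y, f y * Hk (chi p R hR) ε x y) =
      -∫ y, chi p R hR y * g y * Real.log (‖y - x‖ ^ 2 + ε) := by
  set χ := chi p R hR with hχ
  let χ2 : ContDiffBump p := ⟨15 * R / 8, 2 * R, by positivity, by linarith⟩
  set F : E2 → ℝ := fun y => χ2 y * f y with hF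
  have hχd : ContDiff ℝ 2 χ := χ.contDiff
  have hχ2d : ContDiff ℝ 2 χ2 := χ2.contDiff
  have hFd : ContDiff ℝ 2 F := by
    rw [contDiff_iff_contDiffAt]
    intro y
    by_cases hy : y ∈ Ω
    · exact hχ2d.contDiffAt.mul (hf.contDiffAt (ho.mem_nhds hy))
    · have : y ∉ tsupport χ2 := by
        rw [χ2.tsupport_eq]; exact fun h => hy (hΩ h)
      have h0 : F =ᶠ[𝓝 y] fun _ => 0 := by
        filter_upwards [notMem_tsupport_iff_eventuallyEq.1 this] with z hz
        simp [hF, hz]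
      exact contDiffAt_const.congr_of_eventuallyEq h0
  set L : E2 → ℝ := fun z => Real.log (‖z - x‖ ^ 2 + ε) with hL
  have hLd : ContDiff ℝ 2 L := contDiff_logeps hε x
  have hud : ContDiff ℝ 2 (fun y => χ y * L y) := hχd.mul hLd
  have hus : HasCompactSupport (fun y => χ y * L y) := χ.hasCompactSupport.mul_right
  have key := ibp_lap hFd hud hus
  have hball : ∀ y, y ∈ ball p (15 * R / 8) → F =ᶠ[𝓝 y] f := by
    intro y hy
    filter_upwards [isOpen_ball.mem_nhds hy] with z hz
    simp [hF, χ2.one_of_mem_closedBall (ball_subset_closedBall hz)]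
  have hout : ∀ y, y ∉ ball p (15 * R / 8) → (χ : E2 → ℝ) =ᶠ[𝓝 y] fun _ => 0 := by
    intro y hy
    apply notMem_tsupport_iff_eventuallyEq.1
    rw [χ.tsupport_eq]
    intro h
    apply hy
    have h2 : dist y p ≤ 7 * R / 4 := h
    rw [mem_ball]; linarith
  have hI1 : Integrable (fun y => (χ y * f y) * (4 * ε / (‖y - x‖ ^ 2 + ε) ^ 2)) := by
    have h1 : (fun y => (χ y * f y) * (4 * ε / (‖y - x‖ ^ 2 + ε) ^ 2)) =
        fun y => χ y * (F y * (4 * ε / (‖y - x‖ ^ 2 + ε) ^ 2)) := by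
      funext y
      by_cases hy : y ∈ ball p (15 * R / 8)
      · rw [(hball y hy).self_of_nhds]; ring
      · simp [(hout y hy).self_of_nhds]
    rw [h1]
    refine Continuous.integrable_of_hasCompactSupport ?_ χ.hasCompactSupport.mul_right
    refine χ.continuous.mul (hFd.continuous.mul (Continuous.div (by fun_prop) (by fun_prop) fun y => ?_))
    positivity
  have hI2 : Integrable (fun y => F y * lap (fun y => χ y * L y) y) :=
    (hFd.continuous.mul (lap_continuous hud)).integrable_of_hasCompactSupport (lap_compact hus).mul_left
  have hpt : ∀ y, F y * lap (fun y => χ y * L y) y =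
      (χ y * f y) * (4 * ε / (‖y - x‖ ^ 2 + ε) ^ 2) + f y * Hk χ ε x y := by
    intro y
    by_cases hy : y ∈ ball p (15 * R / 8)
    · rw [(hball y hy).self_of_nhds, lap_mul hχd.contDiffAt hLd.contDiffAt, hL, lap_logeps hε]
      simp only [pd_logeps hε, Hk]
      ring
    · have h1 : (fun y => χ y * L y) =ᶠ[𝓝 y] fun _ => 0 := by
        filter_upwards [hout y hy] with z hz
        simp [hz]
      rw [lap_congr h1, lap_const, (hout y hy).self_of_nhds]
      unfold Hk
      rw [lap_congr (hout y hy), lap_const]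
      simp only [pd_congr _ (hout y hy)]
      simp [pd]
  have hI3 : Integrable (fun y => f y * Hk χ ε x y) := by
    refine (hI2.sub hI1).congr (Eventually.of_forall fun y => ?_)
    simp only [Pi.sub_apply, hpt y]; ring
  rw [← integral_add hI1 hI3, ← integral_neg]
  simp only [← hpt]
  rw [key]
  congr 1
  funext y
  by_cases hy : y ∈ ball p (15 * R / 8)
  · have hyΩ : y ∈ Ω := hΩ (by rw [mem_closedBall]; rw [mem_ball] at hy; linarith)
    rw [lap_congr (hball y hy), ← hg y hyΩ]; ring
  · simp [(hout y hy).self_of_nhds]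

set_option maxHeartbeats 1000000 in
theorem Hk_bound (p : E2) {R : ℝ} (hR : 0 < R) : ∃ C : ℝ, 0 ≤ C ∧
    (∀ ε x y, y ∉ ball p (2 * R) → Hk (chi p R hR) ε x y = 0) ∧
    ∀ ε, 0 < ε → ε ≤ 1 → ∀ x ∈ ball p (9 * R / 8), ∀ y, |Hk (chi p R hR) ε x y| ≤ C ∧
      ∀ x' ∈ ball p (9 * R / 8), |Hk (chi p R hR) ε x y - Hk (chi p R hR) ε x' y| ≤ C * ‖x - x'‖ := by
  set χ := chi p R hR with hχ
  have hχd : ContDiff ℝ 2 χ := χ.contDiff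
  obtain ⟨B0, hB0⟩ := (lap_compact χ.hasCompactSupport).exists_bound_of_continuous (lap_continuous hχd)
  have hpc : ∀ i, ∃ B, ∀ y, ‖pd i χ y‖ ≤ B := fun i =>
    HasCompactSupport.exists_bound_of_continuous
      (χ.hasCompactSupport.fderiv_apply (𝕜 := ℝ) (EuclideanSpace.single i 1)) (pd_contDiff (n := 1) i hχd).continuous
  choose B1 hB1 using hpc
  have hB00 : 0 ≤ B0 := (norm_nonneg _).trans (hB0 0)
  have hB10 : ∀ i, 0 ≤ B1 i := fun i => (norm_nonneg _).trans (hB1 i 0)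
  set d := R / 8 with hd
  have hd0 : 0 < d := by positivity
  set T := |Real.log (d ^ 2)| + |Real.log ((3 * R) ^ 2 + 1)| with hT
  set C1 := B0 * T + 2 * ∑ i, B1 i * (6 * R / d ^ 2) with hC1
  set C2 := B0 * (6 * R / d ^ 2) + 2 * ∑ i, B1 i * (2 / d ^ 2 + 36 * R ^ 2 / d ^ 4) with hC2
  have hC10 : 0 ≤ C1 := by
    have : 0 ≤ ∑ i, B1 i * (6 * R / d ^ 2) := Finset.sum_nonneg fun i _ => mul_nonneg (hB10 i) (by positivity)
    positivity
  have hC20 : 0 ≤ C2 := by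
    have : 0 ≤ ∑ i, B1 i * (2 / d ^ 2 + 36 * R ^ 2 / d ^ 4) := Finset.sum_nonneg fun i _ => mul_nonneg (hB10 i) (by positivity)
    positivity
  have hz : ∀ (c : ℝ) y, (χ : E2 → ℝ) =ᶠ[𝓝 y] (fun _ => c) → ∀ ε x, Hk χ ε x y = 0 := by
    intro c y h ε x
    unfold Hk
    rw [lap_congr h, lap_const]
    simp only [pd_congr _ h]
    simp [pd]
  have hzo : ∀ y, 7 * R / 4 < dist y p → ∀ ε x, Hk χ ε x y = 0 := by
    intro y hy
    apply hz 0
    apply notMem_tsupport_iff_eventuallyEq.1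
    rw [χ.tsupport_eq]
    intro h
    have h2 : dist y p ≤ 7 * R / 4 := h
    linarith
  refine ⟨C1 + C2, by positivity, ?_, ?_⟩
  · intro ε x y hy
    apply hzo
    rw [mem_ball] at hy
    linarith
  intro ε hε hε1 x hx y
  by_cases h1 : 7 * R / 4 < dist y p
  · simp only [hzo y h1]
    exact ⟨by simp; positivity, fun x' _ => by simp; positivity⟩
  by_cases h2 : dist y p < 5 * R / 4
  · have : ∀ ε x, Hk χ ε x y = 0 := by
      apply hz 1
      have : ball p (5 * R / 4) ∈ 𝓝 y := isOpen_ball.mem_nhds h2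
      filter_upwards [this] with z hz
      exact χ.one_of_mem_closedBall (ball_subset_closedBall hz)
    simp only [this]
    exact ⟨by simp; positivity, fun x' _ => by simp; positivity⟩
  push Not at h1 h2
  have hdist : ∀ x ∈ ball p (9 * R / 8), d ≤ ‖y - x‖ ∧ ‖y - x‖ ≤ 3 * R := by
    intro x hx
    rw [mem_ball] at hx
    rw [← dist_eq_norm]
    have t1 := dist_triangle y x p
    have t2 := dist_triangle y p x
    rw [dist_comm p x] at t2
    constructor <;> linarith
  have hco : ∀ z : E2, ∀ i, |z i| ≤ ‖z‖ := fun z i => by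
    have := EuclideanSpace.norm_eq z
    simpa using PiLp.norm_apply_le z i
  have hB : ∀ x ∈ ball p (9 * R / 8), |Hk χ ε x y| ≤ C1 := by
    intro x hx
    obtain ⟨a1, a2⟩ := hdist x hx
    have a3 : d ^ 2 ≤ ‖y - x‖ ^ 2 + ε := by nlinarith
    have a4 : ‖y - x‖ ^ 2 + ε ≤ (3 * R) ^ 2 + 1 := by nlinarith [norm_nonneg (y - x)]
    have hd2 : 0 < d ^ 2 := by positivity
    have l1 := Real.log_le_log hd2 a3
    have l2 := Real.log_le_log (hd2.trans_le a3) a4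
    have l3 : |Real.log (‖y - x‖ ^ 2 + ε)| ≤ T := by
      rw [abs_le]
      constructor
      · linarith [neg_abs_le (Real.log (d ^ 2)), abs_nonneg (Real.log ((3 * R) ^ 2 + 1))]
      · linarith [le_abs_self (Real.log ((3 * R) ^ 2 + 1)), abs_nonneg (Real.log (d ^ 2))]
    unfold Hk
    refine (abs_add_le _ _).trans ?_
    rw [hC1, abs_mul, abs_mul, abs_two]
    gcongr
    · exact hB0 y
    · refine (Finset.abs_sum_le_sum_abs _ _).trans (Finset.sum_le_sum fun i _ => ?_)
      rw [abs_mul, abs_div, abs_mul, abs_two, abs_of_pos (hd2.trans_le a3)]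
      have := hco (y - x) i
      have h6 : 2 * |(y - x) i| ≤ 6 * R := by linarith
      have := hB10 i
      gcongr
      exact hB1 i y
  refine ⟨(hB x hx).trans (by linarith), fun x' hx' => ?_⟩
  obtain ⟨a1, a2⟩ := hdist x hx
  obtain ⟨b1, b2⟩ := hdist x' hx'
  set a := ‖y - x‖ ^ 2 + ε with ha
  set b := ‖y - x'‖ ^ 2 + ε with hb
  have hd2 : 0 < d ^ 2 := by positivity
  have a3 : d ^ 2 ≤ a := by nlinarith
  have b3 : d ^ 2 ≤ b := by nlinarith
  have a0 := hd2.trans_le a3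
  have b0 := hd2.trans_le b3
  set N := ‖x - x'‖ with hN
  have hab : |a - b| ≤ 6 * R * N := by
    have e1 : a - b = (‖y - x‖ - ‖y - x'‖) * (‖y - x‖ + ‖y - x'‖) := by rw [ha, hb]; ring
    have e2 : |‖y - x‖ - ‖y - x'‖| ≤ N := by
      have := abs_norm_sub_norm_le (y - x) (y - x')
      rwa [show y - x - (y - x') = -(x - x') by abel, norm_neg] at this
    rw [e1, abs_mul, abs_of_nonneg (show 0 ≤ ‖y - x‖ + ‖y - x'‖ by positivity)]
    have := abs_nonneg (‖y - x‖ - ‖y - x'‖)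
    nlinarith [norm_nonneg (x - x')]
  have hlog : |Real.log a - Real.log b| ≤ 6 * R / d ^ 2 * N := by
    have key : ∀ a b : ℝ, 0 < a → d ^ 2 ≤ b → Real.log a - Real.log b ≤ |a - b| / d ^ 2 := by
      intro a b ha hb
      have hb0 := hd2.trans_le hb
      have := Real.log_le_sub_one_of_pos (div_pos ha hb0)
      rw [Real.log_div ha.ne' hb0.ne'] at this
      calc _ ≤ a / b - 1 := this
        _ = (a - b) / b := by field_simp
        _ ≤ |a - b| / b := by gcongr; exact le_abs_self _
        _ ≤ _ := by gcongr
    have k1 := key a b a0 b3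
    have k2 := key b a b0 a3
    rw [abs_sub_comm b a] at k2
    have : |a - b| / d ^ 2 ≤ 6 * R / d ^ 2 * N := by
      rw [div_mul_eq_mul_div]; gcongr
    rw [abs_le]
    constructor <;> linarith
  have hfr : ∀ i, |2 * (y - x) i / a - 2 * (y - x') i / b| ≤ (2 / d ^ 2 + 36 * R ^ 2 / d ^ 4) * N := by
    intro i
    have e : 2 * (y - x) i / a - 2 * (y - x') i / b = 2 * (x' - x) i / a + 2 * (y - x') i * (b - a) / (a * b) := by
      simp only [PiLp.sub_apply]
      field_simp
      ring
    rw [e]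
    have c1 := hco (x' - x) i
    have c2 := hco (y - x') i
    rw [norm_sub_rev] at c1
    have k1 : |2 * (x' - x) i / a| ≤ 2 / d ^ 2 * N := by
      rw [abs_div, abs_mul, abs_two, abs_of_pos a0, div_mul_eq_mul_div]
      gcongr
    have k2 : |2 * (y - x') i * (b - a) / (a * b)| ≤ 36 * R ^ 2 / d ^ 4 * N := by
      rw [abs_div, abs_mul, abs_mul, abs_two, abs_of_pos (mul_pos a0 b0), div_mul_eq_mul_div, abs_sub_comm b a]
      have hden : d ^ 4 ≤ a * b := by nlinarith
      have hnum : 2 * |(y - x') i| * |a - b| ≤ 36 * R ^ 2 * N := by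
        calc 2 * |(y - x') i| * |a - b| ≤ 2 * (3 * R) * (6 * R * N) := by
              gcongr
              exact c2.trans b2
          _ = _ := by ring
      gcongr
    have k3 := abs_add_le (2 * (x' - x) i / a) (2 * (y - x') i * (b - a) / (a * b))
    have k4 := add_mul (2 / d ^ 2) (36 * R ^ 2 / d ^ 4) N
    linarith
  have e3 : Hk χ ε x y - Hk χ ε x' y = lap χ y * (Real.log a - Real.log b) +
      2 * ∑ i, pd i χ y * (2 * (y - x) i / a - 2 * (y - x') i / b) := by
    unfold Hk
    simp only [mul_sub, Finset.sum_sub_distrib]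
    ring
  have e4 : |Hk χ ε x y - Hk χ ε x' y| ≤ C2 * N := by
    rw [e3]
    refine (abs_add_le _ _).trans ?_
    rw [abs_mul, abs_mul, abs_two, hC2, add_mul]
    have f1 : |lap χ y| * |Real.log a - Real.log b| ≤ B0 * (6 * R / d ^ 2) * N := by
      rw [mul_assoc]
      exact mul_le_mul (hB0 y) hlog (abs_nonneg _) hB00
    have f2 : |∑ i, pd i χ y * (2 * (y - x) i / a - 2 * (y - x') i / b)| ≤
        (∑ i, B1 i * (2 / d ^ 2 + 36 * R ^ 2 / d ^ 4)) * N := by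
      refine (Finset.abs_sum_le_sum_abs _ _).trans ?_
      rw [Finset.sum_mul]
      refine Finset.sum_le_sum fun i _ => ?_
      rw [abs_mul, mul_assoc]
      exact mul_le_mul (hB1 i y) (hfr i) (abs_nonneg _) (hB10 i)
    linarith
  have : 0 ≤ N := norm_nonneg _
  nlinarith

end

noncomputable section


theorem approx_id {h : E2 → ℝ} (hi : Integrable h) {x : E2} (hc : ContinuousAt h x) :
    Tendsto (fun c : ℝ => ∫ y, h y * (4 * (c ^ 2)⁻¹ / (‖y - x‖ ^ 2 + (c ^ 2)⁻¹) ^ 2)) atTop (𝓝 (4 * π * h x)) := by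
  have hpi := Real.pi_pos
  set ψ : E2 → ℝ := fun z => 1 / π * ((1 + 1 * ‖z‖ ^ 2) ^ 2)⁻¹ with hψ
  have h1 : ∫ z, ψ z = 1 := by
    simp only [hψ]
    rw [integral_const_mul, radial_E2 (fun r => ((1 + 1 * r ^ 2) ^ 2)⁻¹), int_sq one_pos]
    field_simp
  have h2 : Tendsto (fun z : E2 => ‖z‖ ^ Module.finrank ℝ E2 * ψ z) (cobounded E2) (𝓝 0) := by
    rw [hdE]
    have h3 : Tendsto (fun z : E2 => 1 / π * (1 + 1 * ‖z‖ ^ 2)⁻¹) (cobounded E2) (𝓝 0) := by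
      have := ((tendsto_one_add_sq one_pos).comp (tendsto_norm_cobounded_atTop (E := E2))).inv_tendsto_atTop.const_mul (1 / π)
      simpa using this
    refine squeeze_zero (fun z => by simp only [hψ]; positivity) (fun z => ?_) h3
    simp only [hψ]
    have : ‖z‖ ^ 2 * (1 / π * ((1 + 1 * ‖z‖ ^ 2) ^ 2)⁻¹) = 1 / π * (‖z‖ ^ 2 / (1 + 1 * ‖z‖ ^ 2) ^ 2) := by ring
    rw [this, inv_eq_one_div]
    refine mul_le_mul_of_nonneg_left ?_ (by positivity)
    rw [div_le_div_iff₀ (by positivity) (by positivity)]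
    nlinarith [sq_nonneg ‖z‖]
  have h3 := (tendsto_integral_comp_smul_smul_of_integrable' (μ := (volume : Measure E2)) (φ := ψ)
    (fun z => by simp only [hψ]; positivity) h1 h2 hi hc).const_mul (4 * π)
  refine h3.congr' ?_
  filter_upwards [eventually_gt_atTop 0] with c hc0
  rw [← integral_const_mul]
  congr 1
  funext y
  simp only [hψ, smul_eq_mul, norm_smul, hdE, Real.norm_eq_abs, abs_of_pos hc0]
  rw [norm_sub_rev x y]
  have : 0 < 1 + c ^ 2 * ‖y - x‖ ^ 2 := by positivity
  have : 0 < ‖y - x‖ ^ 2 + (c ^ 2)⁻¹ := by positivity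
  field_simp
  ring

theorem log_int {χg : E2 → ℝ} (hi : Integrable χg) {B : ℝ} (hB : ∀ y, |χg y| ≤ B) {T : ℝ} {x : E2} (hT : ∀ y, T ≤ ‖y - x‖ → χg y = 0) :
    Integrable (fun y => |χg y| * |Real.log ‖y - x‖|) := by
  have h1 := (pot_bound hdE zero_le_one one_lt_two (fun y => abs_nonneg (χg y)) hi.abs x (fun y _ => hB y)).1
  have h2 : Integrable (fun y => ‖x - y‖ ^ (-1 : ℝ) * |χg y| + |T| * |χg y|) := h1.add (hi.abs.const_mul _)
  refine h2.mono' ?_ (Eventually.of_forall fun y => ?_)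
  · have m1 : AEStronglyMeasurable (fun y => |χg y|) := hi.abs.1
    have m2 : Measurable (fun y : E2 => |Real.log ‖y - x‖|) :=
      (Real.measurable_log.comp (by fun_prop)).abs
    exact m1.mul m2.aestronglyMeasurable
  · rw [Real.norm_eq_abs, abs_mul, abs_abs, abs_abs, ← add_mul, mul_comm]
    by_cases hy : T ≤ ‖y - x‖
    · simp [hT y hy]
    push Not at hy
    gcongr
    rw [norm_sub_rev x y, Real.rpow_neg_one]
    rcases (norm_nonneg (y - x)).eq_or_lt' with h0 | h0
    · rw [h0]; simp
    set s := ‖y - x‖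
    have l1 := Real.log_le_sub_one_of_pos h0
    have l2 := Real.log_le_sub_one_of_pos (inv_pos.2 h0)
    rw [Real.log_inv] at l2
    have : 0 < s⁻¹ := inv_pos.2 h0
    have := le_abs_self T
    rw [abs_le]
    constructor <;> linarith

theorem log_lim {χg : E2 → ℝ} (hi : Integrable χg) {B : ℝ} (hB : ∀ y, |χg y| ≤ B) {T : ℝ} {x : E2} (hT : ∀ y, T ≤ ‖y - x‖ → χg y = 0) :
    Tendsto (fun c : ℝ => ∫ y, χg y * Real.log (‖y - x‖ ^ 2 + (c ^ 2)⁻¹)) atTop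
      (𝓝 (∫ y, χg y * (2 * Real.log ‖y - x‖))) := by
  refine tendsto_integral_filter_of_dominated_convergence
    (fun y => 2 * (|χg y| * |Real.log ‖y - x‖|) + Real.log (T ^ 2 + 1) * |χg y|) ?_ ?_ ?_ ?_
  · refine Eventually.of_forall fun c => ?_
    have m2 : Measurable (fun y : E2 => Real.log (‖y - x‖ ^ 2 + (c ^ 2)⁻¹)) :=
      Real.measurable_log.comp (by fun_prop)
    exact hi.1.mul m2.aestronglyMeasurable
  · filter_upwards [eventually_ge_atTop 1] with c hc
    have hne : ∀ᵐ y : E2, y ≠ x := by simp [ae_iff, measure_singleton]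
    filter_upwards [hne] with y hy
    rw [Real.norm_eq_abs, abs_mul]
    by_cases hyT : T ≤ ‖y - x‖
    · simp [hT y hyT]
    push Not at hyT
    have h0 : 0 < ‖y - x‖ := norm_pos_iff.2 (sub_ne_zero.2 hy)
    have hc1 : (c ^ 2)⁻¹ ≤ 1 := inv_le_one_of_one_le₀ (by nlinarith)
    have hc0 : 0 < (c ^ 2)⁻¹ := by positivity
    have l1 : Real.log (‖y - x‖ ^ 2) ≤ Real.log (‖y - x‖ ^ 2 + (c ^ 2)⁻¹) :=
      Real.log_le_log (by positivity) (by linarith)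
    have l2 : Real.log (‖y - x‖ ^ 2 + (c ^ 2)⁻¹) ≤ Real.log (T ^ 2 + 1) :=
      Real.log_le_log (by positivity) (by nlinarith)
    rw [Real.log_pow] at l1
    push_cast at l1
    have l4 : 0 ≤ Real.log (T ^ 2 + 1) := Real.log_nonneg (by nlinarith [sq_nonneg T])
    have l3 : |Real.log (‖y - x‖ ^ 2 + (c ^ 2)⁻¹)| ≤ 2 * |Real.log ‖y - x‖| + Real.log (T ^ 2 + 1) := by
      rw [abs_le]
      constructor
      · linarith [neg_abs_le (Real.log ‖y - x‖)]
      · linarith [abs_nonneg (Real.log ‖y - x‖)]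
    have := abs_nonneg (χg y)
    nlinarith
  · exact ((log_int hi hB hT).const_mul 2).add (hi.abs.const_mul _)
  · have hne : ∀ᵐ y : E2, y ≠ x := by simp [ae_iff, measure_singleton]
    filter_upwards [hne] with y hy
    have h0 : 0 < ‖y - x‖ := norm_pos_iff.2 (sub_ne_zero.2 hy)
    refine Tendsto.const_mul _ ?_
    have h1 : Tendsto (fun c : ℝ => ‖y - x‖ ^ 2 + (c ^ 2)⁻¹) atTop (𝓝 (‖y - x‖ ^ 2)) := by
      have : Tendsto (fun c : ℝ => (c ^ 2)⁻¹) atTop (𝓝 0) := (tendsto_pow_atTop (by norm_num)).inv_tendsto_atTop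
      simpa using this.const_add (‖y - x‖ ^ 2)
    have h2 := ((Real.continuousAt_log (by positivity : ‖y - x‖ ^ 2 ≠ 0)).tendsto).comp h1
    rw [Real.log_pow] at h2
    exact_mod_cast h2

/-- local representation formula -/
theorem repr_local (p : E2) {R : ℝ} (hR : 0 < R) : ∃ C : ℝ, 0 ≤ C ∧ ∀ {Ω : Set E2}, IsOpen Ω →
    closedBall p (2 * R) ⊆ Ω → ∀ {f g : E2 → ℝ}, ContDiffOn ℝ 2 f Ω → (∀ x ∈ Ω, -lap f x = g x) →
    ContinuousOn g Ω → ∀ x ∈ ball p (9 * R / 8),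
      Integrable (fun y => Real.log ‖x - y‖ * (chi p R hR y * g y)) ∧
      |f x + 1 / (2 * π) * ∫ y, Real.log ‖x - y‖ * (chi p R hR y * g y)| ≤ C * ∫ y in ball p (2 * R), |f y| ∧
      ∀ x' ∈ ball p (9 * R / 8),
      |f x - f x' + 1 / (2 * π) * ∫ y, (Real.log ‖x - y‖ - Real.log ‖x' - y‖) * (chi p R hR y * g y)| ≤
        C * ‖x - x'‖ * ∫ y in ball p (2 * R), |f y| := by
  obtain ⟨C, hC0, hHz, hHb⟩ := Hk_bound p hR
  refine ⟨C, hC0, ?_⟩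
  intro Ω ho hΩ f g hf hg hgc x hx
  have hpi := Real.pi_pos
  set χ := chi p R hR with hχ
  set G : E2 → ℝ := fun y => χ y * g y with hG
  have hχz : ∀ y, y ∉ closedBall p (7 * R / 4) → (χ : E2 → ℝ) =ᶠ[𝓝 y] fun _ => 0 := by
    intro y hy
    apply notMem_tsupport_iff_eventuallyEq.1
    rw [χ.tsupport_eq]
    exact hy
  have hext : ∀ {h : E2 → ℝ}, ContinuousOn h Ω → Continuous (fun y => χ y * h y) := by
    intro h hh
    rw [continuous_iff_continuousAt]
    intro y
    by_cases hy : y ∈ Ω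
    · exact χ.continuous.continuousAt.mul (hh.continuousAt (ho.mem_nhds hy))
    · have : (fun y => χ y * h y) =ᶠ[𝓝 y] fun _ => 0 := by
        filter_upwards [hχz y (fun h => hy (hΩ (closedBall_subset_closedBall (by linarith) h)))] with z hz
        simp [hz]
      exact continuousAt_const.congr this.symm
  have hGc : Continuous G := hext hgc
  have hGs : HasCompactSupport G := χ.hasCompactSupport.mul_right
  have hGi : Integrable G := hGc.integrable_of_hasCompactSupport hGs
  obtain ⟨B, hB⟩ := hGs.exists_bound_of_continuous hGc
  have hFc : Continuous (fun y => χ y * f y) := hext hf.continuousOn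
  have hFi : Integrable (fun y => χ y * f y) := hFc.integrable_of_hasCompactSupport χ.hasCompactSupport.mul_right
  have hT : ∀ x ∈ ball p (9 * R / 8), ∀ y, 3 * R ≤ ‖y - x‖ → G y = 0 := by
    intro x hx y hy
    have : y ∉ closedBall p (7 * R / 4) := by
      rw [mem_closedBall, not_le]
      rw [mem_ball] at hx
      rw [← dist_eq_norm] at hy
      have := dist_triangle y p x
      rw [dist_comm p x] at this
      linarith
    simp [hG, (hχz y this).self_of_nhds]
  have hfi : IntegrableOn (fun y => |f y|) (ball p (2 * R)) := by
    have : ContinuousOn f (closedBall p (2 * R)) := hf.continuousOn.mono hΩ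
    exact (this.abs.integrableOn_compact (isCompact_closedBall _ _)).mono_set ball_subset_closedBall
  have hli : ∀ x ∈ ball p (9 * R / 8), Integrable (fun y => Real.log ‖x - y‖ * G y) := by
    intro x hx
    have := log_int hGi hB (hT x hx)
    refine this.mono ?_ (Eventually.of_forall fun y => ?_)
    · have m2 : Measurable (fun y : E2 => Real.log ‖x - y‖) := Real.measurable_log.comp (by fun_prop)
      exact m2.aestronglyMeasurable.mul hGi.1
    · have e : ∀ a : ℝ, ‖Real.log ‖x - y‖ * a‖ ≤ ‖|a| * |Real.log ‖y - x‖|‖ := by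
        intro a
        rw [norm_sub_rev x y, Real.norm_eq_abs, Real.norm_eq_abs, abs_mul, abs_mul, abs_abs, abs_abs, mul_comm]
      exact e (G y)
  set ℓ : E2 → ℝ := fun x => 4 * π * f x + 2 * ∫ y, Real.log ‖x - y‖ * G y with hℓ
  have hlim : ∀ x ∈ ball p (9 * R / 8), Tendsto (fun c : ℝ => -∫ y, f y * Hk χ (c ^ 2)⁻¹ x y) atTop (𝓝 (ℓ x)) := by
    intro x hx
    have h1 := approx_id hFi (x := x) hFc.continuousAt
    have h2 := log_lim hGi hB (hT x hx)
    have hx1 : χ x = 1 := by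
      apply χ.one_of_mem_closedBall
      rw [mem_ball] at hx
      have : dist x p ≤ 5 * R / 4 := by linarith
      exact this
    have h3 := h1.add h2
    have e : 4 * π * (χ x * f x) + ∫ y, G y * (2 * Real.log ‖y - x‖) = ℓ x := by
      rw [hx1, one_mul, hℓ]
      simp only
      rw [← integral_const_mul]
      congr 2
      funext y
      rw [norm_sub_rev x y]; ring
    rw [e] at h3
    refine h3.congr' ?_
    filter_upwards [eventually_gt_atTop 0] with c hc
    have := repr_eps hR ho hΩ hf hg (show 0 < (c ^ 2)⁻¹ by positivity) x
    simp only [hG]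
    linarith
  have hsm : ∀ᶠ c : ℝ in atTop, 0 < (c ^ 2)⁻¹ ∧ (c ^ 2)⁻¹ ≤ 1 := by
    filter_upwards [eventually_ge_atTop 1] with c hc
    exact ⟨by positivity, inv_le_one_of_one_le₀ (by nlinarith)⟩
  -- integral bounds
  have hgen : ∀ (h : E2 → ℝ) (A : ℝ), (∀ y, y ∉ ball p (2 * R) → h y = 0) → (∀ y, |h y| ≤ A) →
      |∫ y, f y * h y| ≤ A * ∫ y in ball p (2 * R), |f y| := by
    intro h A h0 hA
    have e : ∫ y, f y * h y = ∫ y in ball p (2 * R), f y * h y :=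
      (setIntegral_eq_integral_of_forall_compl_eq_zero fun y hy => by rw [h0 y hy, mul_zero]).symm
    rw [e, ← Real.norm_eq_abs, ← integral_const_mul]
    refine norm_integral_le_of_norm_le (hfi.const_mul A) (Eventually.of_forall fun y => ?_)
    rw [norm_mul, mul_comm]
    exact mul_le_mul_of_nonneg_right (hA y) (abs_nonneg _)
  have hI0 : 0 ≤ ∫ y in ball p (2 * R), |f y| := integral_nonneg fun y => abs_nonneg _
  have hpi4 : (1 : ℝ) ≤ 4 * π := by linarith [Real.pi_gt_three]
  have hdiv : ∀ a b : ℝ, 0 ≤ b → |a| ≤ b → |1 / (4 * π) * a| ≤ b := by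
    intro a b hb hab
    rw [abs_mul, abs_of_pos (by positivity : 0 < 1 / (4 * π))]
    have : 1 / (4 * π) ≤ 1 := by rw [div_le_one (by positivity)]; exact hpi4
    have : 0 ≤ 1 / (4 * π) := by positivity
    nlinarith [abs_nonneg a]
  refine ⟨hli x hx, ?_, ?_⟩
  · have hb : |ℓ x| ≤ C * ∫ y in ball p (2 * R), |f y| := by
      refine le_of_tendsto (hlim x hx).abs ?_
      filter_upwards [hsm] with c hc
      rw [abs_neg]
      exact hgen _ C (fun y hy => hHz _ _ _ hy) fun y => (hHb _ hc.1 hc.2 x hx y).1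
    have := hdiv _ _ (by positivity) hb
    have e3 : ∀ a I : ℝ, a + 1 / (2 * π) * I = 1 / (4 * π) * (4 * π * a + 2 * I) := by
      intro a I; field_simp; ring
    change |f x + 1 / (2 * π) * ∫ y, Real.log ‖x - y‖ * G y| ≤ _
    rw [e3]
    exact this
  · intro x' hx'
    have hb : |ℓ x - ℓ x'| ≤ C * ‖x - x'‖ * ∫ y in ball p (2 * R), |f y| := by
      refine le_of_tendsto ((hlim x hx).sub (hlim x' hx')).abs ?_
      filter_upwards [hsm] with c hc
      have hintg : ∀ x ∈ ball p (9 * R / 8), Integrable (fun y => f y * Hk χ (c ^ 2)⁻¹ x y) := by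
        intro x hx
        have h0 : ∀ y, y ∉ ball p (2 * R) → f y * Hk χ (c ^ 2)⁻¹ x y = 0 := fun y hy => by rw [hHz _ _ _ hy, mul_zero]
        have : IntegrableOn (fun y => f y * Hk χ (c ^ 2)⁻¹ x y) (ball p (2 * R)) := by
          refine (hfi.const_mul C).mono' ?_ (Eventually.of_forall fun y => ?_)
          · refine ContinuousOn.aestronglyMeasurable ?_ measurableSet_ball
            refine (hf.continuousOn.mono (ball_subset_closedBall.trans hΩ)).mul ?_
            refine Continuous.continuousOn ?_
            unfold Hk
            have hχd : ContDiff ℝ 2 χ := χ.contDiff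
            have q : ∀ y : E2, ‖y - x‖ ^ 2 + (c ^ 2)⁻¹ ≠ 0 := fun y => by have := hc.1; positivity
            refine ((lap_continuous hχd).mul (Continuous.log (by fun_prop) q)).add (continuous_const.mul ?_)
            refine continuous_finsetSum _ fun i _ => (pd_contDiff (n := 1) i hχd).continuous.mul (Continuous.div ?_ (by fun_prop) q)
            fun_prop
          · rw [norm_mul, mul_comm]
            exact mul_le_mul_of_nonneg_right (hHb _ hc.1 hc.2 x hx y).1 (abs_nonneg _)
        exact (integrableOn_iff_integrable_of_support_subset (fun y hy => by
          by_contra hn; exact hy (h0 y hn))).1 this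
      have e : (-∫ y, f y * Hk χ (c ^ 2)⁻¹ x y) - (-∫ y, f y * Hk χ (c ^ 2)⁻¹ x' y) =
          -∫ y, f y * (Hk χ (c ^ 2)⁻¹ x y - Hk χ (c ^ 2)⁻¹ x' y) := by
        rw [show (fun y => f y * (Hk χ (c ^ 2)⁻¹ x y - Hk χ (c ^ 2)⁻¹ x' y)) =
          fun y => f y * Hk χ (c ^ 2)⁻¹ x y - f y * Hk χ (c ^ 2)⁻¹ x' y from funext fun y => by ring]
        rw [integral_sub (hintg x hx) (hintg x' hx')]
        ring
      rw [e, abs_neg]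
      exact hgen _ _ (fun y hy => by rw [hHz _ _ _ hy, hHz _ _ _ hy, sub_zero]) fun y => (hHb _ hc.1 hc.2 x hx y).2 x' hx'
    have := hdiv _ _ (by positivity) hb
    change |f x - f x' + 1 / (2 * π) * ∫ y, (Real.log ‖x - y‖ - Real.log ‖x' - y‖) * G y| ≤ _
    have e2 : ∫ y, (Real.log ‖x - y‖ - Real.log ‖x' - y‖) * G y =
        (∫ y, Real.log ‖x - y‖ * G y) - ∫ y, Real.log ‖x' - y‖ * G y := by
      rw [← integral_sub (hli x hx) (hli x' hx')]
      congr 1; funext y; ring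
    rw [e2]
    have e3 : ∀ a b I J : ℝ, a - b + 1 / (2 * π) * (I - J) = 1 / (4 * π) * ((4 * π * a + 2 * I) - (4 * π * b + 2 * J)) := by
      intro a b I J; field_simp; ring
    rw [e3]
    exact this

end

noncomputable section


namespace Setting

variable {m : ℕ}

/-- the density `λ V e^v` -/
def rho (S : Setting m) (k : ℕ) (x : E2) : ℝ := S.lam k * S.V x * Real.exp (S.v k x)

theorem cpt (S : Setting m) : IsCompact (closure S.Ω) := S.hbd.isCompact_closure

theorem rho_cont (S : Setting m) (k : ℕ) : ContinuousOn (S.rho k) (closure S.Ω) :=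
  (continuousOn_const.mul S.hVreg.continuousOn).mul (S.hv_cont k).rexp

theorem rho_nonneg (S : Setting m) (k : ℕ) {x : E2} (hx : x ∈ closure S.Ω) : 0 ≤ S.rho k x := by
  have := S.hlam_pos k
  have := S.hVpos x hx
  unfold rho; positivity

theorem rho_int (S : Setting m) (k : ℕ) : IntegrableOn (S.rho k) S.Ω :=
  ((S.rho_cont k).integrableOn_compact S.cpt).mono_set subset_closure

theorem rho_mass (S : Setting m) : ∃ M, 0 ≤ M ∧ ∀ k, ∫ x in S.Ω, S.rho k x ≤ M := by
  obtain ⟨M, hM⟩ := S.hmass.bddAbove_range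
  refine ⟨max M 0, le_max_right _ _, fun k => le_trans (hM ⟨k, rfl⟩) (le_max_left _ _)⟩

theorem V_bounds (S : Setting m) : ∃ V0 V1, 0 < V0 ∧ V0 ≤ V1 ∧ ∀ x ∈ closure S.Ω, V0 ≤ S.V x ∧ S.V x ≤ V1 := by
  have hne : (closure S.Ω).Nonempty := S.hconn.nonempty.closure
  obtain ⟨a, ha, hamin⟩ := S.cpt.exists_isMinOn hne S.hVreg.continuousOn
  obtain ⟨b, hb, hbmax⟩ := S.cpt.exists_isMaxOn hne S.hVreg.continuousOn
  exact ⟨S.V a, S.V b, S.hVpos a ha, hamin hb, fun x hx => ⟨hamin hx, hbmax hx⟩⟩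

theorem v_nonneg (S : Setting m) (k : ℕ) : ∀ x ∈ closure S.Ω, 0 ≤ S.v k x := by
  refine max_principle S.hopen S.hbd (S.hv_reg k) (S.hv_cont k) (fun x hx => ?_) fun x hx => (S.hBC k x hx).ge
  have h1 := S.hPDE k x hx
  have h2 := S.rho_nonneg k (subset_closure hx)
  unfold rho at h2
  linarith

theorem mu_pos {S : Setting m} (W : EigenData S) {n : ℕ} (hn : 1 ≤ n) (k : ℕ) : 0 < W.mu n k := by
  rcases hn.eq_or_lt with h | h
  · rw [← h]; exact W.hpos k
  · induction n, (show 2 ≤ n from h) using Nat.le_induction with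
    | base => exact (W.hpos k).trans (W.hlt k)
    | succ n hn2 ih => exact (ih (by omega) (by omega)).trans_le (W.hmono k n hn2)

/-- the normalised eigenfunction -/
def z {S : Setting m} (W : EigenData S) (n k : ℕ) (x : E2) : ℝ := (W.mu n k)⁻¹ * W.w n k x

theorem z_reg {S : Setting m} (W : EigenData S) (n k : ℕ) : ContDiffOn ℝ 2 (z W n k) S.Ω :=
  contDiffOn_const.mul (W.hw_reg n k)

theorem z_cont {S : Setting m} (W : EigenData S) (n k : ℕ) : ContinuousOn (z W n k) (closure S.Ω) :=
  continuousOn_const.mul (W.hw_cont n k)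

theorem z_pde {S : Setting m} (W : EigenData S) {n : ℕ} (hn : 1 ≤ n) (k : ℕ) :
    ∀ x ∈ S.Ω, -lap (z W n k) x = S.rho k x * W.w n k x := by
  intro x hx
  have h := W.hPDE n k x hx
  have hμ := mu_pos W hn k
  unfold z rho
  rw [lap_const_mul _ ((W.hw_reg n k).contDiffAt (S.hopen.mem_nhds hx))]
  have : lap (W.w n k) x = -(W.mu n k * S.lam k * S.V x * Real.exp (S.v k x) * W.w n k x) := by linarith
  rw [this]
  field_simp

theorem z_bound {S : Setting m} (W : EigenData S) {n : ℕ} (hn : 1 ≤ n) (k : ℕ) :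
    ∀ x ∈ closure S.Ω, |z W n k x| ≤ S.v k x := by
  have key : ∀ s : ℝ, |s| = 1 → ∀ x ∈ closure S.Ω, 0 ≤ S.v k x + s * z W n k x := by
    intro s hs
    refine max_principle S.hopen S.hbd ((S.hv_reg k).add (contDiffOn_const.mul (z_reg W n k)))
      ((S.hv_cont k).add (continuousOn_const.mul (z_cont W n k))) (fun x hx => ?_) fun x hx => ?_
    · have hz := (z_reg W n k).contDiffAt (S.hopen.mem_nhds hx)
      have hv := (S.hv_reg k).contDiffAt (S.hopen.mem_nhds hx)
      rw [lap_add hv (contDiffAt_const.mul hz), lap_const_mul _ hz]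
      have h1 := S.hPDE k x hx
      have h2 := z_pde W hn k x hx
      have h3 := S.rho_nonneg k (subset_closure hx)
      have h4 := W.hbound n k x (subset_closure hx)
      have h1' : -lap (S.v k) x = S.rho k x := h1
      have h5 : |s * W.w n k x| ≤ 1 := by rw [abs_mul, hs, one_mul]; exact h4
      have h6 := (abs_le.1 h5).1
      have : lap (S.v k) x + s * lap (z W n k) x = -(S.rho k x * (1 + s * W.w n k x)) := by
        have e1 : lap (S.v k) x = -S.rho k x := by linarith
        have e2 : lap (z W n k) x = -(S.rho k x * W.w n k x) := by linarith
        rw [e1, e2]; ring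
      rw [this]
      have : 0 ≤ S.rho k x * (1 + s * W.w n k x) := mul_nonneg h3 (by linarith)
      linarith
    · rw [S.hBC k x hx]; unfold z; rw [W.hBC n k x hx]; simp
  intro x hx
  rw [abs_le]
  have a := key 1 (by simp) x hx
  have b := key (-1) (by simp) x hx
  constructor <;> linarith

theorem v_l1 (S : Setting m) : ∃ L, 0 ≤ L ∧ ∀ j k, ∫ x in ball (S.xstar j) (2 * S.R), |S.v k x| ≤ L := by
  obtain ⟨D, hD⟩ := S.hbd.exists_norm_le
  obtain ⟨M, hM0, hM⟩ := S.rho_mass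
  refine ⟨D ^ 2 / 4 * M + 2 * (volume S.Ω).toReal, by positivity, fun j k => ?_⟩
  have h := l1_bound S.hopen hD S.hbd (S.hv_reg k) (S.hv_cont k) (S.hBC k) (ρ := S.rho k) (S.hPDE k)
    (fun x hx => S.rho_nonneg k (subset_closure hx)) (S.rho_int k)
  have h2 := hM k
  have hvi : IntegrableOn (fun x => |S.v k x|) S.Ω :=
    ((S.hv_cont k).abs.integrableOn_compact S.cpt).mono_set subset_closure
  calc ∫ x in ball (S.xstar j) (2 * S.R), |S.v k x| ≤ ∫ x in S.Ω, |S.v k x| :=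
        setIntegral_mono_set hvi (Eventually.of_forall fun x => abs_nonneg _)
          (ball_subset_closedBall.trans (S.hR2 j)).eventuallyLE
    _ = ∫ x in S.Ω, S.v k x := setIntegral_congr_fun S.hopen.measurableSet fun x hx =>
        abs_of_nonneg (S.v_nonneg k x (subset_closure hx))
    _ ≤ D ^ 2 / 4 * (∫ x in S.Ω, S.rho k x) + 2 * (volume S.Ω).toReal := h
    _ ≤ _ := by gcongr

theorem z_l1 {S : Setting m} (W : EigenData S) {n : ℕ} (hn : 1 ≤ n) (j : Fin m) (k : ℕ) :
    ∫ x in ball (S.xstar j) (2 * S.R), |z W n k x| ≤ ∫ x in ball (S.xstar j) (2 * S.R), |S.v k x| := by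
  have hsub : closedBall (S.xstar j) (2 * S.R) ⊆ closure S.Ω := (S.hR2 j).trans subset_closure
  refine setIntegral_mono_on ?_ ?_ measurableSet_ball fun x hx => ?_
  · exact (((z_cont W n k).abs.mono hsub).integrableOn_compact (isCompact_closedBall _ _)).mono_set ball_subset_closedBall
  · exact (((S.hv_cont k).abs.mono hsub).integrableOn_compact (isCompact_closedBall _ _)).mono_set ball_subset_closedBall
  · exact (z_bound W hn k x (hsub (ball_subset_closedBall hx))).trans (le_abs_self _)

theorem dsq_pos (S : Setting m) (j : Fin m) (k : ℕ) : 0 < S.rho k (S.xpt j k) := by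
  have h : S.xpt j k ∈ S.Ω := S.hR2 j (ball_subset_closedBall (ball_subset_ball (by linarith [S.hR]) (S.hxpt_mem j k)))
  have := S.hlam_pos k
  have := S.hVpos _ (subset_closure h)
  unfold rho; positivity

theorem xpt_mem (S : Setting m) (j : Fin m) (k : ℕ) : S.xpt j k ∈ S.Ω :=
  S.hR2 j (ball_subset_closedBall (ball_subset_ball (by linarith [S.hR]) (S.hxpt_mem j k)))

theorem ball_sub (S : Setting m) (j : Fin m) (k : ℕ) : ball (S.xpt j k) S.R ⊆ S.Ω := by
  intro x hx
  apply S.hR2 j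
  have := S.hxpt_mem j k
  rw [mem_ball] at *
  rw [mem_closedBall]
  linarith [dist_triangle x (S.xpt j k) (S.xstar j)]

theorem delta_pos (S : Setting m) (j : Fin m) (k : ℕ) : 0 < S.delta j k := by
  unfold delta
  have := S.dsq_pos j k
  exact inv_pos.2 (Real.sqrt_pos.2 this)

theorem delta_sq (S : Setting m) (j : Fin m) (k : ℕ) : S.rho k (S.xpt j k) * S.delta j k ^ 2 = 1 := by
  have := S.dsq_pos j k
  unfold delta
  change _ * ((√(S.rho k (S.xpt j k)))⁻¹) ^ 2 = 1
  rw [inv_pow, Real.sq_sqrt this.le]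
  field_simp

/-- pointwise bound of the density near the maximum point -/
theorem rho_le (S : Setting m) : ∃ C0, 0 ≤ C0 ∧ ∀ j k, ∀ x ∈ ball (S.xpt j k) S.R, S.rho k x ≤ C0 * S.rho k (S.xpt j k) := by
  obtain ⟨V0, V1, h0, h01, hV⟩ := S.V_bounds
  refine ⟨V1 / V0, by have := h0.trans_le h01; positivity, fun j k x hx => ?_⟩
  have hx1 := hV x (subset_closure (S.ball_sub j k hx))
  have hx2 := hV _ (subset_closure (S.xpt_mem j k))
  have hm := S.hxpt_max j k x hx
  have hl := S.hlam_pos k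
  have : V1 ≤ V1 / V0 * S.V (S.xpt j k) := by
    rw [div_mul_eq_mul_div, le_div_iff₀ h0]
    exact mul_le_mul_of_nonneg_left hx2.1 (by linarith)
  unfold rho
  calc S.lam k * S.V x * Real.exp (S.v k x) ≤ S.lam k * (V1 / V0 * S.V (S.xpt j k)) * Real.exp (S.v k (S.xpt j k)) := by
        have := hx1.2
        have : 0 ≤ S.V x := by linarith [hx1.1]
        have : 0 < S.V (S.xpt j k) := by linarith [hx2.1]
        have : 0 < V1 := by linarith
        gcongr
        linarith
    _ = _ := by ring

end Setting

end

noncomputable section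


theorem scale_int (F : E2 → ℝ) {d : ℝ} (hd : 0 < d) (a : E2) : ∫ Y, d ^ 2 * F (d • Y + a) = ∫ y, F y := by
  rw [integral_const_mul]
  have h := Measure.integral_comp_smul (volume : Measure E2) (fun y => F (y + a)) d
  rw [h, integral_add_right_eq_self F a, hdE, abs_of_pos (by positivity), smul_eq_mul]
  field_simp

theorem scale_integrable {F : E2 → ℝ} (hF : Integrable F) {d : ℝ} (hd : 0 < d) (a : E2) :
    Integrable (fun Y => d ^ 2 * F (d • Y + a)) :=
  ((hF.comp_add_right a).comp_smul hd.ne').const_mul _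

theorem scale_mem {d L : ℝ} (hd : 0 < d) (a Y : E2) : d • Y + a ∈ ball a (d * L) ↔ Y ∈ ball (0 : E2) L := by
  rw [mem_ball, mem_ball, dist_eq_norm, add_sub_cancel_right, norm_smul, Real.norm_eq_abs, abs_of_pos hd, dist_zero_right]
  exact mul_lt_mul_iff_right₀ hd

theorem scale_setInt (F : E2 → ℝ) {d : ℝ} (hd : 0 < d) (a : E2) (L : ℝ) :
    ∫ Y in ball 0 L, d ^ 2 * F (d • Y + a) = ∫ y in ball a (d * L), F y := by
  rw [← integral_indicator measurableSet_ball, ← integral_indicator measurableSet_ball]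
  refine Eq.trans ?_ (scale_int _ hd a)
  congr 1
  funext Y
  by_cases h : Y ∈ ball (0 : E2) L
  · rw [Set.indicator_of_mem h, Set.indicator_of_mem ((scale_mem hd a Y).2 h)]
  · rw [Set.indicator_of_notMem h, Set.indicator_of_notMem (fun h' => h ((scale_mem hd a Y).1 h')), mul_zero]

theorem rescale_repr (p : E2) {R : ℝ} (hR : 0 < R) : ∃ C : ℝ, 0 ≤ C ∧ ∀ {Ω : Set E2}, IsOpen Ω →
    closedBall p (2 * R) ⊆ Ω → ∀ {f g : E2 → ℝ}, ContDiffOn ℝ 2 f Ω → (∀ x ∈ Ω, -lap f x = g x) →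
    ContinuousOn g Ω → ∀ {d : ℝ}, 0 < d → ∀ a ∈ ball p (9 * R / 8), ∀ X : E2, d • X + a ∈ ball p (9 * R / 8) →
      |f (d • X + a) - f a + 1 / (2 * π) * ∫ Y, kk X Y * (d ^ 2 * (chi p R hR (d • Y + a) * g (d • Y + a)))| ≤
        C * (d * ‖X‖) * ∫ y in ball p (2 * R), |f y| := by
  obtain ⟨C, hC, h⟩ := repr_local p hR
  refine ⟨C, hC, ?_⟩
  intro Ω ho hΩ f g hf hg hgc d hd a ha X hX
  have h1 := (h ho hΩ hf hg hgc _ hX).2.2 a ha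
  rw [add_sub_cancel_right, norm_smul, Real.norm_eq_abs, abs_of_pos hd] at h1
  convert h1 using 4
  refine Eq.trans ?_ (scale_int _ hd a)
  have n1 : ∀ᵐ Y : E2, Y ≠ X := by simp [ae_iff, measure_singleton]
  have n2 : ∀ᵐ Y : E2, Y ≠ 0 := by simp [ae_iff, measure_singleton]
  refine integral_congr_ae ?_
  filter_upwards [n1, n2] with Y h1 h2
  have e1 : d • X + a - (d • Y + a) = d • (X - Y) := by rw [smul_sub]; abel
  have e2 : a - (d • Y + a) = -(d • Y) := by abel
  have p1 : ‖X - Y‖ ≠ 0 := norm_ne_zero_iff.2 (sub_ne_zero.2 h1.symm)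
  have p2 : ‖Y‖ ≠ 0 := norm_ne_zero_iff.2 h2
  rw [e1, e2, norm_neg, norm_smul, norm_smul, Real.norm_eq_abs, abs_of_pos hd, Real.log_mul hd.ne' p1, Real.log_mul hd.ne' p2]
  unfold kk
  ring

namespace Setting

variable {m : ℕ}

/-- cut-off density -/
def Q (S : Setting m) (j : Fin m) (k : ℕ) (x : E2) : ℝ := chi (S.xstar j) S.R S.hR x * S.rho k x

theorem chi_zero (S : Setting m) (j : Fin m) {x : E2} (hx : x ∉ ball (S.xstar j) (7 * S.R / 4)) :
    chi (S.xstar j) S.R S.hR x = 0 := by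
  apply ContDiffBump.zero_of_le_dist
  rw [mem_ball, not_lt] at hx
  exact hx

theorem chi_one (S : Setting m) (j : Fin m) {x : E2} (hx : x ∈ closedBall (S.xstar j) (5 * S.R / 4)) :
    chi (S.xstar j) S.R S.hR x = 1 := ContDiffBump.one_of_mem_closedBall _ hx

theorem sub_Om (S : Setting m) (j : Fin m) : ball (S.xstar j) (7 * S.R / 4) ⊆ S.Ω :=
  (ball_subset_closedBall.trans (closedBall_subset_closedBall (by linarith [S.hR]))).trans (S.hR2 j)

theorem Q_nonneg (S : Setting m) (j : Fin m) (k : ℕ) (x : E2) : 0 ≤ S.Q j k x := by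
  unfold Q
  by_cases hx : x ∈ ball (S.xstar j) (7 * S.R / 4)
  · exact mul_nonneg (ContDiffBump.nonneg _) (S.rho_nonneg k (subset_closure (S.sub_Om j hx)))
  · rw [S.chi_zero j hx, zero_mul]

theorem Q_le (S : Setting m) (j : Fin m) (k : ℕ) {x : E2} (hx : x ∈ closure S.Ω) : S.Q j k x ≤ S.rho k x :=
  mul_le_of_le_one_left (S.rho_nonneg k hx) (ContDiffBump.le_one _)

theorem Q_int (S : Setting m) (j : Fin m) (k : ℕ) : Integrable (S.Q j k) := by
  have h : IntegrableOn (S.Q j k) S.Ω := by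
    refine (S.rho_int k).mono' ?_ ?_
    · have h1 : AEStronglyMeasurable (fun x => chi (S.xstar j) S.R S.hR x) (volume.restrict S.Ω) :=
        (ContDiffBump.continuous _).aestronglyMeasurable
      exact h1.mul (S.rho_int k).1
    · rw [ae_restrict_iff' S.hopen.measurableSet]
      exact Eventually.of_forall fun x hx => by
        rw [Real.norm_eq_abs, abs_of_nonneg (S.Q_nonneg j k x)]; exact S.Q_le j k (subset_closure hx)
  refine (integrableOn_iff_integrable_of_support_subset fun x hx => ?_).1 h
  by_contra hn
  exact hx (by unfold Q; rw [S.chi_zero j (fun h' => hn (S.sub_Om j h')), zero_mul])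

theorem Q_mass (S : Setting m) (j : Fin m) (k : ℕ) : ∫ x, S.Q j k x ≤ ∫ x in S.Ω, S.rho k x := by
  have e : ∫ x, S.Q j k x = ∫ x in S.Ω, S.Q j k x :=
    (setIntegral_eq_integral_of_forall_compl_eq_zero fun x hx => by
      unfold Q; rw [S.chi_zero j (fun h' => hx (S.sub_Om j h')), zero_mul]).symm
  rw [e]
  exact setIntegral_mono_on (S.Q_int j k).integrableOn (S.rho_int k) S.hopen.measurableSet fun x hx => S.Q_le j k (subset_closure hx)

theorem delta_lim (S : Setting m) (j : Fin m) : Tendsto (S.delta j) atTop (𝓝 0) := by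
  obtain ⟨C, hC, hrep⟩ := repr_local (S.xstar j) S.hR
  obtain ⟨L, hL0, hL⟩ := S.v_l1
  obtain ⟨M, hM0, hM⟩ := S.rho_mass
  obtain ⟨C0, hC0, hρ⟩ := S.rho_le
  have hpi := Real.pi_pos
  have hR := S.hR
  set J := ∫ y in ball (0 : E2) S.R, ‖y‖ ^ (-1 : ℝ) with hJ
  have hbase : ∀ k, S.v k (S.xpt j k) ≤ (C * L + 1 / (2 * π) * (S.R⁻¹ * M)) + (1 / (2 * π) * (C0 * J)) * S.rho k (S.xpt j k) := by
    intro k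
    set a := S.xpt j k with ha
    have ha1 : a ∈ ball (S.xstar j) (9 * S.R / 8) := ball_subset_ball (by linarith) (S.hxpt_mem j k)
    obtain ⟨hi, hb, -⟩ := hrep S.hopen (S.hR2 j) (S.hv_reg k) (S.hPDE k)
      ((S.rho_cont k).mono subset_closure) a ha1
    have hb1 := (abs_le.1 hb).2
    have hCL : C * ∫ y in ball (S.xstar j) (2 * S.R), |S.v k y| ≤ C * L := mul_le_mul_of_nonneg_left (hL j k) hC
    obtain ⟨i1, i2⟩ := integrableOn_sub_rpow hdE one_lt_two S.R a
    have hdom : Integrable (fun y => (ball a S.R).indicator (fun y => ‖a - y‖ ^ (-1 : ℝ) * (C0 * S.rho k a)) y + S.R⁻¹ * S.Q j k y) :=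
      ((integrable_indicator_iff measurableSet_ball).2 (i1.mul_const _)).add ((S.Q_int j k).const_mul _)
    have hle : ∀ y, -(Real.log ‖a - y‖ * S.Q j k y) ≤
        (ball a S.R).indicator (fun y => ‖a - y‖ ^ (-1 : ℝ) * (C0 * S.rho k a)) y + S.R⁻¹ * S.Q j k y := by
      intro y
      have hq := S.Q_nonneg j k y
      have hlog : -Real.log ‖a - y‖ ≤ ‖a - y‖⁻¹ := by
        rw [← Real.log_inv]; exact (Real.log_le_self (by positivity))
      have h1 : -(Real.log ‖a - y‖ * S.Q j k y) ≤ ‖a - y‖⁻¹ * S.Q j k y := by nlinarith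
      by_cases hy : y ∈ ball a S.R
      · rw [Set.indicator_of_mem hy, Real.rpow_neg_one]
        have h2 : S.Q j k y ≤ C0 * S.rho k a := (S.Q_le j k (subset_closure (S.ball_sub j k hy))).trans (hρ j k y hy)
        have h3 : ‖a - y‖⁻¹ * S.Q j k y ≤ ‖a - y‖⁻¹ * (C0 * S.rho k a) := mul_le_mul_of_nonneg_left h2 (by positivity)
        have : 0 ≤ S.R⁻¹ * S.Q j k y := by positivity
        linarith
      · rw [Set.indicator_of_notMem hy, zero_add]
        refine h1.trans (mul_le_mul_of_nonneg_right ?_ hq)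
        rw [mem_ball, not_lt, dist_comm, dist_eq_norm] at hy
        exact inv_anti₀ hR hy
    have hintg : -(∫ y, Real.log ‖a - y‖ * S.Q j k y) ≤ J * (C0 * S.rho k a) + S.R⁻¹ * M := by
      rw [← integral_neg]
      have hi' : Integrable (fun y => Real.log ‖a - y‖ * S.Q j k y) := hi
      refine (integral_mono hi'.neg hdom hle).trans ?_
      rw [integral_add ((integrable_indicator_iff measurableSet_ball).2 (i1.mul_const _)) ((S.Q_int j k).const_mul _),
        integral_indicator measurableSet_ball, integral_mul_const, integral_const_mul, i2]
      have := (S.Q_mass j k).trans (hM k)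
      gcongr
    have hI : |S.v k a + 1 / (2 * π) * ∫ y, Real.log ‖a - y‖ * S.Q j k y| ≤ C * ∫ y in ball (S.xstar j) (2 * S.R), |S.v k y| := hb
    have hI2 := (abs_le.1 hI).2
    have h5 := mul_le_mul_of_nonneg_left hintg (show 0 ≤ 1 / (2 * π) by positivity)
    nlinarith
  have hJ0 : 0 ≤ J := integral_nonneg fun y => by positivity
  have hinf : Tendsto (fun k => S.rho k (S.xpt j k)) atTop atTop := by
    set B := 1 / (2 * π) * (C0 * J) with hB
    have hB0 : 0 ≤ B := by positivity
    have h1 : Tendsto (fun k => (S.v k (S.xpt j k) - (C * L + 1 / (2 * π) * (S.R⁻¹ * M))) / (B + 1)) atTop atTop :=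
      (tendsto_atTop_add_const_right _ _ (S.hxpt_blow j)).atTop_div_const (by positivity)
    refine tendsto_atTop_mono (fun k => ?_) h1
    rw [div_le_iff₀ (by positivity)]
    have := hbase k
    have := (S.dsq_pos j k).le
    nlinarith
  have : S.delta j = fun k => (√(S.rho k (S.xpt j k)))⁻¹ := rfl
  rw [this]
  exact (Real.tendsto_sqrt_atTop.comp hinf).inv_tendsto_atTop

end Setting

end

noncomputable section


theorem intU : ∫ y : E2, Real.exp (U y) = 8 * π := by
  simp only [expU]
  rw [radial_E2 (fun r => ((1 + 1 / 8 * r ^ 2) ^ 2)⁻¹), int_sq (by norm_num)]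
  ring

theorem U_eq (x : E2) : U x = -(2 * Real.log (1 + 1 / 8 * ‖x‖ ^ 2)) := by
  unfold U
  rw [one_div, Real.log_inv, Real.log_pow]
  push_cast
  ring_nf

theorem intUU : ∫ y : E2, Real.exp (U y) * U y = -(16 * π) := by
  simp only [expU]
  simp only [U_eq]
  have := radial_E2 (fun r => ((1 + 1 / 8 * r ^ 2) ^ 2)⁻¹ * -(2 * Real.log (1 + 1 / 8 * r ^ 2)))
  rw [this]
  have e : ∀ r : ℝ, r * (((1 + 1 / 8 * r ^ 2) ^ 2)⁻¹ * -(2 * Real.log (1 + 1 / 8 * r ^ 2))) =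
    -2 * (r * (((1 + 1 / 8 * r ^ 2) ^ 2)⁻¹ * Real.log (1 + 1 / 8 * r ^ 2))) := fun r => by ring
  simp only [e]
  rw [integral_const_mul, int_sq_log (by norm_num)]
  ring

theorem U_cont : Continuous U := by
  have : U = fun x => -(2 * Real.log (1 + 1 / 8 * ‖x‖ ^ 2)) := funext U_eq
  rw [this]
  exact (continuous_const.mul (Continuous.log (by fun_prop) fun x => by positivity)).neg

namespace Setting

variable {m : ℕ}

/-- rescaled density -/
def PP (S : Setting m) (j : Fin m) (k : ℕ) (Y : E2) : ℝ := S.delta j k ^ 2 * S.Q j k (S.delta j k • Y + S.xpt j k)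

/-- rescaled solution -/
def vt (S : Setting m) (j : Fin m) (k : ℕ) (Y : E2) : ℝ :=
  S.v k (S.delta j k • Y + S.xpt j k) - S.v k (S.xpt j k)

open Classical in
/-- the radius of validity -/
def rr (S : Setting m) (j : Fin m) (k : ℕ) : ℝ :=
  if dist (S.xpt j k) (S.xstar j) < S.R / 8 then S.R / S.delta j k else 0

theorem rr_ev (S : Setting m) (j : Fin m) : ∀ᶠ k in atTop, S.rr j k = S.R / S.delta j k := by
  have h := (S.hxpt_lim j).eventually (ball_mem_nhds (S.xstar j) (show 0 < S.R / 8 by linarith [S.hR]))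
  filter_upwards [h] with k hk
  unfold rr
  rw [if_pos (mem_ball.1 hk)]

theorem rr_lim (S : Setting m) (j : Fin m) : Tendsto (S.rr j) atTop atTop := by
  have h : Tendsto (fun k => S.R / S.delta j k) atTop atTop := by
    have h1 : Tendsto (S.delta j) atTop (𝓝[>] 0) :=
      tendsto_nhdsWithin_iff.2 ⟨S.delta_lim j, Eventually.of_forall fun k => S.delta_pos j k⟩
    have := h1.inv_tendsto_nhdsGT_zero.const_mul_atTop S.hR
    exact this
  refine h.congr' ?_
  filter_upwards [S.rr_ev j] with k hk
  exact hk.symm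

theorem rr_mem (S : Setting m) (j : Fin m) (k : ℕ) {Y : E2} (hY : Y ∈ ball (0 : E2) (S.rr j k)) :
    S.delta j k • Y + S.xpt j k ∈ ball (S.xpt j k) S.R ∧ S.xpt j k ∈ ball (S.xstar j) (9 * S.R / 8) ∧
      S.delta j k • Y + S.xpt j k ∈ ball (S.xstar j) (9 * S.R / 8) := by
  unfold rr at hY
  have hR := S.hR
  have hd := S.delta_pos j k
  split_ifs at hY with h
  · have h1 : S.delta j k • Y + S.xpt j k ∈ ball (S.xpt j k) S.R := by
      have := (scale_mem (L := S.R / S.delta j k) hd (S.xpt j k) Y).2 hY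
      rwa [mul_div_cancel₀ _ hd.ne'] at this
    refine ⟨h1, ?_, ?_⟩
    · rw [mem_ball]; linarith
    · rw [mem_ball] at h1 ⊢
      linarith [dist_triangle (S.delta j k • Y + S.xpt j k) (S.xpt j k) (S.xstar j)]
  · simp at hY

theorem PP_nonneg (S : Setting m) (j : Fin m) (k : ℕ) (Y : E2) : 0 ≤ S.PP j k Y :=
  mul_nonneg (sq_nonneg _) (S.Q_nonneg j k _)

theorem PP_int (S : Setting m) (j : Fin m) (k : ℕ) : Integrable (S.PP j k) :=
  scale_integrable (S.Q_int j k) (S.delta_pos j k) _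

theorem PP_mass (S : Setting m) (j : Fin m) (k : ℕ) : ∫ Y, S.PP j k Y = ∫ x, S.Q j k x :=
  scale_int _ (S.delta_pos j k) _

theorem PP_le (S : Setting m) : ∃ C0, 0 ≤ C0 ∧ ∀ j k, ∀ Y ∈ ball (0 : E2) (S.rr j k), S.PP j k Y ≤ C0 := by
  obtain ⟨C0, h0, h⟩ := S.rho_le
  refine ⟨C0, h0, fun j k Y hY => ?_⟩
  obtain ⟨h1, h2, h3⟩ := S.rr_mem j k hY
  have h4 := (S.Q_le j k (subset_closure (S.ball_sub j k h1))).trans (h j k _ h1)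
  have h5 := S.delta_sq j k
  calc S.PP j k Y ≤ S.delta j k ^ 2 * (C0 * S.rho k (S.xpt j k)) := mul_le_mul_of_nonneg_left h4 (sq_nonneg _)
    _ = C0 * (S.rho k (S.xpt j k) * S.delta j k ^ 2) := by ring
    _ = C0 := by rw [h5, mul_one]

theorem vt_nonpos (S : Setting m) (j : Fin m) (k : ℕ) {Y : E2} (hY : Y ∈ ball (0 : E2) (S.rr j k)) : S.vt j k Y ≤ 0 := by
  have := S.hxpt_max j k _ (S.rr_mem j k hY).1
  unfold vt
  linarith

theorem PP_eq (S : Setting m) (j : Fin m) (k : ℕ) {Y : E2} (hY : Y ∈ ball (0 : E2) (S.rr j k)) :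
    S.PP j k Y = S.V (S.delta j k • Y + S.xpt j k) / S.V (S.xpt j k) * Real.exp (S.vt j k Y) := by
  obtain ⟨h1, h2, h3⟩ := S.rr_mem j k hY
  have h5 := S.delta_sq j k
  have hV := S.hVpos _ (subset_closure (S.xpt_mem j k))
  have hc := S.chi_one j (x := S.delta j k • Y + S.xpt j k)
    (ball_subset_closedBall (ball_subset_ball (by linarith [S.hR]) h3))
  unfold PP Q vt
  rw [hc, one_mul, Real.exp_sub]
  unfold rho at h5 ⊢
  have he := Real.exp_pos (S.v k (S.xpt j k))
  have hl := S.hlam_pos k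
  have : S.delta j k ^ 2 = (S.lam k * S.V (S.xpt j k) * Real.exp (S.v k (S.xpt j k)))⁻¹ :=
    eq_inv_of_mul_eq_one_right h5
  rw [this]
  field_simp

theorem PP_rep (S : Setting m) (j : Fin m) : ∃ K, 0 ≤ K ∧ (∀ k, ∀ X ∈ ball (0 : E2) (S.rr j k),
      |S.vt j k X + 1 / (2 * π) * ∫ Y, kk X Y * S.PP j k Y| ≤ (K * S.delta j k) * ‖X‖) ∧
    ∀ (W : EigenData S) {n : ℕ}, 1 ≤ n → ∀ k, ∀ X ∈ ball (0 : E2) (S.rr j k),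
      |(z W n k (S.delta j k • X + S.xpt j k) - z W n k (S.xpt j k)) +
        1 / (2 * π) * ∫ Y, kk X Y * (S.PP j k Y * W.w n k (S.delta j k • Y + S.xpt j k))| ≤ (K * S.delta j k) * ‖X‖ := by
  obtain ⟨C, hC, h⟩ := rescale_repr (S.xstar j) S.hR
  obtain ⟨L, hL0, hL⟩ := S.v_l1
  refine ⟨C * L, by positivity, fun k X hX => ?_, fun W n hn k X hX => ?_⟩
  · obtain ⟨h1, h2, h3⟩ := S.rr_mem j k hX
    have hd := S.delta_pos j k
    have := h S.hopen (S.hR2 j) (S.hv_reg k) (S.hPDE k) ((S.rho_cont k).mono subset_closure) hd _ h2 X h3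
    refine le_trans this ?_
    calc _ ≤ C * (S.delta j k * ‖X‖) * L := by gcongr; exact hL j k
      _ = _ := by ring
  · obtain ⟨h1, h2, h3⟩ := S.rr_mem j k hX
    have hd := S.delta_pos j k
    have := h S.hopen (S.hR2 j) (z_reg W n k) (z_pde W hn k)
      (((S.rho_cont k).mul (W.hw_cont n k)).mono subset_closure) hd _ h2 X h3
    have e : ∀ Y, S.delta j k ^ 2 * (chi (S.xstar j) S.R S.hR (S.delta j k • Y + S.xpt j k) *
        (S.rho k (S.delta j k • Y + S.xpt j k) * W.w n k (S.delta j k • Y + S.xpt j k))) =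
        S.PP j k Y * W.w n k (S.delta j k • Y + S.xpt j k) := fun Y => by unfold PP Q; ring
    simp only [e] at this
    refine le_trans this ?_
    calc _ ≤ C * (S.delta j k * ‖X‖) * L := by gcongr; exact (z_l1 W hn j k).trans (hL j k)
      _ = _ := by ring

theorem pt_lim (S : Setting m) (j : Fin m) (Y : E2) :
    Tendsto (fun k => S.delta j k • Y + S.xpt j k) atTop (𝓝 (S.xstar j)) := by
  have := ((S.delta_lim j).smul_const Y).add (S.hxpt_lim j)
  simpa using this

theorem A_lim (S : Setting m) (j : Fin m) (Y : E2) :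
    Tendsto (fun k => S.V (S.delta j k • Y + S.xpt j k) / S.V (S.xpt j k)) atTop (𝓝 1) := by
  have hc : ContinuousAt S.V (S.xstar j) := S.hVreg.continuousOn.continuousAt
    (mem_of_superset (S.hopen.mem_nhds (S.hx_mem j)) subset_closure)
  have hp := S.hVpos _ (subset_closure (S.hx_mem j))
  have h1 := hc.tendsto.comp (S.pt_lim j Y)
  have h2 := hc.tendsto.comp (S.hxpt_lim j)
  have := h1.div h2 hp.ne'
  rw [div_self hp.ne'] at this
  exact this

theorem vt_lim (S : Setting m) (j : Fin m) (X : E2) : Tendsto (fun k => S.vt j k X) atTop (𝓝 (U X)) := by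
  obtain ⟨K, hK, hrep, -⟩ := S.PP_rep j
  obtain ⟨C0, hC0, hC⟩ := S.PP_le
  obtain ⟨M, hM0, hM⟩ := S.rho_mass
  refine bubble (S.rr_lim j) (ε := fun k => K * S.delta j k) (by simpa using (S.delta_lim j).const_mul K) hC0 (S.PP_nonneg j) (S.PP_int j)
    (M := M) (fun k => ?_) (hC j) (fun k y hy => S.vt_nonpos j k hy) (fun k y hy => S.PP_eq j k hy) (S.A_lim j) hrep X
  rw [S.PP_mass]
  exact (S.Q_mass j k).trans (hM k)

theorem PP_lim (S : Setting m) (j : Fin m) (Y : E2) : Tendsto (fun k => S.PP j k Y) atTop (𝓝 (Real.exp (U Y))) := by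
  have h := (S.A_lim j Y).mul ((S.vt_lim j Y).rexp)
  rw [one_mul] at h
  refine h.congr' ?_
  filter_upwards [(S.rr_lim j).eventually_gt_atTop ‖Y‖] with k hk
  exact (S.PP_eq j k (by simpa using hk)).symm

theorem expU_int (S : Setting m) : Integrable (fun y : E2 => Real.exp (U y)) := by
  obtain ⟨M, hM0, hM⟩ := S.rho_mass
  have j : Fin m := ⟨0, S.hm⟩
  refine fatou_int (S.PP_nonneg j) (S.PP_int j) (M := M) (fun k => ?_) U_cont.rexp.aestronglyMeasurable (S.PP_lim j)
  rw [S.PP_mass]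
  exact (S.Q_mass j k).trans (hM k)

theorem U_rep (S : Setting m) (x : E2) : U x = -(1 / (2 * π) * ∫ y, kk x y * Real.exp (U y)) := by
  have j : Fin m := ⟨0, S.hm⟩
  obtain ⟨K, hK, hrep, -⟩ := S.PP_rep j
  obtain ⟨C0, hC0, hC⟩ := S.PP_le
  obtain ⟨M, hM0, hM⟩ := S.rho_mass
  have h1 := kk_lim hdE (S.rr_lim j) (S.PP_nonneg j) (S.PP_int j) (M := M)
    (fun k => by rw [S.PP_mass]; exact (S.Q_mass j k).trans (hM k)) (hC j) (fun k => (S.PP_int j k).1)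
    (fun k y => (abs_of_nonneg (S.PP_nonneg j k y)).le) S.expU_int (S.PP_lim j) x
  have h2 := ((S.vt_lim j x).add (h1.const_mul (1 / (2 * π)))).abs
  have h3 : Tendsto (fun k => (K * S.delta j k) * ‖x‖) atTop (𝓝 0) := by
    simpa using ((S.delta_lim j).const_mul K).mul_const ‖x‖
  have h4 := le_of_tendsto_of_tendsto h2 h3 (by
    filter_upwards [(S.rr_lim j).eventually_gt_atTop ‖x‖] with k hk
    exact hrep k x (by simpa using hk))
  have := abs_eq_zero.1 (le_antisymm h4 (abs_nonneg _))
  linarith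

/-- local mass convergence -/
theorem PP_ball (S : Setting m) (j : Fin m) (L : ℝ) :
    Tendsto (fun k => ∫ Y in ball (0 : E2) L, S.PP j k Y) atTop (𝓝 (∫ Y in ball (0 : E2) L, Real.exp (U Y))) := by
  obtain ⟨C0, hC0, hC⟩ := S.PP_le
  refine tendsto_integral_filter_of_dominated_convergence (fun _ => C0)
    (Eventually.of_forall fun k => (S.PP_int j k).1.restrict) ?_ (integrableOn_const measure_ball_lt_top.ne)
    (Eventually.of_forall fun Y => S.PP_lim j Y)
  filter_upwards [(S.rr_lim j).eventually_gt_atTop L] with k hk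
  rw [ae_restrict_iff' measurableSet_ball]
  refine Eventually.of_forall fun Y hY => ?_
  rw [Real.norm_eq_abs, abs_of_nonneg (S.PP_nonneg j k Y)]
  exact hC j k Y (ball_subset_ball hk.le hY)

end Setting

end

noncomputable section


namespace Setting

variable {m : ℕ}

theorem dist_star (S : Setting m) {i j : Fin m} (h : i ≠ j) : 2 * S.R ≤ dist (S.xstar i) (S.xstar j) := by
  have := (disjoint_ball_ball_iff S.hR S.hR).1 (S.hRdisj i j h)
  linarith

theorem mass_split (S : Setting m) (j : Fin m) (k : ℕ) :
    (∫ x, S.Q j k x) + ∑ i ∈ Finset.univ.erase j, ∫ x in ball (S.xstar i) (S.R / 8), S.Q i k x ≤ ∫ x in S.Ω, S.rho k x := by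
  have hR := S.hR
  have hi : ∀ i, Integrable ((ball (S.xstar i) (S.R / 8)).indicator (S.Q i k)) := fun i =>
    (S.Q_int i k).indicator measurableSet_ball
  have e : ∑ i ∈ Finset.univ.erase j, ∫ x in ball (S.xstar i) (S.R / 8), S.Q i k x =
      ∫ x, ∑ i ∈ Finset.univ.erase j, (ball (S.xstar i) (S.R / 8)).indicator (S.Q i k) x := by
    rw [integral_finsetSum _ fun i _ => hi i]
    exact Finset.sum_congr rfl fun i _ => (integral_indicator measurableSet_ball).symm
  rw [e, ← integral_add (S.Q_int j k) (integrable_finsetSum _ fun i _ => hi i), ← integral_indicator S.hopen.measurableSet]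
  refine integral_mono ((S.Q_int j k).add (integrable_finsetSum _ fun i _ => hi i))
    ((integrable_indicator_iff S.hopen.measurableSet).2 (S.rho_int k)) fun x => ?_
  change S.Q j k x + ∑ i ∈ Finset.univ.erase j, (ball (S.xstar i) (S.R / 8)).indicator (S.Q i k) x ≤ S.Ω.indicator (S.rho k) x
  by_cases hx : ∃ i, i ≠ j ∧ x ∈ ball (S.xstar i) (S.R / 8)
  · obtain ⟨i, hij, hxi⟩ := hx
    have hxO : x ∈ S.Ω := S.sub_Om i (ball_subset_ball (by linarith) hxi)
    rw [mem_ball] at hxi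
    have h1 : S.Q j k x = 0 := by
      unfold Q
      rw [S.chi_zero j, zero_mul]
      rw [mem_ball, not_lt]
      have := S.dist_star hij
      have := dist_triangle (S.xstar i) x (S.xstar j)
      rw [dist_comm (S.xstar i) x] at this
      linarith
    rw [Finset.sum_eq_single i, h1, zero_add, Set.indicator_of_mem (mem_ball.2 hxi), Set.indicator_of_mem hxO]
    · exact S.Q_le i k (subset_closure hxO)
    · intro l _ hl
      apply Set.indicator_of_notMem
      rw [mem_ball, not_lt]
      have := S.dist_star hl.symm
      have := dist_triangle (S.xstar i) x (S.xstar l)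
      rw [dist_comm (S.xstar i) x] at this
      linarith
    · intro h
      exact absurd (Finset.mem_erase.2 ⟨hij, Finset.mem_univ i⟩) h
  · push Not at hx
    rw [Finset.sum_eq_zero, add_zero]
    · by_cases hxO : x ∈ S.Ω
      · rw [Set.indicator_of_mem hxO]; exact S.Q_le j k (subset_closure hxO)
      · rw [Set.indicator_of_notMem hxO]
        unfold Q
        rw [S.chi_zero j (fun h' => hxO (S.sub_Om j h')), zero_mul]
    · intro i hi
      exact Set.indicator_of_notMem (hx i (Finset.ne_of_mem_erase hi)) _

theorem tail (S : Setting m) (j : Fin m) : ∃ L, 1 ≤ L ∧ ∀ᶠ k in atTop,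
    8 * π - 1 ≤ ∫ Y in ball (0 : E2) L, S.PP j k Y ∧ ∫ Y in (ball (0 : E2) L)ᶜ, S.PP j k Y ≤ 1 := by
  have hm : (0 : ℝ) < m := by exact_mod_cast S.hm
  have hm1 : (1 : ℝ) ≤ m := by exact_mod_cast S.hm
  have hcov := (aecover_ball (μ := (volume : Measure E2)) (x := (0 : E2)) (r := fun n : ℝ => n) tendsto_id).integral_tendsto_of_countably_generated S.expU_int
  rw [intU] at hcov
  obtain ⟨L, hL, hL1⟩ := ((hcov.eventually (lt_mem_nhds (show 8 * π - 1 / (2 * m) < 8 * π by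
    have : 0 < 1 / (2 * (m : ℝ)) := by positivity
    linarith))).and (eventually_ge_atTop 1)).exists
  refine ⟨L, hL1, ?_⟩
  set I := ∫ Y in ball (0 : E2) L, Real.exp (U Y) with hI
  have hmass : Tendsto (fun k => (∫ x in S.Ω, S.rho k x) - ∑ i, ∫ Y in ball (0 : E2) L, S.PP i k Y) atTop
      (𝓝 (8 * π * m - ∑ i : Fin m, I)) :=
    S.hmass.sub (tendsto_finsetSum _ fun i _ => S.PP_ball i L)
  have hlt : 8 * π * m - ∑ i : Fin m, I < 1 := by
    rw [Finset.sum_const, Finset.card_univ, Fintype.card_fin, nsmul_eq_mul]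
    have : (m : ℝ) * (8 * π - 1 / (2 * m)) < m * I := mul_lt_mul_of_pos_left hL hm
    have e : (m : ℝ) * (8 * π - 1 / (2 * m)) = 8 * π * m - 1 / 2 := by field_simp
    linarith
  have hI1 : 8 * π - 1 < I := by
    have : 1 / (2 * (m : ℝ)) ≤ 1 := by rw [div_le_one (by positivity)]; linarith
    linarith
  have hball : ∀ i, ∀ᶠ k in atTop, ∫ Y in ball (0 : E2) L, S.PP i k Y ≤ ∫ x in ball (S.xstar i) (S.R / 8), S.Q i k x := by
    intro i
    have hR := S.hR
    have h1 : ∀ᶠ k in atTop, S.delta i k * L < S.R / 16 := by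
      have : Tendsto (fun k => S.delta i k * L) atTop (𝓝 0) := by simpa using (S.delta_lim i).mul_const L
      exact this.eventually (gt_mem_nhds (by positivity))
    have h2 := (S.hxpt_lim i).eventually (ball_mem_nhds (S.xstar i) (show 0 < S.R / 16 by positivity))
    filter_upwards [h1, h2] with k h1 h2
    have e : ∫ Y in ball (0 : E2) L, S.PP i k Y = ∫ x in ball (S.xpt i k) (S.delta i k * L), S.Q i k x :=
      scale_setInt _ (S.delta_pos i k) _ L
    rw [e]
    refine setIntegral_mono_set (S.Q_int i k).integrableOn (Eventually.of_forall fun x => S.Q_nonneg i k x) ?_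
    refine LE.le.eventuallyLE (ball_subset_ball' ?_)
    linarith
  filter_upwards [hmass.eventually (gt_mem_nhds hlt), (S.PP_ball j L).eventually (lt_mem_nhds hI1),
    eventually_all.2 hball] with k h1 h2 h3
  refine ⟨h2.le, ?_⟩
  have e1 := integral_add_compl (measurableSet_ball (x := (0 : E2)) (ε := L)) (S.PP_int j k)
  rw [S.PP_mass] at e1
  have e2 := S.mass_split j k
  have e3 : ∑ i ∈ Finset.univ.erase j, ∫ Y in ball (0 : E2) L, S.PP i k Y ≤
      ∑ i ∈ Finset.univ.erase j, ∫ x in ball (S.xstar i) (S.R / 8), S.Q i k x :=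
    Finset.sum_le_sum fun i _ => h3 i
  have e4 := Finset.add_sum_erase Finset.univ (fun i => ∫ Y in ball (0 : E2) L, S.PP i k Y) (Finset.mem_univ j)
  linarith

theorem decay (S : Setting m) (j : Fin m) : ∃ L C, 1 ≤ L ∧ ∀ᶠ k in atTop, ∀ X : E2, 2 * L ≤ ‖X‖ → ‖X‖ + 1 ≤ S.rr j k →
    S.vt j k X ≤ -(7 / 2) * Real.log ‖X‖ + C := by
  obtain ⟨L, hL, htail⟩ := S.tail j
  obtain ⟨K, hK, hrep, -⟩ := S.PP_rep j
  obtain ⟨C0, hC0, hC⟩ := S.PP_le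
  obtain ⟨M, hM0, hM⟩ := S.rho_mass
  set B := (Real.log L + Real.log 2 + Real.log 3) * M + C0 * JJ E2 1 with hB
  refine ⟨L, 1 / (2 * π) * B + K * S.R, hL, ?_⟩
  filter_upwards [htail, S.rr_ev j] with k hk hrr X hX1 hX2
  have hpi := Real.pi_pos
  have hX : X ∈ ball (0 : E2) (S.rr j k) := by rw [mem_ball_zero_iff]; linarith
  have hsub : ball X 1 ⊆ ball (0 : E2) (S.rr j k) := ball_subset_ball' (by rw [dist_zero_right]; linarith)
  have hsub' : ball (0 : E2) 1 ⊆ ball (0 : E2) (S.rr j k) := ball_subset_ball (by linarith [norm_nonneg X])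
  have h1 := kk_decay hdE (S.PP_nonneg j k) (S.PP_int j k) hL X (fun y hy => hC j k y (hsub hy)) (fun y hy => hC j k y (hsub' hy))
    (M := M) (by rw [S.PP_mass]; exact (S.Q_mass j k).trans (hM k)) hk.1 hk.2 hX1
  have h2 := (abs_le.1 (hrep k X hX)).2
  have hd := S.delta_pos j k
  have h3 : S.delta j k * ‖X‖ ≤ S.R := by
    have : ‖X‖ ≤ S.R / S.delta j k := by rw [← hrr]; linarith
    rw [le_div_iff₀ hd] at this
    linarith
  have h4 : K * S.delta j k * ‖X‖ ≤ K * S.R := by rw [mul_assoc]; exact mul_le_mul_of_nonneg_left h3 hK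
  have hlog : 0 ≤ Real.log ‖X‖ := Real.log_nonneg (by linarith)
  have h5 := mul_le_mul_of_nonneg_left h1 (show 0 ≤ 1 / (2 * π) by positivity)
  have h6 : 1 / (2 * π) * (-(8 * π - 1 - 1) * Real.log ‖X‖ + B) ≤ -(7 / 2) * Real.log ‖X‖ + 1 / (2 * π) * B := by
    have : 1 / (2 * π) * (8 * π - 1 - 1) = 4 - 1 / π := by field_simp; ring
    have h7 : 1 / π ≤ 1 / 2 := one_div_le_one_div_of_le (by norm_num) (by linarith [Real.pi_gt_three])
    have h8 : (7 / 2) * Real.log ‖X‖ ≤ (4 - 1 / π) * Real.log ‖X‖ := mul_le_mul_of_nonneg_right (by linarith) hlog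
    rw [← this] at h8
    linarith
  linarith

theorem PP_bound (S : Setting m) (j : Fin m) : ∃ C, 0 ≤ C ∧ ∀ᶠ k in atTop, ∀ X : E2, ‖X‖ + 1 ≤ S.rr j k →
    S.PP j k X ≤ C * (1 + ‖X‖) ^ (-(7 / 2) : ℝ) := by
  obtain ⟨L, C, hL, hdec⟩ := S.decay j
  obtain ⟨C0, hC0, hC⟩ := S.PP_le
  obtain ⟨V0, V1, h0, h01, hV⟩ := S.V_bounds
  have hV1 : 0 < V1 := by linarith
  refine ⟨C0 * (1 + 2 * L) ^ (7 / 2 : ℝ) + V1 / V0 * Real.exp C * 2 ^ (7 / 2 : ℝ), by positivity, ?_⟩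
  filter_upwards [hdec] with k hk X hX
  have hXm : X ∈ ball (0 : E2) (S.rr j k) := by rw [mem_ball_zero_iff]; linarith
  have hpos : 0 < (1 + ‖X‖) ^ (-(7 / 2) : ℝ) := by positivity
  rw [add_mul]
  rcases lt_or_ge ‖X‖ (2 * L) with h | h
  · have h1 : (1 : ℝ) ≤ (1 + 2 * L) ^ (7 / 2 : ℝ) * (1 + ‖X‖) ^ (-(7 / 2) : ℝ) := by
      rw [Real.rpow_neg (by positivity), ← div_eq_mul_inv, le_div_iff₀ (by positivity), one_mul]
      exact Real.rpow_le_rpow (by positivity) (by linarith) (by norm_num)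
    have h2 := hC j k X hXm
    have h3 : C0 * 1 ≤ C0 * ((1 + 2 * L) ^ (7 / 2 : ℝ) * (1 + ‖X‖) ^ (-(7 / 2) : ℝ)) := mul_le_mul_of_nonneg_left h1 hC0
    have h4 : 0 ≤ V1 / V0 * Real.exp C * 2 ^ (7 / 2 : ℝ) * (1 + ‖X‖) ^ (-(7 / 2) : ℝ) := by positivity
    rw [mul_one, ← mul_assoc] at h3
    linarith
  · have hx0 : 0 < ‖X‖ := by linarith
    have h1 := hk X h hX
    have h2 : Real.exp (S.vt j k X) ≤ Real.exp C * ‖X‖ ^ (-(7 / 2) : ℝ) := by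
      rw [Real.rpow_def_of_pos hx0, ← Real.exp_add]
      exact Real.exp_le_exp.2 (by linarith)
    have h3 : ‖X‖ ^ (-(7 / 2) : ℝ) ≤ 2 ^ (7 / 2 : ℝ) * (1 + ‖X‖) ^ (-(7 / 2) : ℝ) := by
      have : (2 : ℝ) ^ (7 / 2 : ℝ) * (1 + ‖X‖) ^ (-(7 / 2) : ℝ) = ((1 + ‖X‖) / 2) ^ (-(7 / 2) : ℝ) := by
        rw [Real.div_rpow (by positivity) (by norm_num), Real.rpow_neg (x := 2) (by norm_num)]
        field_simp
      rw [this]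
      exact Real.rpow_le_rpow_of_nonpos (by positivity) (by linarith) (by norm_num)
    rw [S.PP_eq j k hXm]
    obtain ⟨m1, -, m3⟩ := S.rr_mem j k hXm
    have b1 := hV _ (subset_closure (S.ball_sub j k m1))
    have b2 := hV _ (subset_closure (S.xpt_mem j k))
    have hA : S.V (S.delta j k • X + S.xpt j k) / S.V (S.xpt j k) ≤ V1 / V0 :=
      div_le_div₀ hV1.le b1.2 h0 b2.1
    have h5 : 0 ≤ C0 * (1 + 2 * L) ^ (7 / 2 : ℝ) * (1 + ‖X‖) ^ (-(7 / 2) : ℝ) := by positivity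
    calc _ ≤ V1 / V0 * (Real.exp C * (2 ^ (7 / 2 : ℝ) * (1 + ‖X‖) ^ (-(7 / 2) : ℝ))) := by
          refine mul_le_mul hA (h2.trans ?_) (Real.exp_pos _).le (by positivity)
          gcongr
      _ ≤ _ := by
          have : V1 / V0 * (Real.exp C * (2 ^ (7 / 2 : ℝ) * (1 + ‖X‖) ^ (-(7 / 2) : ℝ))) =
            V1 / V0 * Real.exp C * 2 ^ (7 / 2 : ℝ) * (1 + ‖X‖) ^ (-(7 / 2) : ℝ) := by ring
          linarith

theorem Qw_meas {S : Setting m} (W : EigenData S) (n : ℕ) (j : Fin m) (k : ℕ) :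
    AEStronglyMeasurable (fun x => S.Q j k x * W.w n k x) ∧ ∀ x, |S.Q j k x * W.w n k x| ≤ S.Q j k x := by
  constructor
  · have h : (fun x => S.Q j k x * W.w n k x) = fun x => S.Q j k x * (S.Ω.indicator (W.w n k) x) := by
      funext x
      by_cases hx : x ∈ S.Ω
      · rw [Set.indicator_of_mem hx]
      · unfold Q; rw [S.chi_zero j (fun h' => hx (S.sub_Om j h'))]; simp
    rw [h]
    have m1 := (S.Q_int j k).1
    have m2 : AEStronglyMeasurable (fun x => S.Ω.indicator (W.w n k) x) :=
      (aestronglyMeasurable_indicator_iff S.hopen.measurableSet).2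
        (((W.hw_cont n k).mono subset_closure).aestronglyMeasurable S.hopen.measurableSet)
    exact m1.mul m2
  · intro x
    have hq := S.Q_nonneg j k x
    rw [abs_mul, abs_of_nonneg hq]
    by_cases hx : x ∈ S.Ω
    · exact mul_le_of_le_one_right hq (W.hbound n k x (subset_closure hx))
    · unfold Q; rw [S.chi_zero j (fun h' => hx (S.sub_Om j h'))]; simp

theorem PPw_meas {S : Setting m} (W : EigenData S) (n : ℕ) (j : Fin m) (k : ℕ) :
    AEStronglyMeasurable (fun Y => S.PP j k Y * W.w n k (S.delta j k • Y + S.xpt j k)) ∧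
      ∀ Y, |S.PP j k Y * W.w n k (S.delta j k • Y + S.xpt j k)| ≤ S.PP j k Y := by
  obtain ⟨h1, h2⟩ := Qw_meas W n j k
  have e : (fun Y => S.PP j k Y * W.w n k (S.delta j k • Y + S.xpt j k)) =
    fun Y => S.delta j k ^ 2 * (S.Q j k (S.delta j k • Y + S.xpt j k) * W.w n k (S.delta j k • Y + S.xpt j k)) := by
    funext Y; unfold PP; ring
  have hI : Integrable (fun x => S.Q j k x * W.w n k x) := (S.Q_int j k).mono' h1 (Eventually.of_forall h2)
  constructor
  · rw [e]
    exact (scale_integrable hI (S.delta_pos j k) (S.xpt j k)).1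
  · intro Y
    unfold PP
    rw [mul_assoc, abs_mul, abs_of_nonneg (sq_nonneg _)]
    exact mul_le_mul_of_nonneg_left (h2 _) (sq_nonneg _)

/-- rescaled difference of the normalised eigenfunction -/
def zt {S : Setting m} (W : EigenData S) (n : ℕ) (j : Fin m) (k : ℕ) (X : E2) : ℝ :=
  z W n k (S.delta j k • X + S.xpt j k) - z W n k (S.xpt j k)

theorem zt_bound {S : Setting m} (W : EigenData S) {n : ℕ} (hn : 1 ≤ n) (j : Fin m) : ∃ C, 0 ≤ C ∧
    ∀ᶠ k in atTop, ∀ X : E2, ‖X‖ + 1 ≤ S.rr j k → |zt W n j k X| ≤ C * ‖X‖ := by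
  obtain ⟨K, hK, -, hrep⟩ := S.PP_rep j
  obtain ⟨C0, hC0, hC⟩ := S.PP_le
  obtain ⟨M, hM0, hM⟩ := S.rho_mass
  have hJ := JJ_nonneg (E := E2) 1
  have hpi := Real.pi_pos
  refine ⟨K + 1 / (2 * π) * (2 * (C0 * JJ E2 1 + M)), by positivity, ?_⟩
  filter_upwards [(S.delta_lim j).eventually (gt_mem_nhds one_pos)] with k hd1 X hX
  have hXm : X ∈ ball (0 : E2) (S.rr j k) := by rw [mem_ball_zero_iff]; linarith
  have hsub : ball X 1 ⊆ ball (0 : E2) (S.rr j k) := ball_subset_ball' (by rw [dist_zero_right]; linarith)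
  have hsub' : ball (0 : E2) 1 ⊆ ball (0 : E2) (S.rr j k) := ball_subset_ball (by linarith [norm_nonneg X])
  obtain ⟨m1, m2⟩ := PPw_meas W n j k
  have h1 := (kk_pot hdE (S.PP_nonneg j k) (S.PP_int j k) m1 m2 X (fun y hy => hC j k y (hsub hy)) (fun y hy => hC j k y (hsub' hy))).2
  have h2 := hrep W hn k X hXm
  have hmass : ∫ Y, S.PP j k Y ≤ M := by rw [S.PP_mass]; exact (S.Q_mass j k).trans (hM k)
  have h3 : ‖X‖ * (2 * (C0 * JJ E2 1 + ∫ Y, S.PP j k Y)) ≤ ‖X‖ * (2 * (C0 * JJ E2 1 + M)) := by gcongr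
  have h4 : K * S.delta j k * ‖X‖ ≤ K * ‖X‖ := by
    refine mul_le_mul_of_nonneg_right ?_ (norm_nonneg _)
    nlinarith
  set I := ∫ Y, kk X Y * (S.PP j k Y * W.w n k (S.delta j k • Y + S.xpt j k))
  have h5 : |zt W n j k X| ≤ |zt W n j k X + 1 / (2 * π) * I| + |1 / (2 * π) * I| := by
    have := abs_sub (zt W n j k X + 1 / (2 * π) * I) (1 / (2 * π) * I)
    rwa [add_sub_cancel_right] at this
  have h6 : |1 / (2 * π) * I| ≤ 1 / (2 * π) * (‖X‖ * (2 * (C0 * JJ E2 1 + M))) := by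
    rw [abs_mul, abs_of_pos (show 0 < 1 / (2 * π) by positivity)]
    exact mul_le_mul_of_nonneg_left (h1.trans h3) (by positivity)
  have h2' : |zt W n j k X + 1 / (2 * π) * I| ≤ K * S.delta j k * ‖X‖ := h2
  calc _ ≤ _ := h5
    _ ≤ K * ‖X‖ + 1 / (2 * π) * (‖X‖ * (2 * (C0 * JJ E2 1 + M))) := add_le_add (h2'.trans h4) h6
    _ = _ := by ring

theorem zt_lim {S : Setting m} (W : EigenData S) {n : ℕ} (hn : 1 ≤ n) (j : Fin m) {φ : ℕ → ℕ}
    (hφ : Tendsto φ atTop atTop) {c : ℝ}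
    (hw : ∀ Y : E2, Tendsto (fun k => W.w n (φ k) (S.delta j (φ k) • Y + S.xpt j (φ k))) atTop (𝓝 c)) (X : E2) :
    Tendsto (fun k => zt W n j (φ k) X) atTop (𝓝 (c * U X)) := by
  obtain ⟨K, hK, -, hrep⟩ := S.PP_rep j
  obtain ⟨C0, hC0, hC⟩ := S.PP_le
  obtain ⟨M, hM0, hM⟩ := S.rho_mass
  have h1 := kk_lim hdE (q := fun y => Real.exp (U y) * c) ((S.rr_lim j).comp hφ) (P := fun k => S.PP j (φ k))
    (Q := fun k Y => S.PP j (φ k) Y * W.w n (φ k) (S.delta j (φ k) • Y + S.xpt j (φ k)))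
    (fun k => S.PP_nonneg j (φ k)) (fun k => S.PP_int j (φ k)) (M := M)
    (fun k => by rw [S.PP_mass]; exact (S.Q_mass j _).trans (hM _)) (fun k => hC j (φ k))
    (fun k => (PPw_meas W n j (φ k)).1) (fun k => (PPw_meas W n j (φ k)).2) (S.expU_int.mul_const c)
    (fun y => ((S.PP_lim j y).comp hφ).mul (hw y)) X
  have e : ∫ y, kk X y * (Real.exp (U y) * c) = c * ∫ y, kk X y * Real.exp (U y) := by
    rw [← integral_const_mul]; congr 1; funext y; ring
  rw [e] at h1
  have h3 : Tendsto (fun k => (K * S.delta j (φ k)) * ‖X‖) atTop (𝓝 0) := by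
    simpa using (((S.delta_lim j).comp hφ).const_mul K).mul_const ‖X‖
  have h4 : Tendsto (fun k => zt W n j (φ k) X + 1 / (2 * π) *
      ∫ Y, kk X Y * (S.PP j (φ k) Y * W.w n (φ k) (S.delta j (φ k) • Y + S.xpt j (φ k)))) atTop (𝓝 0) := by
    refine squeeze_zero_norm' ?_ h3
    filter_upwards [((S.rr_lim j).comp hφ).eventually_gt_atTop ‖X‖] with k hk
    exact hrep W hn (φ k) X (by simpa using hk)
  have h5 := h4.sub (h1.const_mul (1 / (2 * π)))
  simp only [add_sub_cancel_right] at h5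
  have e2 : 0 - 1 / (2 * π) * (c * ∫ y, kk X y * Real.exp (U y)) = c * U X := by rw [S.U_rep X]; ring
  rwa [e2] at h5

end Setting

end

noncomputable section


namespace Setting

variable {m : ℕ}

theorem inner_lim {S : Setting m} (W : EigenData S) {n : ℕ} (hn : 1 ≤ n) (j : Fin m) {φ : ℕ → ℕ}
    (hφ : Tendsto φ atTop atTop) {c : ℝ}
    (hw : ∀ Y : E2, Tendsto (fun k => W.w n (φ k) (S.delta j (φ k) • Y + S.xpt j (φ k))) atTop (𝓝 c)) :
    Tendsto (fun k => ∫ x in ball (S.xpt j (φ k)) (S.R / 2), S.rho (φ k) x * (z W n (φ k) x - z W n (φ k) (S.xpt j (φ k))))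
      atTop (𝓝 (-16 * π * c)) := by
  obtain ⟨C1, hC1, hP⟩ := S.PP_bound j
  obtain ⟨C2, hC2, hZ⟩ := zt_bound W hn j
  have hR := S.hR
  have key : Tendsto (fun k => ∫ X, (ball (0 : E2) (S.R / 2 / S.delta j (φ k))).indicator
      (fun X => S.PP j (φ k) X * zt W n j (φ k) X) X) atTop (𝓝 (∫ X, Real.exp (U X) * (c * U X))) := by
    have hbig := ((S.rr_lim j).comp hφ).eventually_ge_atTop 2
    have hev := hφ.eventually (S.rr_ev j)
    refine tendsto_integral_filter_of_dominated_convergence (fun X => C1 * C2 * (1 + ‖X‖) ^ (-(5 / 2) : ℝ)) ?_ ?_ ?_ ?_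
    · filter_upwards [hev] with k hk
      rw [aestronglyMeasurable_indicator_iff measurableSet_ball]
      have m1 := (S.PP_int j (φ k)).1.restrict (s := ball (0 : E2) (S.R / 2 / S.delta j (φ k)))
      have m2 : AEStronglyMeasurable (fun X => zt W n j (φ k) X) (volume.restrict (ball (0 : E2) (S.R / 2 / S.delta j (φ k)))) := by
        refine ContinuousOn.aestronglyMeasurable ?_ measurableSet_ball
        unfold zt
        refine ContinuousOn.sub ?_ continuousOn_const
        refine (z_cont W n (φ k)).comp (by fun_prop) ?_
        intro X hX
        have hX2 : X ∈ ball (0 : E2) (S.rr j (φ k)) := by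
          rw [hk]
          refine ball_subset_ball ?_ hX
          have := S.delta_pos j (φ k)
          gcongr
          linarith
        exact subset_closure (S.ball_sub j _ (S.rr_mem j _ hX2).1)
      exact m1.mul m2
    · filter_upwards [hφ.eventually hP, hφ.eventually hZ, hev, hbig] with k h1 h2 h3 h4
      refine Eventually.of_forall fun X => ?_
      by_cases hX : X ∈ ball (0 : E2) (S.R / 2 / S.delta j (φ k))
      · rw [Set.indicator_of_mem hX, norm_mul, Real.norm_eq_abs, Real.norm_eq_abs, abs_of_nonneg (S.PP_nonneg j _ X)]
        have hX2 : ‖X‖ + 1 ≤ S.rr j (φ k) := by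
          rw [mem_ball_zero_iff] at hX
          simp only [Function.comp] at h4
          have e : S.R / 2 / S.delta j (φ k) = S.rr j (φ k) / 2 := by rw [h3]; ring
          rw [e] at hX
          linarith
        have e2 : (1 + ‖X‖) ^ (-(5 / 2) : ℝ) = (1 + ‖X‖) ^ (-(7 / 2) : ℝ) * (1 + ‖X‖) := by
          rw [show (-(5 / 2) : ℝ) = -(7 / 2) + 1 by norm_num, Real.rpow_add_one (by positivity)]
        calc _ ≤ C1 * (1 + ‖X‖) ^ (-(7 / 2) : ℝ) * (C2 * (1 + ‖X‖)) := by
              refine mul_le_mul (h1 X hX2) ((h2 X hX2).trans ?_) (abs_nonneg _) (by positivity)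
              exact mul_le_mul_of_nonneg_left (by linarith) hC2
          _ = _ := by rw [e2]; ring
      · rw [Set.indicator_of_notMem hX, norm_zero]; positivity
    · exact (integrable_one_add_norm (by rw [hdE]; norm_num)).const_mul _
    · refine Eventually.of_forall fun X => ?_
      have h1 := ((S.PP_lim j X).comp hφ).mul (zt_lim W hn j hφ hw X)
      refine h1.congr' ?_
      filter_upwards [hev, ((S.rr_lim j).comp hφ).eventually_gt_atTop (2 * ‖X‖)] with k h3 h4
      have hX : X ∈ ball (0 : E2) (S.R / 2 / S.delta j (φ k)) := by
        rw [mem_ball_zero_iff]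
        simp only [Function.comp] at h4
        have e : S.R / 2 / S.delta j (φ k) = S.rr j (φ k) / 2 := by rw [h3]; ring
        rw [e]
        linarith
      rw [Set.indicator_of_mem hX]
      rfl
  have e : ∫ X, Real.exp (U X) * (c * U X) = -16 * π * c := by
    have : ∀ X, Real.exp (U X) * (c * U X) = c * (Real.exp (U X) * U X) := fun X => by ring
    simp only [this]
    rw [integral_const_mul, intUU]; ring
  rw [e] at key
  refine key.congr' ?_
  filter_upwards [hφ.eventually (S.rr_ev j)] with k hk
  have hd := S.delta_pos j (φ k)
  have h1 := scale_setInt (fun x => S.rho (φ k) x * (z W n (φ k) x - z W n (φ k) (S.xpt j (φ k)))) hd (S.xpt j (φ k)) (S.R / 2 / S.delta j (φ k))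
  rw [mul_div_cancel₀ _ hd.ne'] at h1
  rw [← h1, integral_indicator measurableSet_ball]
  refine setIntegral_congr_fun measurableSet_ball fun X hX => ?_
  have hX2 : X ∈ ball (0 : E2) (S.rr j (φ k)) := by
    rw [hk]
    refine ball_subset_ball ?_ hX
    gcongr
    linarith
  have hc := S.chi_one j (x := S.delta j (φ k) • X + S.xpt j (φ k))
    (ball_subset_closedBall (ball_subset_ball (by linarith) (S.rr_mem j _ hX2).2.2))
  simp only [PP, Q, zt, hc]
  ring

end Setting

/-- Jensen's inequality for a subprobability density -/
theorem exp_jensen {f q : E2 → ℝ} (hq0 : ∀ y, 0 ≤ q y) (hqi : Integrable q) (hq1 : ∫ y, q y ≤ 1)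
    (hfi : Integrable (fun y => f y * q y)) (hei : Integrable (fun y => Real.exp (f y) * q y)) :
    Real.exp (∫ y, f y * q y) ≤ 1 + ∫ y, Real.exp (f y) * q y := by
  set a := ∫ y, f y * q y with ha
  set μ := ∫ y, q y with hμ
  have hμ0 : 0 ≤ μ := integral_nonneg hq0
  have h1 : ∫ y, (Real.exp a * (1 - a) * q y + Real.exp a * (f y * q y)) ≤ ∫ y, Real.exp (f y) * q y := by
    refine integral_mono ((hqi.const_mul _).add (hfi.const_mul _)) hei fun y => ?_
    have h2 : Real.exp a * (1 + f y - a) ≤ Real.exp (f y) := by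
      have h3 := Real.add_one_le_exp (f y - a)
      have h4 : Real.exp (f y) = Real.exp a * Real.exp (f y - a) := by rw [← Real.exp_add]; congr 1; ring
      rw [h4]
      exact mul_le_mul_of_nonneg_left (by linarith) (Real.exp_pos _).le
    have := mul_le_mul_of_nonneg_right h2 (hq0 y)
    simp only
    linarith
  rw [integral_add (hqi.const_mul _) (hfi.const_mul _), integral_const_mul, integral_const_mul] at h1
  have h5 : Real.exp a * (1 - a) ≤ 1 := by
    have h6 := Real.add_one_le_exp (-a)
    calc Real.exp a * (1 - a) ≤ Real.exp a * Real.exp (-a) := mul_le_mul_of_nonneg_left (by linarith) (Real.exp_pos _).le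
      _ = 1 := by rw [← Real.exp_add, add_neg_cancel, Real.exp_zero]
  have h7 : (1 - μ) * (Real.exp a * (1 - a)) ≤ (1 - μ) * 1 := mul_le_mul_of_nonneg_left h5 (by linarith)
  have e : Real.exp a = (1 - μ) * (Real.exp a * (1 - a)) + (Real.exp a * (1 - a) * μ + Real.exp a * a) := by ring
  linarith

/-- truncated inverse distance kernel -/
def kap (t : E2) : ℝ := (ball (0 : E2) 1).indicator (fun t => ‖t‖ ^ (-1 : ℝ)) t

theorem kap_int : Integrable kap :=
  (integrable_indicator_iff measurableSet_ball).2 (integrableOn_norm_rpow hdE one_lt_two 1)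

theorem kap_nonneg (t : E2) : 0 ≤ kap t := Set.indicator_nonneg (fun t _ => by positivity) t

/-- the positive part of minus the logarithm -/
def lpl (t : E2) : ℝ := max 0 (-Real.log ‖t‖)

theorem lpl_facts (t : E2) : lpl t ≤ kap t ∧ Real.exp (lpl t) ≤ 1 + kap t := by
  have hk := kap_nonneg t
  unfold lpl
  rcases le_or_gt (-Real.log ‖t‖) 0 with h | h
  · rw [max_eq_left h, Real.exp_zero]
    exact ⟨hk, by linarith⟩
  · rw [max_eq_right h.le]
    have hl : Real.log ‖t‖ < 0 := by linarith
    have ht0 : 0 < ‖t‖ := by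
      rcases (norm_nonneg t).eq_or_lt with h' | h'
      · rw [← h', Real.log_zero] at hl; exact absurd hl (lt_irrefl _)
      · exact h'
    have ht1 : ‖t‖ < 1 := by
      by_contra hn
      exact absurd (Real.log_nonneg (not_lt.1 hn)) (not_le.2 hl)
    have e : kap t = ‖t‖⁻¹ := by
      unfold kap
      rw [Set.indicator_of_mem (by simpa using ht1), Real.rpow_neg_one]
    rw [e, ← Real.log_inv, Real.exp_log (by positivity)]
    exact ⟨Real.log_le_self (by positivity), by linarith⟩

theorem lpl_meas (x : E2) : Measurable (fun y => lpl (x - y)) := by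
  unfold lpl
  exact measurable_const.max (Real.measurable_log.comp (by fun_prop)).neg

theorem kap_conv {q : E2 → ℝ} (hqi : Integrable q) : (∀ᵐ x : E2, Integrable (fun y => q y * kap (x - y))) ∧
    Integrable (fun x => ∫ y, q y * kap (x - y)) ∧ ∫ x, ∫ y, q y * kap (x - y) = (∫ y, q y) * ∫ y, kap y := by
  have h := hqi.convolution_integrand (ContinuousLinearMap.mul ℝ ℝ) kap_int
  refine ⟨h.prod_right_ae, h.integral_prod_left, ?_⟩
  exact integral_convolution (ContinuousLinearMap.mul ℝ ℝ) hqi kap_int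

namespace Setting

variable {m : ℕ}

theorem ann_exp (S : Setting m) (j : Fin m) : ∃ C, 0 ≤ C ∧ ∀ᶠ k in atTop,
    ∫ x in ball (S.xpt j k) S.R \ ball (S.xpt j k) (S.R / 2), Real.exp (2 * S.v k x) ≤ C := by
  obtain ⟨C1, hC1, hrep⟩ := repr_local (S.xstar j) S.hR
  obtain ⟨L1, hL10, hL1⟩ := S.v_l1
  obtain ⟨M, hM0, hM⟩ := S.rho_mass
  obtain ⟨L, hL, htail⟩ := S.tail j
  have hR := S.hR
  have hpi := Real.pi_pos
  set D := Real.exp (2 * (C1 * L1) + 1 / π * (|Real.log (S.R / 4)| * M)) with hD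
  have hk0 : 0 ≤ ∫ y, kap y := integral_nonneg kap_nonneg
  refine ⟨D * (2 * (volume (ball (0 : E2) S.R)).toReal + ∫ y, kap y), by positivity, ?_⟩
  have hbig := (S.rr_lim j).eventually_ge_atTop (4 * L)
  have hnear := (S.hxpt_lim j).eventually (ball_mem_nhds (S.xstar j) (show 0 < S.R / 8 by positivity))
  filter_upwards [htail, hbig, S.rr_ev j, hnear] with k htail hbig hrr hnear
  have hd := S.delta_pos j k
  set a := S.xpt j k with ha
  set A := ball a S.R \ ball a (S.R / 2) with hA
  have hAm : MeasurableSet A := measurableSet_ball.diff measurableSet_ball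
  set Q2 := (ball a (S.R / 4))ᶜ.indicator (S.Q j k) with hQ2
  have hQ20 : ∀ y, 0 ≤ Q2 y := fun y => Set.indicator_nonneg (fun y _ => S.Q_nonneg j k y) y
  have hQ2i : Integrable Q2 := (S.Q_int j k).indicator measurableSet_ball.compl
  have hQ21 : ∫ y, Q2 y ≤ 1 := by
    rw [hQ2, integral_indicator measurableSet_ball.compl]
    have e1 := integral_add_compl (measurableSet_ball (x := a) (ε := S.R / 4)) (S.Q_int j k)
    have e2 := integral_add_compl (measurableSet_ball (x := (0 : E2)) (ε := L)) (S.PP_int j k)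
    have e3 : ∫ Y in ball (0 : E2) L, S.PP j k Y = ∫ x in ball a (S.delta j k * L), S.Q j k x :=
      scale_setInt _ hd _ L
    have e4 : ∫ x in ball a (S.delta j k * L), S.Q j k x ≤ ∫ x in ball a (S.R / 4), S.Q j k x := by
      refine setIntegral_mono_set (S.Q_int j k).integrableOn (Eventually.of_forall fun x => S.Q_nonneg j k x) ?_
      refine LE.le.eventuallyLE (ball_subset_ball ?_)
      rw [hrr, le_div_iff₀ hd] at hbig
      linarith
    rw [S.PP_mass] at e2
    linarith [htail.2]
  obtain ⟨c1, c2, c3⟩ := kap_conv hQ2i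
  have hpt : ∀ᵐ x : E2, x ∈ A → Real.exp (2 * S.v k x) ≤ D * (2 + ∫ y, Q2 y * kap (x - y)) := by
    filter_upwards [c1] with x hx hxA
    have hxp : x ∈ ball (S.xstar j) (9 * S.R / 8) := by
      have h1 := hxA.1
      rw [mem_ball] at h1 ⊢
      have h2 : dist a (S.xstar j) < S.R / 8 := hnear
      linarith [dist_triangle x a (S.xstar j)]
    obtain ⟨hi, hb, -⟩ := hrep S.hopen (S.hR2 j) (S.hv_reg k) (S.hPDE k)
      ((S.rho_cont k).mono subset_closure) x hxp
    have hi' : Integrable (fun y => Real.log ‖x - y‖ * S.Q j k y) := hi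
    have hb' : |S.v k x + 1 / (2 * π) * ∫ y, Real.log ‖x - y‖ * S.Q j k y| ≤ C1 * ∫ y in ball (S.xstar j) (2 * S.R), |S.v k y| := hb
    have hb1 := (abs_le.1 hb').2
    have hCL : C1 * ∫ y in ball (S.xstar j) (2 * S.R), |S.v k y| ≤ C1 * L1 := mul_le_mul_of_nonneg_left (hL1 j k) hC1
    have hlpi : Integrable (fun y => lpl (x - y) * Q2 y) := by
      refine hx.mono' ?_ (Eventually.of_forall fun y => ?_)
      · have m1 := (lpl_meas x).aestronglyMeasurable (μ := (volume : Measure E2))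
        exact m1.mul hQ2i.1
      · have : 0 ≤ lpl (x - y) := le_max_left _ _
        rw [Real.norm_eq_abs, abs_of_nonneg (mul_nonneg this (hQ20 y)), mul_comm]
        exact mul_le_mul_of_nonneg_left (lpl_facts _).1 (hQ20 y)
    have hsum : Integrable (fun y => Q2 y + Q2 y * kap (x - y)) := hQ2i.add hx
    have hexp_le : ∀ y, Real.exp (lpl (x - y)) * Q2 y ≤ Q2 y + Q2 y * kap (x - y) := by
      intro y
      have := mul_le_mul_of_nonneg_right (lpl_facts (x - y)).2 (hQ20 y)
      linarith
    have hexpi : Integrable (fun y => Real.exp (lpl (x - y)) * Q2 y) := by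
      refine hsum.mono' ?_ (Eventually.of_forall fun y => ?_)
      · have m1 := (Real.measurable_exp.comp (lpl_meas x)).aestronglyMeasurable (μ := (volume : Measure E2))
        exact m1.mul hQ2i.1
      · rw [Real.norm_eq_abs, abs_of_nonneg (mul_nonneg (Real.exp_pos _).le (hQ20 y))]
        exact hexp_le y
    have hlog : -(∫ y, Real.log ‖x - y‖ * S.Q j k y) ≤ |Real.log (S.R / 4)| * M + ∫ y, lpl (x - y) * Q2 y := by
      rw [← integral_neg]
      have hle : ∀ y, -(Real.log ‖x - y‖ * S.Q j k y) ≤ |Real.log (S.R / 4)| * S.Q j k y + lpl (x - y) * Q2 y := by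
        intro y
        have hq := S.Q_nonneg j k y
        by_cases hy : y ∈ ball a (S.R / 4)
        · have e : Q2 y = 0 := by
            rw [hQ2]
            exact Set.indicator_of_notMem (Set.notMem_compl_iff.2 hy) _
          rw [e, mul_zero, add_zero, ← neg_mul]
          refine mul_le_mul_of_nonneg_right ?_ hq
          have hxa := hxA.2
          rw [mem_ball, not_lt] at hxa
          rw [mem_ball] at hy
          have h1 : S.R / 4 ≤ ‖x - y‖ := by
            rw [← dist_eq_norm]
            linarith [dist_triangle x y a]
          have h2 := Real.log_le_log (by positivity) h1
          linarith [neg_abs_le (Real.log (S.R / 4))]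
        · have e : Q2 y = S.Q j k y := by
            rw [hQ2]
            exact Set.indicator_of_mem (Set.mem_compl hy) _
          rw [e]
          have h1 : -Real.log ‖x - y‖ ≤ lpl (x - y) := le_max_right _ _
          have h2 := mul_le_mul_of_nonneg_right h1 hq
          have h3 : 0 ≤ |Real.log (S.R / 4)| * S.Q j k y := by positivity
          linarith
      have hmono : ∫ y, -(Real.log ‖x - y‖ * S.Q j k y) ≤ ∫ y, (|Real.log (S.R / 4)| * S.Q j k y + lpl (x - y) * Q2 y) :=
        integral_mono hi'.neg (((S.Q_int j k).const_mul _).add hlpi) hle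
      refine hmono.trans ?_
      rw [integral_add ((S.Q_int j k).const_mul _) hlpi, integral_const_mul]
      have := (S.Q_mass j k).trans (hM k)
      gcongr
    set I := ∫ y, lpl (x - y) * Q2 y with hI
    have hI0 : 0 ≤ I := integral_nonneg fun y => mul_nonneg (le_max_left _ _) (hQ20 y)
    have hj : Real.exp I ≤ 2 + ∫ y, Q2 y * kap (x - y) := by
      have h1 := exp_jensen (f := fun y => lpl (x - y)) hQ20 hQ2i hQ21 hlpi hexpi
      have h2 := integral_mono hexpi hsum hexp_le
      rw [integral_add hQ2i hx] at h2
      linarith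
    have hv : 2 * S.v k x ≤ (2 * (C1 * L1) + 1 / π * (|Real.log (S.R / 4)| * M)) + I := by
      have h1 := mul_le_mul_of_nonneg_left hlog (show 0 ≤ 1 / π by positivity)
      have h2 : 1 / π * I ≤ I := mul_le_of_le_one_left hI0 (by
        rw [div_le_one hpi]; linarith [Real.pi_gt_three])
      have e : ∀ t : ℝ, 2 * (1 / (2 * π) * t) = 1 / π * t := fun t => by field_simp
      have h3 := e (∫ y, Real.log ‖x - y‖ * S.Q j k y)
      linarith
    calc Real.exp (2 * S.v k x) ≤ Real.exp ((2 * (C1 * L1) + 1 / π * (|Real.log (S.R / 4)| * M)) + I) := Real.exp_le_exp.2 hv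
      _ = D * Real.exp I := Real.exp_add _ _
      _ ≤ _ := mul_le_mul_of_nonneg_left hj (Real.exp_pos _).le
  have hAv : volume A ≠ ⊤ := ((measure_mono Set.sdiff_subset).trans_lt measure_ball_lt_top).ne
  have hc2 : IntegrableOn (fun _ : E2 => (2 : ℝ)) A := integrableOn_const hAv
  have hi2 : IntegrableOn (fun x => D * (2 + ∫ y, Q2 y * kap (x - y))) A :=
    (hc2.add c2.integrableOn).const_mul D
  have hvc : IntegrableOn (fun x => Real.exp (2 * S.v k x)) A := by
    have hcont : ContinuousOn (fun x => Real.exp (2 * S.v k x)) (closure S.Ω) :=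
      (continuousOn_const.mul (S.hv_cont k)).rexp
    exact (hcont.integrableOn_compact S.cpt).mono_set
      ((Set.sdiff_subset.trans (S.ball_sub j k)).trans subset_closure)
  have h1 : ∫ x in A, Real.exp (2 * S.v k x) ≤ ∫ x in A, D * (2 + ∫ y, Q2 y * kap (x - y)) :=
    setIntegral_mono_on_ae hvc hi2 hAm hpt
  refine h1.trans ?_
  rw [integral_const_mul, integral_add hc2 c2.integrableOn, setIntegral_const, smul_eq_mul]
  have hc4 : ∫ x in A, ∫ y, Q2 y * kap (x - y) ≤ ∫ y, kap y := by
    have h2 := setIntegral_le_integral (s := A) c2 (Eventually.of_forall fun x => integral_nonneg fun y => mul_nonneg (hQ20 y) (kap_nonneg _))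
    rw [c3] at h2
    exact h2.trans (mul_le_of_le_one_left hk0 hQ21)
  have hvol : volume.real A ≤ (volume (ball (0 : E2) S.R)).toReal := by
    have : volume (ball (0 : E2) S.R) = volume (ball a S.R) := (Measure.addHaar_ball_center volume a S.R).symm
    rw [this]
    exact ENNReal.toReal_mono measure_ball_lt_top.ne (measure_mono Set.sdiff_subset)
  refine mul_le_mul_of_nonneg_left ?_ (Real.exp_pos _).le
  linarith

theorem lam_v (S : Setting m) (j : Fin m) : Tendsto (fun k => S.lam k * S.v k (S.xpt j k)) atTop (𝓝 0) := by
  obtain ⟨L, C, hL, hdec⟩ := S.decay j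
  obtain ⟨V0, V1, h0, h01, hV⟩ := S.V_bounds
  have hR := S.hR
  set B := (C - 7 / 4 * Real.log V0 - 7 / 2 * Real.log (S.R / 2)) with hB
  have hb : ∀ᶠ k in atTop, S.v k (S.xpt j k) ≤ 4 / 3 * (-(7 / 4) * Real.log (S.lam k) + B) := by
    filter_upwards [hdec, S.rr_ev j, (S.rr_lim j).eventually_ge_atTop (4 * L)] with k h1 h2 h3
    have hd := S.delta_pos j k
    set a := S.xpt j k with ha
    set X : E2 := EuclideanSpace.single 0 (S.rr j k / 2) with hX
    have hXn : ‖X‖ = S.rr j k / 2 := by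
      rw [hX, EuclideanSpace.norm_single, Real.norm_eq_abs, abs_of_nonneg (by linarith)]
    have h4 := h1 X (by rw [hXn]; linarith) (by rw [hXn]; linarith)
    have hXm : X ∈ ball (0 : E2) (S.rr j k) := by rw [mem_ball_zero_iff, hXn]; linarith
    have h5 := S.v_nonneg k _ (subset_closure (S.ball_sub j k (S.rr_mem j k hXm).1))
    unfold vt at h4
    have hV0 := (hV a (subset_closure (S.xpt_mem j k))).1
    have hVa : 0 < S.V a := by linarith
    have hl := S.hlam_pos k
    have hlogX : Real.log ‖X‖ = Real.log (S.R / 2) + 1 / 2 * (Real.log (S.lam k) + Real.log (S.V a) + S.v k a) := by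
      have e1 : ‖X‖ = S.R / 2 * √(S.rho k a) := by
        rw [hXn, h2]
        have : S.delta j k = (√(S.rho k a))⁻¹ := rfl
        rw [this, div_inv_eq_mul]; ring
      have hp := S.dsq_pos j k
      rw [e1, Real.log_mul (by positivity) (Real.sqrt_pos.2 hp).ne', Real.log_sqrt hp.le]
      unfold rho
      rw [Real.log_mul (by positivity) (Real.exp_pos _).ne', Real.log_mul hl.ne' hVa.ne', Real.log_exp]
      ring
    have h6 := Real.log_le_log h0 hV0
    rw [hlogX] at h4
    linarith
  have hlim : Tendsto (fun k => S.lam k * (4 / 3 * (-(7 / 4) * Real.log (S.lam k) + B))) atTop (𝓝 0) := by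
    have h1 : Tendsto (fun k => S.lam k * Real.log (S.lam k)) atTop (𝓝 (0 * Real.log 0)) :=
      (Real.continuous_mul_log.tendsto 0).comp S.hlam0
    have h2 := h1.const_mul (-(7 / 3))
    have h3 := h2.add (S.hlam0.mul_const (4 / 3 * B))
    simp only [mul_zero, zero_mul, add_zero] at h3
    refine h3.congr fun k => ?_
    ring
  refine squeeze_zero' (Eventually.of_forall fun k => ?_) ?_ hlim
  · exact mul_nonneg (S.hlam_pos k).le (S.v_nonneg k _ (subset_closure (S.xpt_mem j k)))
  · filter_upwards [hb] with k hk
    exact mul_le_mul_of_nonneg_left hk (S.hlam_pos k).le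

theorem outer_lim {S : Setting m} (W : EigenData S) {n : ℕ} (hn : 1 ≤ n) (j : Fin m) :
    Tendsto (fun k => ∫ x in ball (S.xpt j k) S.R \ ball (S.xpt j k) (S.R / 2),
      S.rho k x * (z W n k x - z W n k (S.xpt j k))) atTop (𝓝 0) := by
  obtain ⟨C, hC, hexp⟩ := S.ann_exp j
  obtain ⟨V0, V1, h0, h01, hV⟩ := S.V_bounds
  have hlim : Tendsto (fun k => V1 * (S.lam k + S.lam k * S.v k (S.xpt j k)) * C) atTop (𝓝 0) := by
    have := ((S.hlam0.add (S.lam_v j)).const_mul V1).mul_const C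
    simpa using this
  refine squeeze_zero_norm' ?_ hlim
  filter_upwards [hexp] with k hk
  set a := S.xpt j k with ha
  set A := ball a S.R \ ball a (S.R / 2) with hA
  have hAm : MeasurableSet A := measurableSet_ball.diff measurableSet_ball
  have hva := S.v_nonneg k a (subset_closure (S.xpt_mem j k))
  have hl := S.hlam_pos k
  have hsub : A ⊆ closure S.Ω := (Set.sdiff_subset.trans (S.ball_sub j k)).trans subset_closure
  have hvc : IntegrableOn (fun x => Real.exp (2 * S.v k x)) A := by
    have hcont : ContinuousOn (fun x => Real.exp (2 * S.v k x)) (closure S.Ω) :=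
      (continuousOn_const.mul (S.hv_cont k)).rexp
    exact (hcont.integrableOn_compact S.cpt).mono_set hsub
  have h1 : ‖∫ x in A, S.rho k x * (z W n k x - z W n k a)‖ ≤
      ∫ x in A, V1 * (S.lam k + S.lam k * S.v k a) * Real.exp (2 * S.v k x) := by
    refine norm_integral_le_of_norm_le (hvc.const_mul _) ?_
    rw [ae_restrict_iff' hAm]
    refine Eventually.of_forall fun x hx => ?_
    have hx' := hsub hx
    have hv := S.v_nonneg k x hx'
    have hz : |z W n k x - z W n k a| ≤ S.v k x + S.v k a :=
      (abs_sub _ _).trans (add_le_add (z_bound W hn k x hx') (z_bound W hn k a (subset_closure (S.xpt_mem j k))))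
    rw [norm_mul, Real.norm_eq_abs, Real.norm_eq_abs, abs_of_nonneg (S.rho_nonneg k hx')]
    have hVx := hV x hx'
    have hev : S.v k x ≤ Real.exp (S.v k x) := by linarith [Real.add_one_le_exp (S.v k x)]
    have hone : 1 ≤ Real.exp (S.v k x) := Real.one_le_exp hv
    have e2 : Real.exp (2 * S.v k x) = Real.exp (S.v k x) * Real.exp (S.v k x) := by rw [← Real.exp_add]; ring_nf
    have h3 : S.v k x + S.v k a ≤ (1 + S.v k a) * Real.exp (S.v k x) := by nlinarith
    unfold rho
    calc S.lam k * S.V x * Real.exp (S.v k x) * |z W n k x - z W n k a|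
        ≤ S.lam k * V1 * Real.exp (S.v k x) * ((1 + S.v k a) * Real.exp (S.v k x)) := by
          have : 0 ≤ S.V x := by linarith [hVx.1]
          have : 0 < V1 := by linarith
          refine mul_le_mul ?_ (hz.trans h3) (abs_nonneg _) (by positivity)
          have := hVx.2
          gcongr
      _ = _ := by rw [e2]; ring
  refine h1.trans ?_
  rw [integral_const_mul]
  refine mul_le_mul_of_nonneg_left hk ?_
  have : 0 < V1 := by linarith
  positivity

end Setting

end

/-- `∫_{B_R(x_{j,k})} λ_k V e^{v_k} (wⁿ_k − wⁿ_k(x_{j,k}))/μⁿ_k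
  = −16π cⁿ_j + o(1)`. -/
theorem statement15 {m : ℕ} (S : Setting m) (W : EigenData S)
    (φ : ℕ → ℕ) (hφ : StrictMono φ) (c : ℕ → Fin m → ℝ)
    (hc : ∀ n, 1 ≤ n → n ≤ m → IsLimitVec S W φ n (c n)) :
    ∀ n, 1 ≤ n → n ≤ m → ∀ j : Fin m, ∃ err : ℕ → ℝ, Tendsto err atTop (𝓝 0) ∧
      ∀ᶠ k in atTop,
        (∫ x in ball (S.xpt j (φ k)) S.R, S.lam (φ k) * S.V x * Real.exp (S.v (φ k) x) *
          ((W.w n (φ k) x - W.w n (φ k) (S.xpt j (φ k))) / W.mu n (φ k))) =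
        -16 * π * c n j + err k := by
  intro n hn1 hnm j
  have hw : ∀ Y : E2, Tendsto (fun k => W.w n (φ k) (S.delta j (φ k) • Y + S.xpt j (φ k))) atTop (𝓝 (c n j)) :=
    fun Y => (TendstoLocallyUniformly.tendstoLocallyUniformlyOn (s := Set.univ) ((hc n hn1 hnm).2 j)).tendsto_at (Set.mem_univ Y)
  have h1 := Setting.inner_lim W hn1 j hφ.tendsto_atTop hw
  have h2 := (Setting.outer_lim W hn1 j).comp hφ.tendsto_atTop
  have h3 := h1.add h2
  rw [add_zero] at h3
  have hR := S.hR
  have heq : ∀ k, (∫ x in ball (S.xpt j (φ k)) S.R, S.lam (φ k) * S.V x * Real.exp (S.v (φ k) x) *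
          ((W.w n (φ k) x - W.w n (φ k) (S.xpt j (φ k))) / W.mu n (φ k))) =
      (∫ x in ball (S.xpt j (φ k)) (S.R / 2), S.rho (φ k) x * (Setting.z W n (φ k) x - Setting.z W n (φ k) (S.xpt j (φ k)))) +
      ∫ x in ball (S.xpt j (φ k)) S.R \ ball (S.xpt j (φ k)) (S.R / 2),
        S.rho (φ k) x * (Setting.z W n (φ k) x - Setting.z W n (φ k) (S.xpt j (φ k))) := by
    intro k
    have e : ∀ x, S.lam (φ k) * S.V x * Real.exp (S.v (φ k) x) *
          ((W.w n (φ k) x - W.w n (φ k) (S.xpt j (φ k))) / W.mu n (φ k)) =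
        S.rho (φ k) x * (Setting.z W n (φ k) x - Setting.z W n (φ k) (S.xpt j (φ k))) := by
      intro x
      unfold Setting.rho Setting.z
      ring
    simp only [e]
    have hcont : ContinuousOn (fun x => S.rho (φ k) x * (Setting.z W n (φ k) x - Setting.z W n (φ k) (S.xpt j (φ k))))
        (closure S.Ω) := (S.rho_cont (φ k)).mul ((Setting.z_cont W n (φ k)).sub continuousOn_const)
    have hi := (hcont.integrableOn_compact (μ := volume) S.cpt).mono_set ((S.ball_sub j (φ k)).trans subset_closure)
    have hs : ball (S.xpt j (φ k)) (S.R / 2) ⊆ ball (S.xpt j (φ k)) S.R := ball_subset_ball (by linarith)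
    rw [← integral_inter_add_sdiff measurableSet_ball hi, Set.inter_eq_right.2 hs]
  refine ⟨fun k => (∫ x in ball (S.xpt j (φ k)) S.R, S.lam (φ k) * S.V x * Real.exp (S.v (φ k) x) *
          ((W.w n (φ k) x - W.w n (φ k) (S.xpt j (φ k))) / W.mu n (φ k))) - (-16 * π * c n j), ?_, ?_⟩
  · have h4 := h3.sub_const (-16 * π * c n j)
    rw [sub_self] at h4
    refine h4.congr fun k => ?_
    rw [heq k]
    rfl
  · exact Eventually.of_forall fun k => by ring
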